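/- arXiv:0903.1588 — 3 statements merged into one kernel-verified Lean document; each statement's English description precedes it below -/
import Mathlib

section
/- Theorem 2 (growth rate of the stopping set size distribution). Suppose r = p = 2, i.e., both the smallest CN minimum distance and the smallest VN minimum distance equal 2. Then the growth rate of the stopping set size distribution satisfies G_ss(alpha) = alpha log( 1 / P^{-1}(1/C) ) + O(alpha^{3/2}), where P(x) = 2 sum_{t in X_v} (lambda_t/q_t) sum_i theta_{i,2}^{(t)} x^i and C = 2 sum_{t in X_c} rho_t phi_2^{(t)}/s_t (and these coincide with the corresponding weight-enumerator quantities, since theta_{u,2}^{(t)} = B_{u,2}^{(t)} and phi_2^{(t)} = A_2^{(t)} when the minimum distances are 2). -/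
open Filter Polynomial Finset Matrix
open scoped Classical

/-- A D-GLDPC code ensemble specified by generator matrices: check-node (CN) types
`Fin nc` with lengths `s`, dimensions `hdim`, minimum distances `rd` and full-rank
generator matrices `Gc` over `𝔽₂`; variable-node (VN) types `Fin nv` with dimensions
`kdim`, lengths `q`, minimum distances `pd` and full-rank generator matrices `Gv`;
and edge fractions `ρ`, `lam`. -/
structure DGLDPCss where
  nc : ℕ
  nv : ℕ
  hnc : 0 < nc
  hnv : 0 < nv
  s : Fin nc → ℕ
  hdim : Fin nc → ℕ
  rd : Fin nc → ℕ
  Gc : (t : Fin nc) → Matrix (Fin (hdim t)) (Fin (s t)) (ZMod 2)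
  kdim : Fin nv → ℕ
  q : Fin nv → ℕ
  pd : Fin nv → ℕ
  Gv : (t : Fin nv) → Matrix (Fin (kdim t)) (Fin (q t)) (ZMod 2)
  ρ : Fin nc → ℝ
  lam : Fin nv → ℝ
  h_hdim : ∀ t, 1 ≤ hdim t
  h_hs : ∀ t, hdim t < s t
  h_k1 : ∀ t, 1 ≤ kdim t
  h_q1 : ∀ t, 1 ≤ q t
  -- the generator matrices are full rank
  hGcRank : ∀ t, LinearIndependent (ZMod 2) (fun i => Gc t i)
  hGvRank : ∀ t, LinearIndependent (ZMod 2) (fun i => Gv t i)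
  -- `rd t` (resp. `pd t`) is the minimum distance of the local CN (resp. VN) code
  hrd : ∀ t, rd t = sInf {w : ℕ | ∃ u : Fin (hdim t) → ZMod 2,
    Matrix.vecMul u (Gc t) ≠ 0 ∧
    w = (Finset.univ.filter (fun j => Matrix.vecMul u (Gc t) j ≠ 0)).card}
  hpd : ∀ t, pd t = sInf {w : ℕ | ∃ u : Fin (kdim t) → ZMod 2,
    Matrix.vecMul u (Gv t) ≠ 0 ∧
    w = (Finset.univ.filter (fun j => Matrix.vecMul u (Gv t) j ≠ 0)).card}
  h_rd2 : ∀ t, 2 ≤ rd t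
  h_pd2 : ∀ t, 2 ≤ pd t
  hρpos : ∀ t, 0 < ρ t
  hlampos : ∀ t, 0 < lam t
  hρsum : ∑ t, ρ t = 1
  hlamsum : ∑ t, lam t = 1

namespace DGLDPCss

variable (M : DGLDPCss)

noncomputable def intrho : ℝ := ∑ t, M.ρ t / (M.s t : ℝ)

noncomputable def intlam : ℝ := ∑ t, M.lam t / (M.q t : ℝ)

/-- `r`: the smallest CN minimum distance. -/
noncomputable def r : ℕ := sInf (Set.range M.rd)

/-- `p`: the smallest VN minimum distance. -/
noncomputable def p : ℕ := sInf (Set.range M.pd)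

/-- `φ_u^{(t)}`: the number of `u`-element subsets `T` of the columns of `G_t` such that
every column in `T` lies outside the `𝔽₂`-span of the columns not in `T`
(local stopping sets of size `u` of CN type `t`). -/
noncomputable def phi (t : Fin M.nc) (u : ℕ) : ℕ :=
  Set.ncard {Ts : Finset (Fin (M.s t)) | Ts.card = u ∧
    ∀ j ∈ Ts, (M.Gc t)ᵀ j ∉
      Submodule.span (ZMod 2) ((M.Gc t)ᵀ '' {j' : Fin (M.s t) | j' ∉ Ts})}

/-- The columns of `G'_t = [G_t | I_{k_t}]`: code-bit columns indexed by `Fin (q t)`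
and identity columns indexed by `Fin (kdim t)`. -/
noncomputable def colv (t : Fin M.nv) :
    Fin (M.q t) ⊕ Fin (M.kdim t) → (Fin (M.kdim t) → ZMod 2) :=
  Sum.elim (fun j => (M.Gv t)ᵀ j) (fun i => Pi.single i 1)

/-- `θ_{u,v}^{(t)}`: the number of pairs `(U,V)` with `U` a `u`-element subset of the
identity columns and `V` a `v`-element subset of the code-bit columns of
`G'_t = [G_t | I_{k_t}]`, such that every selected column lies outside the `𝔽₂`-span of
the non-selected columns (local stopping sets of split size `(u,v)` of VN type `t`). -/
noncomputable def theta (t : Fin M.nv) (u v : ℕ) : ℕ :=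
  Set.ncard {UV : Finset (Fin (M.kdim t)) × Finset (Fin (M.q t)) |
    UV.1.card = u ∧ UV.2.card = v ∧
    ∀ c : Fin (M.q t) ⊕ Fin (M.kdim t), Sum.elim (· ∈ UV.2) (· ∈ UV.1) c →
      M.colv t c ∉ Submodule.span (ZMod 2)
        (M.colv t '' {c' : Fin (M.q t) ⊕ Fin (M.kdim t) |
          ¬ Sum.elim (· ∈ UV.2) (· ∈ UV.1) c'})}

noncomputable def En (n : ℕ) : ℕ := ⌊(n : ℝ) / M.intlam⌋₊

noncomputable def cExp (n : ℕ) (t : Fin M.nc) : ℕ := ⌊(M.En n : ℝ) * M.ρ t / (M.s t : ℝ)⌋₊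

noncomputable def vExp (n : ℕ) (t : Fin M.nv) : ℕ := ⌊(M.En n : ℝ) * M.lam t / (M.q t : ℝ)⌋₊

/-- The CN stopping set size enumerating polynomial `Φ^{(t)}(x)`. -/
noncomputable def Phipoly (t : Fin M.nc) : Polynomial ℝ :=
  ∑ u ∈ Finset.range (M.s t + 1), Polynomial.C ((M.phi t u : ℕ) : ℝ) * Polynomial.X ^ u

/-- The VN stopping set split size enumerating polynomial `Θ^{(t)}(x,y)`, with the outer
variable recording input (information bit) erasures and the inner variable recording
code-bit erasures. -/
noncomputable def Thetapoly (t : Fin M.nv) : Polynomial (Polynomial ℝ) :=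
  ∑ u ∈ Finset.range (M.kdim t + 1),
    Polynomial.C (∑ v ∈ Finset.range (M.q t + 1),
      Polynomial.C ((M.theta t u v : ℕ) : ℝ) * Polynomial.X ^ v) * Polynomial.X ^ u

/-- `N_c^Φ(v)`: the coefficient of `x^v` in `∏_t (Φ^{(t)}(x))^{γ_t m}`. -/
noncomputable def NcCount (n v : ℕ) : ℝ := (∏ t, M.Phipoly t ^ M.cExp n t).coeff v

/-- `N_v^Θ(u,v)`: the coefficient of `x^u y^v` in `∏_t (Θ^{(t)}(x,y))^{δ_t n}`. -/
noncomputable def NvCount (n u v : ℕ) : ℝ := ((∏ t, M.Thetapoly t ^ M.vExp n t).coeff u).coeff v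

/-- The expected number of stopping sets of size `w`:
`E[N_w^{ss}] = ∑_v N_v^Θ(w,v) N_c^Φ(v) / binom(E,v)`. -/
noncomputable def ENss (n w : ℕ) : ℝ :=
  ∑ v ∈ Finset.range (M.En n + 1),
    M.NvCount n w v * M.NcCount n v / ((M.En n).choose v : ℝ)

/-- Admissibility of `n` for `α`: all relevant quantities are integers and the expected
number of size-`α n` stopping sets is positive. -/
def Adm (α : ℝ) (n : ℕ) : Prop :=
  0 < n ∧ ((M.En n : ℝ) = (n : ℝ) / M.intlam) ∧
  (∀ t, (M.cExp n t : ℝ) = (M.En n : ℝ) * M.ρ t / (M.s t : ℝ)) ∧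
  (∀ t, (M.vExp n t : ℝ) = (M.En n : ℝ) * M.lam t / (M.q t : ℝ)) ∧
  ((⌊α * (n : ℝ)⌋₊ : ℝ) = α * (n : ℝ)) ∧
  0 < M.ENss n ⌊α * (n : ℝ)⌋₊

/-- The sequence `(1/n) log E[N_{αn}^{ss}]` whose limit is `G_{ss}(α)`. -/
noncomputable def grSeq (α : ℝ) (n : ℕ) : ℝ :=
  (1 / (n : ℝ)) * Real.log (M.ENss n ⌊α * (n : ℝ)⌋₊)

/-- `P(x) = 2 ∑_{t ∈ X_v} (λ_t/q_t) ∑_i θ_{i,2}^{(t)} x^i` (for the case `r = p = 2`). -/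
noncomputable def Pfun (x : ℝ) : ℝ :=
  2 * ∑ t ∈ Finset.univ.filter (fun t => M.pd t = M.p),
    (M.lam t / (M.q t : ℝ)) *
      ∑ i ∈ Finset.range (M.kdim t + 1), (M.theta t i 2 : ℝ) * x ^ i

/-- `C = 2 ∑_{t ∈ X_c} ρ_t φ_2^{(t)} / s_t` (for the case `r = p = 2`). -/
noncomputable def Cparam : ℝ :=
  2 * ∑ t ∈ Finset.univ.filter (fun t => M.rd t = M.r),
    M.ρ t * (M.phi t 2 : ℝ) / (M.s t : ℝ)

end DGLDPCss

section
theorem exists_dot_of_notMem_span {k : ℕ} {S : Set (Fin k → ZMod 2)} {x : Fin k → ZMod 2}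
    (hx : x ∉ Submodule.span (ZMod 2) S) :
    ∃ u : Fin k → ZMod 2, (∀ s ∈ S, u ⬝ᵥ s = 0) ∧ u ⬝ᵥ x ≠ 0 := by
  obtain ⟨f, hf, hle⟩ := Submodule.exists_le_ker_of_notMem hx
  have key : ∀ z : Fin k → ZMod 2, (fun i => f (Pi.single i 1)) ⬝ᵥ z = f z := by
    intro z
    conv_rhs => rw [LinearMap.pi_apply_eq_sum_univ f z]
    simp only [dotProduct, smul_eq_mul]
    refine Finset.sum_congr rfl fun i _ => ?_
    rw [mul_comm]
    congr 2
    ext j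
    simp [Pi.single_apply, eq_comm]
  refine ⟨fun i => f (Pi.single i 1), fun s hs => ?_, ?_⟩
  · rw [key]; exact hle (Submodule.subset_span hs)
  · rw [key]; exact hf

theorem notMem_span_of_dot {k : ℕ} {S : Set (Fin k → ZMod 2)} {x u : Fin k → ZMod 2}
    (h : ∀ s ∈ S, u ⬝ᵥ s = 0) (hx : u ⬝ᵥ x ≠ 0) : x ∉ Submodule.span (ZMod 2) S := by
  intro hm
  apply hx; clear hx
  induction hm using Submodule.span_induction with
  | mem s hs => exact h s hs
  | zero => simp
  | add a b _ _ ha hb => rw [dotProduct_add, ha, hb, add_zero]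
  | smul c a _ ha => rw [dotProduct_smul, ha, smul_zero]

/-- generic bound on minimum distance by local stopping sets -/
theorem mindist_le {k q d : ℕ} (G : Matrix (Fin k) (Fin q) (ZMod 2))
    (hd : d = sInf {w : ℕ | ∃ u : Fin k → ZMod 2, Matrix.vecMul u G ≠ 0 ∧
      w = (Finset.univ.filter (fun j => Matrix.vecMul u G j ≠ 0)).card})
    (V : Finset (Fin q)) (u : Fin k → ZMod 2) (hu : ∀ j, j ∉ V → u ⬝ᵥ Gᵀ j = 0)
    (j : Fin q) (hj : u ⬝ᵥ Gᵀ j ≠ 0) : d ≤ V.card := by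
  have h1 : d ≤ (Finset.univ.filter (fun j => Matrix.vecMul u G j ≠ 0)).card := by
    rw [hd]
    apply Nat.sInf_le
    exact ⟨u, fun h => hj (congrFun h j), rfl⟩
  refine h1.trans (Finset.card_le_card ?_)
  intro i hi
  by_contra hiV
  exact (Finset.mem_filter.1 hi).2 (hu i hiV)

theorem mindist_attained {k q d : ℕ} (G : Matrix (Fin k) (Fin q) (ZMod 2)) (hpos : 0 < d)
    (hd : d = sInf {w : ℕ | ∃ u : Fin k → ZMod 2, Matrix.vecMul u G ≠ 0 ∧
      w = (Finset.univ.filter (fun j => Matrix.vecMul u G j ≠ 0)).card}) :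
    ∃ (u : Fin k → ZMod 2) (V : Finset (Fin q)), V.card = d ∧ (∀ j, j ∈ V ↔ u ⬝ᵥ Gᵀ j ≠ 0) := by
  have hne := Nat.nonempty_of_pos_sInf (hd ▸ hpos)
  obtain ⟨u, hu, hw⟩ := Nat.sInf_mem hne
  refine ⟨u, (Finset.univ.filter (fun j => Matrix.vecMul u G j ≠ 0)), by rw [hd, hw], ?_⟩
  intro j
  simp only [Finset.mem_filter, Finset.mem_univ, true_and]
  rfl

namespace DGLDPCss
variable (M : DGLDPCss)

theorem phi_zero (t : Fin M.nc) : M.phi t 0 = 1 := by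
  unfold phi
  rw [Set.ncard_eq_one]
  refine ⟨∅, ?_⟩
  ext T
  simp only [Set.mem_ofPred_eq, Set.mem_singleton_iff, Finset.card_eq_zero]
  constructor
  · exact fun h => h.1
  · rintro rfl; simp

theorem phi_ne_zero {t : Fin M.nc} {u : ℕ} (h : M.phi t u ≠ 0) : u = 0 ∨ M.rd t ≤ u := by
  obtain ⟨T, hT, hs⟩ := Set.nonempty_of_ncard_ne_zero h
  rcases T.eq_empty_or_nonempty with rfl | ⟨j, hj⟩
  · left; simpa using hT.symm
  · right
    obtain ⟨u, hu, hx⟩ := exists_dot_of_notMem_span (hs j hj)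
    rw [← hT]
    exact mindist_le _ (M.hrd t) T u (fun i hi => hu _ ⟨i, hi, rfl⟩) j hx

theorem phi_one (t : Fin M.nc) : M.phi t 1 = 0 := by
  by_contra h
  have := M.phi_ne_zero h
  have := M.h_rd2 t
  omega

theorem phi_two_pos {t : Fin M.nc} (h : M.rd t = 2) : 0 < M.phi t 2 := by
  obtain ⟨u, V, hV, hu⟩ := mindist_attained (M.Gc t) (by rw [h]; norm_num) (M.hrd t)
  unfold phi
  rw [Set.ncard_pos (Set.toFinite _)]
  refine ⟨V, hV.trans h, fun j hj => notMem_span_of_dot (u := u) ?_ ((hu j).1 hj)⟩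
  rintro _ ⟨i, hi, rfl⟩
  by_contra hc
  exact hi ((hu i).2 hc)

theorem theta_zero (t : Fin M.nv) : M.theta t 0 0 = 1 := by
  unfold theta
  rw [Set.ncard_eq_one]
  refine ⟨(∅, ∅), ?_⟩
  ext ⟨U, V⟩
  simp only [Set.mem_ofPred_eq, Set.mem_singleton_iff, Finset.card_eq_zero, Prod.mk.injEq]
  constructor
  · exact fun h => ⟨h.1, h.2.1⟩
  · rintro ⟨rfl, rfl⟩
    refine ⟨rfl, rfl, ?_⟩
    rintro (c | c) hc <;> simp at hc

theorem theta_ne_zero {t : Fin M.nv} {u v : ℕ} (h : M.theta t u v ≠ 0) :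
    (u = 0 ∧ v = 0) ∨ (1 ≤ u ∧ M.pd t ≤ v) := by
  obtain ⟨⟨U, V⟩, hU, hV, hs⟩ := Set.nonempty_of_ncard_ne_zero h
  simp only at hU hV hs
  rcases U.eq_empty_or_nonempty with rfl | ⟨i, hi⟩
  · left
    refine ⟨by simpa using hU.symm, ?_⟩
    rcases V.eq_empty_or_nonempty with rfl | ⟨j, hj⟩
    · simpa using hV.symm
    · exfalso
      obtain ⟨x, hx, hx'⟩ := exists_dot_of_notMem_span (hs (Sum.inl j) hj)
      apply hx'
      have : x = 0 := by
        ext i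
        have := hx _ ⟨Sum.inr i, by simp, rfl⟩
        simpa [colv] using this
      rw [this, zero_dotProduct]
  · right
    refine ⟨by rw [← hU]; exact Finset.card_pos.2 ⟨i, hi⟩, ?_⟩
    rcases V.eq_empty_or_nonempty with rfl | ⟨j, hj⟩
    · exfalso
      obtain ⟨x, hx, hx'⟩ := exists_dot_of_notMem_span (hs (Sum.inr i) hi)
      apply hx'
      have h0 : Matrix.vecMul x (M.Gv t) = 0 := by
        ext j
        exact hx _ ⟨Sum.inl j, by simp, rfl⟩
      have hinj := Matrix.vecMul_injective_iff.2 (M.hGvRank t)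
      have : x = 0 := hinj (by simpa using h0)
      rw [this, zero_dotProduct]
    · obtain ⟨x, hx, hx'⟩ := exists_dot_of_notMem_span (hs (Sum.inl j) hj)
      rw [← hV]
      exact mindist_le _ (M.hpd t) V x (fun i hi => hx _ ⟨Sum.inl i, hi, rfl⟩) j hx'

theorem theta_two_pos {t : Fin M.nv} (h : M.pd t = 2) :
    ∃ i, 1 ≤ i ∧ i ≤ M.kdim t ∧ 0 < M.theta t i 2 := by
  obtain ⟨x, V, hV, hx⟩ := mindist_attained (M.Gv t) (by rw [h]; norm_num) (M.hpd t)
  set U : Finset (Fin (M.kdim t)) := Finset.univ.filter (fun i => x i ≠ 0) with hUdef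
  have hpos : 0 < M.theta t U.card 2 := by
    unfold theta
    rw [Set.ncard_pos (Set.toFinite _)]
    have hsel : ∀ c : Fin (M.q t) ⊕ Fin (M.kdim t), Sum.elim (· ∈ V) (· ∈ U) c ↔
        x ⬝ᵥ M.colv t c ≠ 0 := by
      rintro (c | c)
      · simpa [colv] using hx c
      · simp [colv, hUdef]
    refine ⟨(U, V), rfl, hV.trans h, fun c hc => notMem_span_of_dot (u := x) ?_ ((hsel c).1 hc)⟩
    rintro _ ⟨i, hi, rfl⟩
    by_contra hcc
    exact hi ((hsel i).2 hcc)
  refine ⟨U.card, ?_, by simpa using Finset.card_le_univ U, hpos⟩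
  rcases M.theta_ne_zero hpos.ne' with h | h
  · omega
  · exact h.1

end DGLDPCss

end

section
/-- polynomials whose coefficients lie in a given subsemiring -/
def polyCone {A : Type*} [CommRing A] (N : Subsemiring A) : Subsemiring A[X] where
  carrier := {f | ∀ i, f.coeff i ∈ N}
  mul_mem' := by
    intro a b ha hb i
    rw [coeff_mul]
    exact sum_mem fun x _ => mul_mem (ha _) (hb _)
  one_mem' := by
    intro i
    rw [coeff_one]
    split_ifs
    · exact one_mem _
    · exact zero_mem _
  add_mem' := by
    intro a b ha hb i
    rw [coeff_add]
    exact add_mem (ha i) (hb i)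
  zero_mem' := by
    intro i
    rw [coeff_zero]
    exact zero_mem _

theorem mem_polyCone {A : Type*} [CommRing A] {N : Subsemiring A} {f : A[X]} :
    f ∈ polyCone N ↔ ∀ i, f.coeff i ∈ N := Iff.rfl

section cone
variable {A : Type*} [CommRing A] [Algebra ℝ A]

theorem cone_smul {N : Subsemiring A} (hN : ∀ c : ℝ, 0 ≤ c → algebraMap ℝ A c ∈ N)
    {c : ℝ} (hc : 0 ≤ c) {a : A} (ha : a ∈ N) : c • a ∈ N := by
  rw [Algebra.smul_def]; exact mul_mem (hN c hc) ha

theorem cone_mul {N : Subsemiring A} {a b c d : A} (hd : d ∈ N) (hb : b ∈ N)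
    (h1 : a - b ∈ N) (h2 : c - d ∈ N) : a * c - b * d ∈ N := by
  have : a * c - b * d = (a - b) * (c - d) + (a - b) * d + b * (c - d) := by ring
  rw [this]
  exact add_mem (add_mem (mul_mem h1 h2) (mul_mem h1 hd)) (mul_mem hb h2)

theorem cone_trans {N : Subsemiring A} {a b c : A} (h1 : a - b ∈ N) (h2 : b - c ∈ N) :
    a - c ∈ N := by
  have := add_mem h1 h2
  simpa using this

theorem cone_pow {N : Subsemiring A} {a b : A} (hb : b ∈ N) (h1 : a - b ∈ N) (n : ℕ) :
    a ^ n - b ^ n ∈ N := by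
  induction n with
  | zero => simp [zero_mem]
  | succ n ih =>
    rw [pow_succ, pow_succ]
    exact cone_mul hb (pow_mem hb n) ih h1

/-- truncated exponential -/
noncomputable def texp (J : ℕ) (g : A) : A :=
  ∑ k ∈ Finset.range (J + 1), ((k.factorial : ℝ)⁻¹) • g ^ k

theorem texp_mem {N : Subsemiring A} (hN : ∀ c : ℝ, 0 ≤ c → algebraMap ℝ A c ∈ N)
    (J : ℕ) {g : A} (hg : g ∈ N) : texp J g ∈ N :=
  sum_mem fun k _ => cone_smul hN (by positivity) (pow_mem hg k)

theorem texp_pow {N : Subsemiring A} (hN : ∀ c : ℝ, 0 ≤ c → algebraMap ℝ A c ∈ N)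
    (J a : ℕ) {β : ℝ} (hβ : 0 ≤ β) (hJ : β ≤ (a : ℝ) - J) {g F : A} (hg : g ∈ N)
    (hF : F - (1 + g) ∈ N) : F ^ a - texp J (β • g) ∈ N := by
  have hJa : J ≤ a := by
    have : (J : ℝ) ≤ a := by linarith
    exact_mod_cast this
  refine cone_trans (cone_pow (add_mem (one_mem _) hg) hF a) ?_
  rw [add_comm, add_pow, texp]
  have hsub : Finset.range (J + 1) ⊆ Finset.range (a + 1) := by
    intro x; simp only [Finset.mem_range]; omega
  rw [← Finset.sum_sdiff hsub, add_sub_assoc, ← Finset.sum_sub_distrib]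
  refine add_mem (sum_mem fun k _ => ?_) (sum_mem fun k hk => ?_)
  · exact mul_mem (mul_mem (pow_mem hg k) (by simp [one_mem])) (natCast_mem _ _)
  · have hk' : k ≤ J := by simpa [Nat.lt_succ_iff] using hk
    have : g ^ k * 1 ^ (a - k) * ((a.choose k : ℕ) : A) - ((k.factorial : ℝ)⁻¹) • (β • g) ^ k
        = ((a.choose k : ℝ) - (k.factorial : ℝ)⁻¹ * β ^ k) • g ^ k := by
      rw [sub_smul, _root_.smul_pow, smul_smul]
      congr 1
      rw [Algebra.smul_def, map_natCast]; ring
    rw [this]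
    refine cone_smul hN ?_ (pow_mem hg k)
    have h1 : (β : ℝ) ^ k ≤ a.descFactorial k := by
      have h2 : ((a + 1 - k) ^ k : ℕ) ≤ a.descFactorial k := Nat.pow_sub_le_descFactorial a k
      have h3 : (((a + 1 - k : ℕ) : ℝ)) ^ k ≤ a.descFactorial k := by exact_mod_cast h2
      refine le_trans (pow_le_pow_left₀ hβ ?_ k) h3
      rw [Nat.cast_sub (by omega)]
      push_cast
      have : (k : ℝ) ≤ J := by exact_mod_cast hk'
      linarith
    rw [Nat.descFactorial_eq_factorial_mul_choose] at h1
    push_cast at h1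
    have hf : (0 : ℝ) < k.factorial := by positivity
    rw [sub_nonneg, inv_mul_le_iff₀ hf]
    exact h1

theorem texp_add {N : Subsemiring A} (hN : ∀ c : ℝ, 0 ≤ c → algebraMap ℝ A c ∈ N)
    (J : ℕ) {g h : A} (hg : g ∈ N) (hh : h ∈ N) :
    texp J g * texp J h - texp J (g + h) ∈ N := by
  have e1 : texp J (g + h) = ∑ p ∈ (Finset.range (J + 1) ×ˢ Finset.range (J + 1)).filter
      (fun p => p.1 + p.2 ≤ J),
      (((p.1.factorial : ℝ)⁻¹) • g ^ p.1) * (((p.2.factorial : ℝ)⁻¹) • h ^ p.2) := by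
    unfold texp
    have : ∀ k ∈ Finset.range (J + 1), ((k.factorial : ℝ)⁻¹) • (g + h) ^ k =
        ∑ p ∈ Finset.HasAntidiagonal.antidiagonal k,
        (((p.1.factorial : ℝ)⁻¹) • g ^ p.1) * (((p.2.factorial : ℝ)⁻¹) • h ^ p.2) := by
      intro k _
      rw [add_pow, Finset.Nat.sum_antidiagonal_eq_sum_range_succ_mk, Finset.smul_sum]
      refine Finset.sum_congr rfl fun i hi => ?_
      have hi' : i ≤ k := by simpa [Nat.lt_succ_iff] using hi
      have hch : (k.choose i : ℝ) = k.factorial / (i.factorial * (k - i).factorial) :=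
        Nat.cast_choose ℝ hi'
      have : ((k.choose i : ℕ) : A) = algebraMap ℝ A (k.choose i : ℝ) := by simp
      rw [this, hch, Algebra.smul_def, Algebra.smul_def, Algebra.smul_def]
      have hf : (k.factorial : ℝ) ≠ 0 := by positivity
      have hc : (k.factorial : ℝ)⁻¹ * (k.factorial / (i.factorial * (k - i).factorial)) =
        (i.factorial : ℝ)⁻¹ * ((k - i).factorial : ℝ)⁻¹ := by
          field_simp
      calc _ = algebraMap ℝ A ((k.factorial : ℝ)⁻¹ *
            (k.factorial / (i.factorial * (k - i).factorial))) * (g ^ i * h ^ (k - i)) := by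
              rw [map_mul]; ring
        _ = _ := by rw [hc, map_mul]; ring
    rw [Finset.sum_congr rfl this, Finset.sum_sigma']
    refine Finset.sum_bij' (fun x _ => x.2) (fun p _ => ⟨p.1 + p.2, p⟩) ?_ ?_ ?_ ?_ ?_
    · rintro ⟨k, a, b⟩ hx
      simp only [Finset.mem_sigma, Finset.mem_range, Finset.HasAntidiagonal.mem_antidiagonal] at hx
      simp only [Finset.mem_filter, Finset.mem_product, Finset.mem_range]
      omega
    · rintro ⟨a, b⟩ hx
      simp only [Finset.mem_filter, Finset.mem_product, Finset.mem_range] at hx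
      simp only [Finset.mem_sigma, Finset.mem_range, Finset.HasAntidiagonal.mem_antidiagonal]
      exact ⟨by omega, trivial⟩
    · rintro ⟨k, a, b⟩ hx
      simp only [Finset.mem_sigma, Finset.mem_range, Finset.HasAntidiagonal.mem_antidiagonal] at hx
      obtain ⟨_, rfl⟩ := hx
      rfl
    · intro _ _; rfl
    · intro _ _; rfl
  rw [e1]
  unfold texp
  rw [Finset.sum_mul_sum, ← Finset.sum_product',
    ← Finset.sum_filter_add_sum_filter_not _ (fun p : ℕ × ℕ => p.1 + p.2 ≤ J), add_sub_cancel_left]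
  exact sum_mem fun p _ => mul_mem (cone_smul hN (by positivity) (pow_mem hg _))
    (cone_smul hN (by positivity) (pow_mem hh _))

theorem prod_pow_cone {N : Subsemiring A} (hN : ∀ c : ℝ, 0 ≤ c → algebraMap ℝ A c ∈ N)
    {ι : Type*} (s : Finset ι) (J : ℕ) (a : ι → ℕ) (β : ι → ℝ) (hβ : ∀ t, 0 ≤ β t)
    (hJ : ∀ t, β t ≤ (a t : ℝ) - J) (g F : ι → A) (hg : ∀ t, g t ∈ N)
    (hF : ∀ t, F t - (1 + g t) ∈ N) :
    (∏ t ∈ s, F t ^ a t) - ((J.factorial : ℝ)⁻¹) • (∑ t ∈ s, β t • g t) ^ J ∈ N := by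
  have hS : ∀ s : Finset ι, (∑ t ∈ s, β t • g t) ∈ N := fun s =>
    sum_mem fun t _ => cone_smul hN (hβ t) (hg t)
  have key : (∏ t ∈ s, F t ^ a t) - texp J (∑ t ∈ s, β t • g t) ∈ N := by
    induction s using Finset.induction_on with
    | empty =>
      have : texp J (0 : A) = 1 := by
        unfold texp
        rw [Finset.sum_eq_single 0]
        · simp
        · intro b _ hb; simp [hb]
        · simp
      simp [this, zero_mem]
    | insert t s hts ih =>
      rw [Finset.prod_insert hts, Finset.sum_insert hts]
      refine cone_trans (cone_mul (texp_mem hN J (hS s)) ?_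
        (texp_pow hN J (a t) (hβ t) (hJ t) (hg t) (hF t)) ih) ?_
      · exact texp_mem hN J (cone_smul hN (hβ t) (hg t))
      · exact texp_add hN J (cone_smul hN (hβ t) (hg t)) (hS s)
  refine cone_trans key ?_
  unfold texp
  rw [Finset.sum_range_succ, add_sub_cancel_right]
  exact sum_mem fun k _ => cone_smul hN (by positivity) (pow_mem (hS s) k)

end cone

end

section
theorem coeff_mul_ge {p q : ℝ[X]} (hp : ∀ i, 0 ≤ p.coeff i) (hq : ∀ i, 0 ≤ q.coeff i) (a b : ℕ) :
    p.coeff a * q.coeff b ≤ (p * q).coeff (a + b) := by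
  rw [coeff_mul]
  exact Finset.single_le_sum (f := fun x : ℕ × ℕ => p.coeff x.1 * q.coeff x.2)
    (fun x _ => mul_nonneg (hp _) (hq _)) (a := (a, b)) (by simp)

theorem coeff_pow_nonneg {p : ℝ[X]} (hp : ∀ i, 0 ≤ p.coeff i) (k i : ℕ) :
    0 ≤ (p ^ k).coeff i :=
  (pow_mem (show p ∈ polyCone (Subsemiring.nonneg ℝ) from hp) k : _) i

theorem coeff_pow_ge {p : ℝ[X]} (hp : ∀ i, 0 ≤ p.coeff i) (a k : ℕ) :
    p.coeff a ^ k ≤ (p ^ k).coeff (k * a) := by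
  induction k with
  | zero => simp
  | succ k ih =>
    rw [pow_succ, pow_succ, Nat.succ_mul]
    exact (mul_le_mul_of_nonneg_right ih (hp a)).trans (coeff_mul_ge (coeff_pow_nonneg hp k) hp _ _)

/-- renewal-type lemma -/
theorem renewal_window {p : ℝ[X]} (hp : ∀ i, 0 ≤ p.coeff i) (h0 : p.coeff 0 = 0)
    (h1 : p.eval 1 = 1) (N : ℕ) :
    ∃ J ≤ N, ∃ j ≤ N, N ≤ j + p.natDegree ∧
      1 / ((N + 1 : ℝ) * (p.natDegree + 1)) ≤ (p ^ J).coeff j := by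
  set K := p.natDegree with hK
  -- the tail polynomial
  set T : ℝ[X] := ∑ i ∈ Finset.range (K + 1), C (p.coeff i) * ∑ l ∈ Finset.range i, X ^ l with hT
  have hsum : ∑ i ∈ Finset.range (K + 1), p.coeff i = 1 := by
    rw [← h1, eval_eq_sum_range]; simp [hK]
  have hT1 : (1 - X) * T = 1 - p := by
    have e1 : (1 : ℝ[X]) = ∑ i ∈ Finset.range (K + 1), C (p.coeff i) := by
      rw [← map_sum, hsum, map_one]
    have e2 : p = ∑ i ∈ Finset.range (K + 1), C (p.coeff i) * X ^ i := p.as_sum_range_C_mul_X_pow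
    have e3 : 1 - p = ∑ i ∈ Finset.range (K + 1), C (p.coeff i) * (1 - X ^ i) := by
      conv_lhs => rw [e2]
      conv_lhs => enter [1]; rw [e1]
      rw [← Finset.sum_sub_distrib]
      refine Finset.sum_congr rfl fun i _ => by ring
    rw [e3, hT, Finset.mul_sum]
    refine Finset.sum_congr rfl fun i _ => ?_
    rw [← mul_neg_geom_sum X i]; ring
  have hTc : ∀ l, T.coeff l = ∑ i ∈ Finset.range (K + 1), if l < i then p.coeff i else 0 := by
    intro l
    rw [hT, finsetSum_coeff]
    refine Finset.sum_congr rfl fun i _ => ?_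
    rw [coeff_C_mul, finsetSum_coeff]
    simp [coeff_X_pow]
  have hTle : ∀ l, T.coeff l ≤ 1 := by
    intro l
    rw [hTc, ← hsum]
    refine Finset.sum_le_sum fun i _ => ?_
    split_ifs
    · exact le_rfl
    · exact hp i
  have hT0 : ∀ l, K ≤ l → T.coeff l = 0 := by
    intro l hl
    rw [hTc]
    refine Finset.sum_eq_zero fun i hi => ?_
    rw [if_neg]
    simp only [Finset.mem_range] at hi; omega
  set U : ℝ[X] := ∑ J ∈ Finset.range (N + 1), p ^ J with hU
  have hUc : ∀ j, 0 ≤ U.coeff j := by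
    intro j
    rw [hU, finsetSum_coeff]
    exact Finset.sum_nonneg fun i _ => coeff_pow_nonneg hp i j
  have hW : (1 - X) * (T * U) = 1 - p ^ (N + 1) := by
    rw [← mul_assoc, hT1, hU, mul_neg_geom_sum]
  have hlow : ∀ m ≤ N, (p ^ (N + 1)).coeff m = 0 := by
    intro m hm
    have : X ^ (N + 1) ∣ p ^ (N + 1) := pow_dvd_pow_of_dvd (X_dvd_iff.2 h0) _
    exact (X_pow_dvd_iff.1 this) m (by omega)
  have hWc : ∀ m ≤ N, (T * U).coeff m = 1 := by
    intro m
    induction m with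
    | zero =>
      intro h
      have := congrArg (fun f => coeff f 0) hW
      simp only [coeff_sub, hlow 0 h, coeff_one_zero, sub_mul, one_mul] at this
      simpa using this
    | succ m ih =>
      intro h
      have := congrArg (fun f => coeff f (m + 1)) hW
      simp only [coeff_sub, hlow _ h, sub_mul, one_mul, coeff_X_mul, coeff_one] at this
      rw [ih (by omega)] at this
      simp at this
      linarith
  have h2 := hWc N le_rfl
  rw [coeff_mul, Finset.Nat.sum_antidiagonal_eq_sum_range_succ_mk] at h2
  by_contra hcon
  push Not at hcon
  have hle : ∑ k ∈ Finset.range N.succ, T.coeff k * U.coeff (N - k) ≤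
      ∑ k ∈ Finset.range N.succ, if k < K then U.coeff (N - k) else 0 := by
    refine Finset.sum_le_sum fun k _ => ?_
    split_ifs with hk
    · exact mul_le_of_le_one_left (hUc _) (hTle k)
    · rw [hT0 k (by omega)]; simp
  have hlt : ∀ k ∈ Finset.range N.succ, (if k < K then U.coeff (N - k) else 0) ≤
      if k < K then 1 / ((K : ℝ) + 1) else 0 := by
    intro k hk
    split_ifs with hkK
    · rw [hU, finsetSum_coeff]
      calc _ ≤ ∑ J ∈ Finset.range (N + 1), 1 / ((N + 1 : ℝ) * (K + 1)) := by
            refine Finset.sum_le_sum fun J hJ => ?_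
            simp only [Finset.mem_range] at hJ hk
            exact (hcon J (by omega) (N - k) (by omega) (by omega)).le
        _ = _ := by
          rw [Finset.sum_const, Finset.card_range, nsmul_eq_mul]; push_cast; field_simp
    · exact le_rfl
  have h3 : ∑ k ∈ Finset.range N.succ, (if k < K then 1 / ((K : ℝ) + 1) else 0) ≤
      K / (K + 1) := by
    rw [← Finset.sum_filter, Finset.sum_const, nsmul_eq_mul, mul_one_div]
    have : ((Finset.range N.succ).filter (fun k => k < K)).card ≤ K := by
      calc _ ≤ (Finset.range K).card := Finset.card_le_card (by
            intro x hx; simp only [Finset.mem_filter, Finset.mem_range] at hx ⊢; exact hx.2)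
        _ = K := Finset.card_range K
    have : (((Finset.range N.succ).filter (fun k => k < K)).card : ℝ) ≤ K := by exact_mod_cast this
    gcongr
  have h4 : (K : ℝ) / (K + 1) < 1 := by
    rw [div_lt_one (by positivity)]; linarith
  have := Finset.sum_le_sum hlt
  linarith

theorem renewal {p : ℝ[X]} (hp : ∀ i, 0 ≤ p.coeff i) (h0 : p.coeff 0 = 0)
    (h1 : p.eval 1 = 1) (i0 : ℕ) (hi0 : 0 < p.coeff i0) :
    ∃ c : ℝ, 0 < c ∧ ∀ N : ℕ, ∃ J ≤ i0 * N, c / (N + 1 : ℝ) ^ i0 ≤ (p ^ J).coeff (i0 * N) := by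
  set K := p.natDegree with hK
  have hp1 : p.coeff i0 ≤ 1 := by
    rw [← h1, eval_eq_sum_range]
    simp only [one_pow, mul_one]
    refine Finset.single_le_sum (f := fun i => p.coeff i) (fun i _ => hp i) ?_
    simp only [Finset.mem_range, Nat.lt_succ_iff]
    exact le_natDegree_of_ne_zero hi0.ne'
  refine ⟨(1 / ((K : ℝ) + 1)) ^ i0 * p.coeff i0 ^ K, by positivity, fun N => ?_⟩
  obtain ⟨J, hJ, j, hj, hjK, hc⟩ := renewal_window hp h0 h1 N
  have hfin : (1 / ((K : ℝ) + 1)) ^ i0 * p.coeff i0 ^ K / (N + 1 : ℝ) ^ i0 ≤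
      (p ^ (J * i0 + (N - j))).coeff (i0 * N) := by
    have e : i0 * N = i0 * j + (N - j) * i0 := by
      obtain ⟨d, rfl⟩ := Nat.exists_eq_add_of_le hj
      simp; ring
    rw [e, pow_add, pow_mul]
    refine le_trans ?_ (coeff_mul_ge (coeff_pow_nonneg (coeff_pow_nonneg hp J) i0)
      (coeff_pow_nonneg hp _) _ _)
    have hA : (1 / ((N + 1 : ℝ) * (K + 1))) ^ i0 ≤ ((p ^ J) ^ i0).coeff (i0 * j) :=
      (pow_le_pow_left₀ (by positivity) hc i0).trans (coeff_pow_ge (coeff_pow_nonneg hp J) j i0)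
    have hB : p.coeff i0 ^ K ≤ (p ^ (N - j)).coeff ((N - j) * i0) :=
      (pow_le_pow_of_le_one hi0.le hp1 (by omega)).trans (coeff_pow_ge hp i0 (N - j))
    calc _ = (1 / ((N + 1 : ℝ) * (K + 1))) ^ i0 * p.coeff i0 ^ K := by
            rw [div_pow, div_pow, mul_pow]; field_simp
      _ ≤ _ := mul_le_mul hA hB (by positivity) (coeff_pow_nonneg (coeff_pow_nonneg hp J) _ _)
  refine ⟨_, ?_, hfin⟩
  by_contra hlt
  push Not at hlt
  have hz : (p ^ (J * i0 + (N - j))).coeff (i0 * N) = 0 :=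
    (X_pow_dvd_iff.1 (pow_dvd_pow_of_dvd (X_dvd_iff.2 h0) _)) _ hlt
  rw [hz] at hfin
  have : 0 < (1 / ((K : ℝ) + 1)) ^ i0 * p.coeff i0 ^ K / (N + 1 : ℝ) ^ i0 := by positivity
  linarith

/-! factorial and binomial estimates -/

theorem factorial_upper (n : ℕ) (hn : 1 ≤ n) :
    (n.factorial : ℝ) ≤ Real.exp 1 * n * ((n : ℝ) ^ n * Real.exp (-n)) := by
  induction n, hn using Nat.le_induction with
  | base => simp [← Real.exp_add]
  | succ n hn ih =>
    have hn' : (0 : ℝ) < n := by exact_mod_cast hn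
    rw [Nat.factorial_succ]
    push_cast
    have key : (n : ℝ) ^ (n + 1) * Real.exp 1 ≤ (n + 1 : ℝ) ^ (n + 1) := by
      have h := Real.one_sub_inv_le_log_of_pos (x := ((n : ℝ) + 1) / n) (by positivity)
      have h2 : 1 ≤ ((n : ℝ) + 1) * Real.log (((n : ℝ) + 1) / n) := by
        have e : 1 - ((((n : ℝ) + 1) / n))⁻¹ = 1 / (n + 1) := by field_simp; ring
        rw [e, div_le_iff₀ (by positivity)] at h
        linarith
      have h3 := Real.exp_le_exp.2 h2
      have e2 : Real.exp (((n : ℝ) + 1) * Real.log (((n : ℝ) + 1) / n)) =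
          (((n : ℝ) + 1) / n) ^ (n + 1) := by
        have := Real.exp_nat_mul (Real.log (((n : ℝ) + 1) / n)) (n + 1)
        rw [Real.exp_log (by positivity)] at this
        push_cast at this
        exact this
      rw [e2, div_pow, le_div_iff₀ (by positivity)] at h3
      linarith
    calc ((n : ℝ) + 1) * n.factorial ≤
        (n + 1) * (Real.exp 1 * n * ((n : ℝ) ^ n * Real.exp (-n))) := by gcongr
      _ = (n + 1) * Real.exp (-n) * ((n : ℝ) ^ (n + 1) * Real.exp 1) := by ring
      _ ≤ (n + 1) * Real.exp (-n) * (n + 1 : ℝ) ^ (n + 1) := by gcongr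
      _ = Real.exp 1 * (n + 1) * ((n + 1 : ℝ) ^ (n + 1) * Real.exp (-(n + 1))) := by
        have : Real.exp (-n : ℝ) = Real.exp 1 * Real.exp (-(n + 1)) := by
          rw [← Real.exp_add]; congr 1; ring
        rw [this]; ring

theorem factorial_lower (n : ℕ) : (n : ℝ) ^ n * Real.exp (-n) ≤ n.factorial := by
  have := Real.pow_div_factorial_le_exp (n : ℝ) (by positivity) n
  rw [div_le_iff₀ (by positivity)] at this
  rw [Real.exp_neg, ← div_eq_mul_inv, div_le_iff₀ (Real.exp_pos _)]
  linarith

theorem choose_upper (E v : ℕ) {b : ℝ} (hb : 0 ≤ b) (hb1 : b ≤ 1) :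
    (E.choose v : ℝ) * (b ^ v * (1 - b) ^ (E - v)) ≤ 1 := by
  rcases le_or_gt v E with h | h
  · have := add_pow b (1 - b) E
    rw [add_sub_cancel, one_pow] at this
    have h2 : 0 ≤ 1 - b := by linarith
    have h3 := Finset.single_le_sum (s := Finset.range (E + 1)) (a := v)
      (f := fun m => b ^ m * (1 - b) ^ (E - m) * (E.choose m : ℝ))
      (fun i _ => by positivity) (by simp; omega)
    rw [← this] at h3
    linarith
  · rw [Nat.choose_eq_zero_of_lt h]; simp

theorem choose_lower (E v : ℕ) (hv : 0 < v) (hvE : v < E) :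
    1 / (9 * (E : ℝ) ^ 2) ≤
      (E.choose v : ℝ) * (((v : ℝ) / E) ^ v * (1 - (v : ℝ) / E) ^ (E - v)) := by
  have hE : (0 : ℝ) < E := by exact_mod_cast (by omega : 0 < E)
  obtain ⟨u, rfl⟩ := Nat.exists_eq_add_of_le hvE.le
  have hu : 1 ≤ u := by omega
  rw [Nat.add_sub_cancel_left, Nat.cast_add_choose]
  have hu' : (0 : ℝ) < u := by exact_mod_cast hu
  have hv' : (0 : ℝ) < v := by exact_mod_cast hv
  push_cast at hE ⊢
  have e : 1 - (v : ℝ) / (v + u) = u / (v + u) := by field_simp; ring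
  rw [e, div_pow, div_pow]
  have a1 := factorial_upper v hv
  have a2 := factorial_upper u hu
  have a3 := factorial_lower (v + u)
  push_cast at a3
  have he : Real.exp (-(v + u : ℝ)) = Real.exp (-v) * Real.exp (-u) := by
    rw [← Real.exp_add]; congr 1; ring
  rw [he] at a3
  have e3 : Real.exp 1 ≤ 3 := by have := Real.exp_one_lt_d9; linarith
  have hvu : (v.factorial : ℝ) * u.factorial ≤ 9 * (v + u : ℝ) ^ 2 *
      ((v : ℝ) ^ v * Real.exp (-v)) * ((u : ℝ) ^ u * Real.exp (-u)) := by
    calc _ ≤ (Real.exp 1 * v * ((v : ℝ) ^ v * Real.exp (-v))) *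
          (Real.exp 1 * u * ((u : ℝ) ^ u * Real.exp (-u))) := by gcongr
      _ ≤ (3 * (v + u) * ((v : ℝ) ^ v * Real.exp (-v))) *
          (3 * (v + u) * ((u : ℝ) ^ u * Real.exp (-u))) := by
            gcongr
            · linarith
            · linarith
      _ = _ := by ring
  rw [div_mul_div_comm, div_mul_div_comm, div_le_div_iff₀ (by positivity) (by positivity), one_mul]
  calc (v.factorial : ℝ) * u.factorial * ((v + u : ℝ) ^ v * (v + u : ℝ) ^ u)
      ≤ (9 * (v + u : ℝ) ^ 2 *
      ((v : ℝ) ^ v * Real.exp (-v)) * ((u : ℝ) ^ u * Real.exp (-u))) *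
        ((v + u : ℝ) ^ v * (v + u : ℝ) ^ u) := by gcongr
    _ = ((v + u : ℝ) ^ (v + u) * (Real.exp (-v) * Real.exp (-u))) *
        ((v : ℝ) ^ v * (u : ℝ) ^ u) * (9 * (v + u : ℝ) ^ 2) := by rw [pow_add]; ring
    _ ≤ _ := by gcongr

end

section
noncomputable abbrev cone1 : Subsemiring ℝ[X] := polyCone (Subsemiring.nonneg ℝ)
noncomputable abbrev cone2 : Subsemiring ℝ[X][X] := polyCone cone1

theorem mem_cone1 {p : ℝ[X]} : p ∈ cone1 ↔ ∀ i, 0 ≤ p.coeff i := Iff.rfl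
theorem mem_cone2 {p : ℝ[X][X]} : p ∈ cone2 ↔ ∀ i j, 0 ≤ (p.coeff i).coeff j := Iff.rfl

theorem cone1_alg (c : ℝ) (hc : 0 ≤ c) : algebraMap ℝ ℝ[X] c ∈ cone1 := by
  rw [mem_cone1]; intro i
  rw [← C_eq_algebraMap, coeff_C]
  split_ifs <;> simp [hc]

theorem cone2_alg (c : ℝ) (hc : 0 ≤ c) : algebraMap ℝ ℝ[X][X] c ∈ cone2 := by
  rw [mem_cone2]; intro i j
  rw [Polynomial.algebraMap_apply, coeff_C]
  split_ifs
  · exact cone1_alg c hc j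
  · simp

theorem coeff2_mul_ge {F H : ℝ[X][X]} (hF : F ∈ cone2) (hH : H ∈ cone2) (a b c d : ℕ) :
    (F.coeff a).coeff b * (H.coeff c).coeff d ≤ ((F * H).coeff (a + c)).coeff (b + d) := by
  rw [coeff_mul, finsetSum_coeff]
  refine (coeff_mul_ge (hF a) (hH c) b d).trans ?_
  exact Finset.single_le_sum (f := fun x : ℕ × ℕ => (F.coeff x.1 * H.coeff x.2).coeff (b + d))
    (fun x _ => mem_cone1.1 (mul_mem (hF _) (hH _)) _) (a := (a, c)) (by simp)

theorem coeff_le_eval {p : ℝ[X]} (hp : p ∈ cone1) {z : ℝ} (hz : 0 ≤ z) (v : ℕ) :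
    p.coeff v * z ^ v ≤ p.eval z := by
  rw [eval_eq_sum_range' (n := max (p.natDegree + 1) (v + 1)) (by omega)]
  exact Finset.single_le_sum (f := fun i => p.coeff i * z ^ i)
    (fun i _ => mul_nonneg (hp i) (by positivity)) (by simp)

theorem coeff2_le_eval {F : ℝ[X][X]} (hF : F ∈ cone2) {x z : ℝ} (hx : 0 ≤ x) (hz : 0 ≤ z)
    (u v : ℕ) : (F.coeff u).coeff v * (x ^ u * z ^ v) ≤ (F.eval (C x)).eval z := by
  rw [eval_eq_sum_range' (p := F) (n := max (F.natDegree + 1) (u + 1)) (by omega), eval_finsetSum]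
  have h1 : (F.coeff u).coeff v * (x ^ u * z ^ v) ≤ (F.coeff u * C x ^ u).eval z := by
    rw [eval_mul, eval_pow, eval_C]
    have := mul_le_mul_of_nonneg_right (coeff_le_eval (hF u) hz v) (pow_nonneg hx u)
    linarith
  refine h1.trans ?_
  refine Finset.single_le_sum (f := fun i => (F.coeff i * C x ^ i).eval z)
    (fun i _ => ?_) (by simp)
  rw [eval_mul, eval_pow, eval_C]
  refine mul_nonneg (le_trans ?_ (coeff_le_eval (hF i) hz 0)) (by positivity)
  exact mul_nonneg (hF i 0) (by positivity)

/-- support condition -/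
def GoodSupp (Q K : ℕ) (F : ℝ[X][X]) : Prop :=
  ∀ u v, (F.coeff u).coeff v ≠ 0 → v ≤ Q * u ∧ u ≤ K * v

theorem GoodSupp.one (Q K : ℕ) : GoodSupp Q K 1 := by
  intro u v h
  rw [coeff_one] at h
  split_ifs at h with hu
  · rw [coeff_one] at h
    split_ifs at h with hv
    · subst hu hv; simp
    · exact absurd rfl h
  · simp at h

theorem GoodSupp.mul {Q K : ℕ} {F H : ℝ[X][X]} (hF : GoodSupp Q K F) (hH : GoodSupp Q K H) :
    GoodSupp Q K (F * H) := by
  intro u v h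
  rw [coeff_mul, finsetSum_coeff] at h
  obtain ⟨⟨a, c⟩, hac, h⟩ := Finset.exists_ne_zero_of_sum_ne_zero h
  rw [coeff_mul] at h
  obtain ⟨⟨b, d⟩, hbd, h⟩ := Finset.exists_ne_zero_of_sum_ne_zero h
  simp only [Finset.HasAntidiagonal.mem_antidiagonal] at hac hbd
  have h1 := hF a b (left_ne_zero_of_mul h)
  have h2 := hH c d (right_ne_zero_of_mul h)
  subst hac hbd
  constructor
  · rw [mul_add]; omega
  · rw [mul_add]; omega

theorem GoodSupp.pow {Q K : ℕ} {F : ℝ[X][X]} (hF : GoodSupp Q K F) (n : ℕ) :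
    GoodSupp Q K (F ^ n) := by
  induction n with
  | zero => simpa using GoodSupp.one Q K
  | succ n ih => rw [pow_succ]; exact ih.mul hF

namespace DGLDPCss
variable (M : DGLDPCss)

theorem Phipoly_coeff (t : Fin M.nc) (u : ℕ) :
    (M.Phipoly t).coeff u = if u ≤ M.s t then (M.phi t u : ℝ) else 0 := by
  unfold Phipoly
  rw [finsetSum_coeff]
  simp [coeff_X_pow, Nat.lt_succ_iff]

theorem Thetapoly_coeff (t : Fin M.nv) (u v : ℕ) :
    ((M.Thetapoly t).coeff u).coeff v =
      if u ≤ M.kdim t ∧ v ≤ M.q t then (M.theta t u v : ℝ) else 0 := by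
  unfold Thetapoly
  rw [finsetSum_coeff]
  simp only [coeff_C_mul, coeff_X_pow, mul_ite, mul_one, mul_zero, Finset.sum_ite_eq,
    Finset.mem_range, Nat.lt_succ_iff]
  by_cases hu : u ≤ M.kdim t
  · simp [hu, finsetSum_coeff, coeff_X_pow, Nat.lt_succ_iff]
  · simp [hu]

theorem Phipoly_mem (t : Fin M.nc) : M.Phipoly t ∈ cone1 := by
  rw [mem_cone1]; intro i
  rw [Phipoly_coeff]; split_ifs <;> positivity

theorem Thetapoly_mem (t : Fin M.nv) : M.Thetapoly t ∈ cone2 := by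
  rw [mem_cone2]; intro i j
  rw [Thetapoly_coeff]; split_ifs <;> positivity

theorem Phiprod_mem (c : Fin M.nc → ℕ) : (∏ t, M.Phipoly t ^ c t) ∈ cone1 :=
  prod_mem fun t _ => pow_mem (M.Phipoly_mem t) _

theorem Thetaprod_mem (c : Fin M.nv → ℕ) : (∏ t, M.Thetapoly t ^ c t) ∈ cone2 :=
  prod_mem fun t _ => pow_mem (M.Thetapoly_mem t) _

theorem NcCount_nonneg (n v : ℕ) : 0 ≤ M.NcCount n v := M.Phiprod_mem _ v
theorem NvCount_nonneg (n u v : ℕ) : 0 ≤ M.NvCount n u v := M.Thetaprod_mem _ u v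

theorem NcCount_super {n m : ℕ} (h : ∀ t, M.cExp (n + m) t = M.cExp n t + M.cExp m t) (v v' : ℕ) :
    M.NcCount n v * M.NcCount m v' ≤ M.NcCount (n + m) (v + v') := by
  unfold NcCount
  simp_rw [h, pow_add, Finset.prod_mul_distrib]
  exact coeff_mul_ge (M.Phiprod_mem _) (M.Phiprod_mem _) _ _

theorem NvCount_super {n m : ℕ} (h : ∀ t, M.vExp (n + m) t = M.vExp n t + M.vExp m t)
    (w w' v v' : ℕ) :
    M.NvCount n w v * M.NvCount m w' v' ≤ M.NvCount (n + m) (w + w') (v + v') := by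
  unfold NvCount
  simp_rw [h, pow_add, Finset.prod_mul_distrib]
  exact coeff2_mul_ge (M.Thetaprod_mem _) (M.Thetaprod_mem _) _ _ _ _

/-- a bound for all lengths of VN codes and dimensions -/
noncomputable def Qm : ℕ := 1 + ∑ t, (M.q t + M.kdim t)

theorem Qm_pos : 0 < M.Qm := by unfold Qm; omega

theorem NvCount_supp {n w v : ℕ} (h : M.NvCount n w v ≠ 0) : v ≤ M.Qm * w ∧ w ≤ M.Qm * v := by
  have hle : ∀ t, M.q t + M.kdim t ≤ M.Qm := fun t => by
    have := Finset.single_le_sum (f := fun t => M.q t + M.kdim t) (fun _ _ => Nat.zero_le _)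
      (Finset.mem_univ t)
    unfold Qm; omega
  have hg : GoodSupp M.Qm M.Qm (∏ t, M.Thetapoly t ^ M.vExp n t) := by
    refine Finset.prod_induction _ _ (fun _ _ => GoodSupp.mul) (GoodSupp.one _ _) fun t _ => ?_
    refine GoodSupp.pow ?_ _
    intro u v huv
    rw [Thetapoly_coeff] at huv
    split_ifs at huv with h1
    · have h2 : M.theta t u v ≠ 0 := by exact_mod_cast huv
      rcases M.theta_ne_zero h2 with h3 | h3
      · simp [h3]
      · have := hle t
        have := M.h_pd2 t
        constructor
        · calc v ≤ M.Qm * 1 := by omega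
            _ ≤ _ := Nat.mul_le_mul_left _ h3.1
        · calc u ≤ M.Qm * 1 := by omega
            _ ≤ _ := Nat.mul_le_mul_left _ (by omega)
    · exact absurd rfl huv
  exact hg w v h

/-- the quadratic-in-`y` part of `Θ` summed with weights -/
noncomputable def Qpoly : ℝ[X] := ∑ t, (M.lam t / (M.q t : ℝ)) •
  ∑ i ∈ Finset.range (M.kdim t + 1), C (M.theta t i 2 : ℝ) * X ^ i

theorem q_pos (t : Fin M.nv) : (0 : ℝ) < M.q t := by exact_mod_cast M.h_q1 t
theorem s_pos (t : Fin M.nc) : (0 : ℝ) < M.s t := by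
  have := M.h_hs t
  exact_mod_cast (by omega : 0 < M.s t)

theorem Pfun_eq (hp : M.p = 2) (x : ℝ) : M.Pfun x = 2 * M.Qpoly.eval x := by
  unfold Pfun Qpoly
  rw [eval_finsetSum, Finset.sum_filter]
  congr 1
  refine Finset.sum_congr rfl fun t _ => ?_
  rw [eval_smul, eval_finsetSum]
  split_ifs with h
  · simp
  · have : ∀ i, M.theta t i 2 = 0 := by
      intro i
      by_contra hc
      rcases M.theta_ne_zero hc with h1 | h1
      · omega
      · have := M.h_pd2 t; omega
    simp [this]

theorem Cparam_eq (hr : M.r = 2) :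
    M.Cparam = 2 * ∑ t, M.ρ t / (M.s t : ℝ) * (M.phi t 2 : ℝ) := by
  unfold Cparam
  rw [Finset.sum_filter]
  congr 1
  refine Finset.sum_congr rfl fun t _ => ?_
  split_ifs with h
  · ring
  · have : M.phi t 2 = 0 := by
      by_contra hc
      rcases M.phi_ne_zero hc with h1 | h1
      · omega
      · have := M.h_rd2 t; omega
    simp [this]

theorem Cparam_pos (hr : M.r = 2) : 0 < M.Cparam := by
  rw [M.Cparam_eq hr]
  have hne : (Set.range M.rd).Nonempty := ⟨_, ⟨⟨0, M.hnc⟩, rfl⟩⟩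
  obtain ⟨t, ht⟩ := Nat.sInf_mem hne
  have ht2 : M.rd t = 2 := ht.trans hr
  have h0 : 0 < M.phi t 2 := M.phi_two_pos ht2
  refine mul_pos two_pos (Finset.sum_pos' (fun i _ => ?_) ⟨t, Finset.mem_univ _, ?_⟩)
  · exact mul_nonneg (div_nonneg (M.hρpos i).le (M.s_pos i).le) (by positivity)
  · exact mul_pos (div_pos (M.hρpos t) (M.s_pos t)) (by exact_mod_cast h0)

theorem Qpoly_coeff (i : ℕ) : M.Qpoly.coeff i =
    ∑ t, (M.lam t / (M.q t : ℝ)) * if i ≤ M.kdim t then (M.theta t i 2 : ℝ) else 0 := by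
  unfold Qpoly
  rw [finsetSum_coeff]
  refine Finset.sum_congr rfl fun t _ => ?_
  rw [coeff_smul, finsetSum_coeff, smul_eq_mul]
  congr 1
  simp [coeff_X_pow, Nat.lt_succ_iff]

theorem Qpoly_mem : M.Qpoly ∈ cone1 := by
  rw [mem_cone1]; intro i
  rw [Qpoly_coeff]
  refine Finset.sum_nonneg fun t _ => mul_nonneg (div_nonneg (M.hlampos t).le (M.q_pos t).le) ?_
  split_ifs <;> positivity

theorem Qpoly_zero : M.Qpoly.coeff 0 = 0 := by
  rw [Qpoly_coeff]
  refine Finset.sum_eq_zero fun t _ => ?_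
  have : M.theta t 0 2 = 0 := by
    by_contra hc
    rcases M.theta_ne_zero hc with h1 | h1 <;> omega
  simp [this]

theorem Qpoly_pos (hp : M.p = 2) : ∃ i, 1 ≤ i ∧ 0 < M.Qpoly.coeff i := by
  have hne : (Set.range M.pd).Nonempty := ⟨_, ⟨⟨0, M.hnv⟩, rfl⟩⟩
  obtain ⟨t, ht⟩ := Nat.sInf_mem hne
  have ht2 : M.pd t = 2 := ht.trans hp
  obtain ⟨i, hi, hik, hpos⟩ := M.theta_two_pos ht2
  refine ⟨i, hi, ?_⟩
  rw [Qpoly_coeff]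
  refine Finset.sum_pos' (fun t _ => ?_) ⟨t, Finset.mem_univ _, ?_⟩
  · refine mul_nonneg (div_nonneg (M.hlampos t).le (M.q_pos t).le) ?_
    split_ifs <;> positivity
  · rw [if_pos hik]
    exact mul_pos (div_pos (M.hlampos t) (M.q_pos t)) (by exact_mod_cast hpos)

theorem exists_y (hr : M.r = 2) (hp : M.p = 2) : ∃ y : ℝ, 0 < y ∧ M.Pfun y = 1 / M.Cparam ∧
    ∀ y' : ℝ, 0 ≤ y' → M.Pfun y' = 1 / M.Cparam → y' = y := by
  obtain ⟨i, hi, hpos⟩ := M.Qpoly_pos hp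
  have hC := M.Cparam_pos hr
  have hP : ∀ x, M.Pfun x = 2 * M.Qpoly.eval x := M.Pfun_eq hp
  have h0 : M.Pfun 0 = 0 := by rw [hP, ← coeff_zero_eq_eval_zero, Qpoly_zero, mul_zero]
  have hmono : ∀ a b, 0 ≤ a → a < b → M.Pfun a < M.Pfun b := by
    intro a b ha hab
    rw [hP, hP, eval_eq_sum_range, eval_eq_sum_range]
    refine mul_lt_mul_of_pos_left (Finset.sum_lt_sum (fun j _ => ?_) ⟨i, ?_, ?_⟩) two_pos
    · exact mul_le_mul_of_nonneg_left (pow_le_pow_left₀ ha hab.le j) (M.Qpoly_mem j)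
    · simp only [Finset.mem_range, Nat.lt_succ_iff]
      exact le_natDegree_of_ne_zero hpos.ne'
    · exact mul_lt_mul_of_pos_left (pow_lt_pow_left₀ hab ha (by omega)) hpos
  have hcont : Continuous M.Pfun := by
    have : M.Pfun = fun x => 2 * M.Qpoly.eval x := funext hP
    rw [this]
    exact continuous_const.mul M.Qpoly.continuous
  have hlarge : ∃ B : ℝ, 0 ≤ B ∧ 1 / M.Cparam ≤ M.Pfun B := by
    refine ⟨1 + 1 / (M.Cparam * M.Qpoly.coeff i), by positivity, ?_⟩
    set B := 1 + 1 / (M.Cparam * M.Qpoly.coeff i) with hB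
    have hB1 : 1 ≤ B := by rw [hB]; simp; positivity
    rw [hP]
    have h1 := coeff_le_eval M.Qpoly_mem (z := B) (by linarith) i
    have h2 : B ≤ B ^ i := le_self_pow₀ hB1 (by omega)
    have h3 : M.Qpoly.coeff i * B ≤ M.Qpoly.coeff i * B ^ i := by gcongr
    have h4 : 1 / M.Cparam ≤ M.Qpoly.coeff i * B := by
      rw [hB, mul_add]
      have : M.Qpoly.coeff i * (1 / (M.Cparam * M.Qpoly.coeff i)) = 1 / M.Cparam := by field_simp
      rw [this]; linarith
    have : 0 < 1 / M.Cparam := by positivity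
    linarith
  obtain ⟨B, hB, hBC⟩ := hlarge
  have hinv : 0 < 1 / M.Cparam := by positivity
  obtain ⟨y, hy, hyC⟩ := intermediate_value_Icc hB hcont.continuousOn
    (show 1 / M.Cparam ∈ Set.Icc (M.Pfun 0) (M.Pfun B) from ⟨by rw [h0]; exact hinv.le, hBC⟩)
  have hy0 : 0 < y := by
    rcases hy.1.eq_or_lt with h | h
    · rw [← h, h0] at hyC; linarith
    · exact h
  refine ⟨y, hy0, hyC, fun y' hy' h => ?_⟩
  rcases lt_trichotomy y' y with hlt | heq | hgt
  · have := hmono _ _ hy' hlt; linarith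
  · exact heq
  · have := hmono _ _ hy0.le hgt; linarith

end DGLDPCss

end

section
namespace DGLDPCss
variable (M : DGLDPCss)

theorem Phi_eval_le (t : Fin M.nc) : ∃ K : ℝ, 0 ≤ K ∧ ∀ z : ℝ, 0 ≤ z → z ≤ 1 →
    (M.Phipoly t).eval z ≤ 1 + ((M.phi t 2 : ℝ) * z ^ 2 + K * z ^ 3) := by
  refine ⟨∑ u ∈ Finset.range (M.s t + 1), (M.phi t u : ℝ), by positivity, fun z hz hz1 => ?_⟩
  unfold Phipoly
  rw [eval_finsetSum]
  have hterm : ∀ u ∈ Finset.range (M.s t + 1),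
      (C (M.phi t u : ℝ) * X ^ u).eval z ≤
        (if u = 0 then 1 else 0) + ((if u = 2 then (M.phi t 2 : ℝ) * z ^ 2 else 0) +
          (M.phi t u : ℝ) * z ^ 3) := by
    intro u _
    rw [eval_mul, eval_C, eval_pow, eval_X]
    have hz3 : (0 : ℝ) ≤ (M.phi t u : ℝ) * z ^ 3 := by positivity
    rcases Nat.lt_or_ge u 3 with h | h
    · interval_cases u
      · simp only [M.phi_zero] at hz3 ⊢; simp; positivity
      · simp [M.phi_one]
      · simp; positivity
    · rw [if_neg (by omega), if_neg (by omega), zero_add, zero_add]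
      exact mul_le_mul_of_nonneg_left (pow_le_pow_of_le_one hz hz1 h) (by positivity)
  refine (Finset.sum_le_sum hterm).trans ?_
  rw [Finset.sum_add_distrib, Finset.sum_add_distrib, ← Finset.sum_mul]
  have h2 : (∑ i ∈ Finset.range (M.s t + 1), if i = 2 then (M.phi t 2 : ℝ) * z ^ 2 else 0) ≤
      (M.phi t 2 : ℝ) * z ^ 2 := by
    rw [Finset.sum_ite_eq']
    split_ifs
    · exact le_rfl
    · positivity
  have h0 : (∑ i ∈ Finset.range (M.s t + 1), if i = 0 then (1 : ℝ) else 0) ≤ 1 := by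
    rw [Finset.sum_ite_eq']
    split_ifs <;> norm_num
  linarith

theorem Theta_eval_le (t : Fin M.nv) {x : ℝ} (hx : 0 ≤ x) : ∃ K : ℝ, 0 ≤ K ∧
    ∀ z : ℝ, 0 ≤ z → z ≤ 1 →
    ((M.Thetapoly t).eval (C x)).eval z ≤ 1 +
      ((∑ i ∈ Finset.range (M.kdim t + 1), (M.theta t i 2 : ℝ) * x ^ i) * z ^ 2 + K * z ^ 3) := by
  refine ⟨∑ u ∈ Finset.range (M.kdim t + 1), ∑ v ∈ Finset.range (M.q t + 1),
    (M.theta t u v : ℝ) * x ^ u, by positivity, fun z hz hz1 => ?_⟩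
  unfold Thetapoly
  rw [eval_finsetSum, eval_finsetSum]
  have hterm : ∀ u ∈ Finset.range (M.kdim t + 1), ∀ v ∈ Finset.range (M.q t + 1),
      (M.theta t u v : ℝ) * z ^ v * x ^ u ≤
        (if v = 0 then (if u = 0 then 1 else 0) else 0) +
          ((if v = 2 then (M.theta t u 2 : ℝ) * x ^ u * z ^ 2 else 0) +
          (M.theta t u v : ℝ) * x ^ u * z ^ 3) := by
    intro u _ v _
    have hz3 : (0 : ℝ) ≤ (M.theta t u v : ℝ) * x ^ u * z ^ 3 := by positivity
    have hz2 : (0 : ℝ) ≤ (if v = 2 then (M.theta t u 2 : ℝ) * x ^ u * z ^ 2 else 0) := by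
      split_ifs <;> positivity
    have hz1' : (0 : ℝ) ≤ (if v = 0 then (if u = 0 then 1 else 0) else 0) := by
      split_ifs <;> positivity
    by_cases hth : M.theta t u v = 0
    · simp only [hth, Nat.cast_zero, zero_mul, add_zero]
      linarith
    · rcases M.theta_ne_zero hth with ⟨rfl, rfl⟩ | ⟨h1, h2⟩
      · rw [M.theta_zero] at hz3 ⊢
        simp; positivity
      · have := M.h_pd2 t
        rcases Nat.lt_or_ge v 3 with h | h
        · have hv : v = 2 := by omega
          subst hv
          simp only [if_true]
          have : (M.theta t u 2 : ℝ) * z ^ 2 * x ^ u = (M.theta t u 2 : ℝ) * x ^ u * z ^ 2 := by ring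
          linarith
        · have : (M.theta t u v : ℝ) * z ^ v * x ^ u ≤ (M.theta t u v : ℝ) * x ^ u * z ^ 3 := by
            have h5 := pow_le_pow_of_le_one hz hz1 h
            have : (0 : ℝ) ≤ (M.theta t u v : ℝ) * x ^ u := by positivity
            nlinarith
          linarith
  have e : ∀ u ∈ Finset.range (M.kdim t + 1),
      ((C (∑ v ∈ Finset.range (M.q t + 1), C (M.theta t u v : ℝ) * X ^ v) * X ^ u :
        ℝ[X][X]).eval (C x)).eval z =
      ∑ v ∈ Finset.range (M.q t + 1), (M.theta t u v : ℝ) * z ^ v * x ^ u := by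
    intro u _
    simp [eval_finsetSum, Finset.sum_mul]
  rw [Finset.sum_congr rfl e]
  refine (Finset.sum_le_sum fun u hu => Finset.sum_le_sum (hterm u hu)).trans ?_
  simp_rw [Finset.sum_add_distrib, ← Finset.sum_mul]
  have h2 : (∑ u ∈ Finset.range (M.kdim t + 1), ∑ v ∈ Finset.range (M.q t + 1),
      if v = 2 then (M.theta t u 2 : ℝ) * x ^ u * z ^ 2 else 0) ≤
      (∑ i ∈ Finset.range (M.kdim t + 1), (M.theta t i 2 : ℝ) * x ^ i) * z ^ 2 := by
    rw [Finset.sum_mul]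
    refine Finset.sum_le_sum fun u _ => ?_
    rw [Finset.sum_ite_eq']
    split_ifs
    · exact le_rfl
    · positivity
  have h0 : (∑ u ∈ Finset.range (M.kdim t + 1), ∑ v ∈ Finset.range (M.q t + 1),
      if v = 0 then (if u = 0 then (1 : ℝ) else 0) else 0) ≤ 1 := by
    simp
  linarith

theorem Phiprod_le (hr : M.r = 2) : ∃ K : ℝ, 0 ≤ K ∧ ∀ n : ℕ,
    (∀ t, (M.cExp n t : ℝ) = (M.En n : ℝ) * M.ρ t / (M.s t : ℝ)) →
    ∀ z : ℝ, 0 ≤ z → z ≤ 1 →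
    (∏ t, M.Phipoly t ^ M.cExp n t).eval z ≤
      Real.exp (M.En n * (M.Cparam / 2 * z ^ 2 + K * z ^ 3)) := by
  choose K hK0 hK using M.Phi_eval_le
  refine ⟨∑ t, M.ρ t / (M.s t : ℝ) * K t, Finset.sum_nonneg fun t _ =>
    mul_nonneg (div_nonneg (M.hρpos t).le (M.s_pos t).le) (hK0 t), fun n hc z hz hz1 => ?_⟩
  have e : (M.En n : ℝ) * (M.Cparam / 2 * z ^ 2 + (∑ t, M.ρ t / (M.s t : ℝ) * K t) * z ^ 3) =
      ∑ t, (M.cExp n t : ℝ) * ((M.phi t 2 : ℝ) * z ^ 2 + K t * z ^ 3) := by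
    rw [M.Cparam_eq hr, mul_div_cancel_left₀ _ (two_ne_zero), Finset.sum_mul, Finset.sum_mul,
      ← Finset.sum_add_distrib, Finset.mul_sum]
    refine Finset.sum_congr rfl fun t _ => ?_
    rw [hc]; ring
  rw [e, Real.exp_sum, eval_prod]
  refine Finset.prod_le_prod (fun t _ => ?_) fun t _ => ?_
  · rw [eval_pow]
    refine pow_nonneg (le_trans ?_ (coeff_le_eval (M.Phipoly_mem t) hz 0)) _
    exact mul_nonneg (M.Phipoly_mem t 0) (by positivity)
  · rw [eval_pow, Real.exp_nat_mul]
    refine pow_le_pow_left₀ ?_ ?_ _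
    · exact le_trans (mul_nonneg (M.Phipoly_mem t 0) (by positivity))
        (coeff_le_eval (M.Phipoly_mem t) hz 0)
    · refine (hK t z hz hz1).trans ?_
      rw [add_comm]; exact Real.add_one_le_exp _

theorem Qpoly_eval (x : ℝ) : M.Qpoly.eval x = ∑ t, (M.lam t / (M.q t : ℝ)) *
    ∑ i ∈ Finset.range (M.kdim t + 1), (M.theta t i 2 : ℝ) * x ^ i := by
  unfold Qpoly
  rw [eval_finsetSum]
  refine Finset.sum_congr rfl fun t _ => ?_
  rw [eval_smul, eval_finsetSum]; simp

theorem Thetaprod_le {x : ℝ} (hx : 0 ≤ x) : ∃ K : ℝ, 0 ≤ K ∧ ∀ n : ℕ,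
    (∀ t, (M.vExp n t : ℝ) = (M.En n : ℝ) * M.lam t / (M.q t : ℝ)) →
    ∀ z : ℝ, 0 ≤ z → z ≤ 1 →
    ((∏ t, M.Thetapoly t ^ M.vExp n t).eval (C x)).eval z ≤
      Real.exp (M.En n * (M.Qpoly.eval x * z ^ 2 + K * z ^ 3)) := by
  choose K hK0 hK using fun t => M.Theta_eval_le t hx
  refine ⟨∑ t, M.lam t / (M.q t : ℝ) * K t, Finset.sum_nonneg fun t _ =>
    mul_nonneg (div_nonneg (M.hlampos t).le (M.q_pos t).le) (hK0 t), fun n hc z hz hz1 => ?_⟩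
  have e : (M.En n : ℝ) * (M.Qpoly.eval x * z ^ 2 + (∑ t, M.lam t / (M.q t : ℝ) * K t) * z ^ 3) =
      ∑ t, (M.vExp n t : ℝ) * ((∑ i ∈ Finset.range (M.kdim t + 1),
        (M.theta t i 2 : ℝ) * x ^ i) * z ^ 2 + K t * z ^ 3) := by
    rw [M.Qpoly_eval, Finset.sum_mul, Finset.sum_mul,
      ← Finset.sum_add_distrib, Finset.mul_sum]
    refine Finset.sum_congr rfl fun t _ => ?_
    rw [hc]; ring
  have hnn : ∀ t, 0 ≤ ((M.Thetapoly t).eval (C x)).eval z := fun t =>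
    le_trans (mul_nonneg (M.Thetapoly_mem t 0 0) (by positivity))
        (coeff2_le_eval (M.Thetapoly_mem t) hx hz 0 0)
  rw [e, Real.exp_sum, eval_prod, eval_prod]
  refine Finset.prod_le_prod (fun t _ => ?_) fun t _ => ?_
  · rw [eval_pow, eval_pow]
    exact pow_nonneg (hnn t) _
  · rw [eval_pow, eval_pow, Real.exp_nat_mul]
    refine pow_le_pow_left₀ (hnn t) ?_ _
    refine (hK t z hz hz1).trans ?_
    rw [add_comm]; exact Real.add_one_le_exp _

/-- per-term upper bound -/
theorem term_upper (hr : M.r = 2) (hp : M.p = 2) {y : ℝ} (hy : 0 < y)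
    (hyC : M.Pfun y = 1 / M.Cparam) :
    ∃ K : ℝ, 0 ≤ K ∧ ∃ β0 : ℝ, 0 < β0 ∧ ∀ n : ℕ,
    (∀ t, (M.cExp n t : ℝ) = (M.En n : ℝ) * M.ρ t / (M.s t : ℝ)) →
    (∀ t, (M.vExp n t : ℝ) = (M.En n : ℝ) * M.lam t / (M.q t : ℝ)) →
    ∀ w v : ℕ, 0 < v → v < M.En n → ∀ β : ℝ, 0 < β → β ≤ β0 → β ^ 2 = (v : ℝ) / M.En n →
    M.NvCount n w v * M.NcCount n v / ((M.En n).choose v : ℝ) ≤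
      9 * (M.En n : ℝ) ^ 2 * (1 / y) ^ w * Real.exp (M.En n * (K * β ^ 3)) := by
  obtain ⟨K1, hK1, hPhi⟩ := M.Phiprod_le hr
  obtain ⟨K2, hK2, hTh⟩ := M.Thetaprod_le hy.le
  have hC := M.Cparam_pos hr
  set c := √M.Cparam with hc
  have hc0 : 0 < c := Real.sqrt_pos.2 hC
  have hcc : c ^ 2 = M.Cparam := Real.sq_sqrt hC.le
  refine ⟨K1 / c ^ 3 + K2 * c ^ 3 + 1, by positivity, min 1 (min c (1 / c)), by positivity, ?_⟩
  intro n hcE hvE w v hv hvn β hβ hβ0 hβ2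
  have hb1 : β ≤ 1 := hβ0.trans (min_le_left _ _)
  have hb2 : β ≤ c := hβ0.trans ((min_le_right _ _).trans (min_le_left _ _))
  have hb3 : β ≤ 1 / c := hβ0.trans ((min_le_right _ _).trans (min_le_right _ _))
  set E := M.En n with hE
  have hE0 : (0 : ℝ) < E := by exact_mod_cast (by omega : 0 < E)
  have hv0 : (0 : ℝ) < v := by exact_mod_cast hv
  set z := β / c with hz
  set ζ := β * c with hζ
  have hz0 : 0 < z := by positivity
  have hζ0 : 0 < ζ := by positivity
  have hz1 : z ≤ 1 := by rw [hz, div_le_one hc0]; exact hb2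
  have hζ1 : ζ ≤ 1 := by rw [hζ, ← le_div_iff₀ hc0]; exact hb3
  have n1 : M.NcCount n v * z ^ v ≤ Real.exp (E * (M.Cparam / 2 * z ^ 2 + K1 * z ^ 3)) :=
    (coeff_le_eval (M.Phiprod_mem _) hz0.le v).trans (hPhi n hcE z hz0.le hz1)
  have n2 : M.NvCount n w v * (y ^ w * ζ ^ v) ≤
      Real.exp (E * (M.Qpoly.eval y * ζ ^ 2 + K2 * ζ ^ 3)) :=
    (coeff2_le_eval (M.Thetaprod_mem _) hy.le hζ0.le w v).trans (hTh n hvE ζ hζ0.le hζ1)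
  have hQ : M.Qpoly.eval y = 1 / (2 * M.Cparam) := by
    have := M.Pfun_eq hp y
    rw [hyC] at this
    field_simp at this ⊢
    linarith
  set b := (v : ℝ) / E with hb
  have hb0 : 0 < b := by positivity
  have hblt : b < 1 := by rw [hb, div_lt_one hE0]; exact_mod_cast hvn
  have hlow := choose_lower E v hv hvn
  rw [← hb] at hlow
  have hch : (0 : ℝ) < E.choose v := by exact_mod_cast Nat.choose_pos hvn.le
  have n3 : 1 / (E.choose v : ℝ) ≤ 9 * (E : ℝ) ^ 2 * (b ^ v * (1 - b) ^ (E - v)) := by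
    rw [div_le_iff₀ (by positivity)] at hlow
    rw [div_le_iff₀ hch]
    linarith
  have n4 : (1 - b) ^ (E - v) ≤ Real.exp (-v + E * b ^ 2) := by
    have h1 : 1 - b ≤ Real.exp (-b) := by have := Real.add_one_le_exp (-b); linarith
    refine (pow_le_pow_left₀ (by linarith) h1 _).trans ?_
    rw [← Real.exp_nat_mul, Nat.cast_sub hvn.le]
    refine le_of_eq (congrArg _ ?_)
    have : (E : ℝ) * b = v := by rw [hb]; field_simp
    linear_combination (-1 - b) * this
  have hprod : (z ^ v) * (ζ ^ v) = b ^ v := by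
    rw [← mul_pow]
    congr 1
    rw [hz, hζ, ← hβ2]; field_simp
  have hyw : 0 < y ^ w := by positivity
  have hA : M.NvCount n w v * M.NcCount n v * (y ^ w * b ^ v) ≤
      Real.exp (E * (M.Qpoly.eval y * ζ ^ 2 + K2 * ζ ^ 3)) *
      Real.exp (E * (M.Cparam / 2 * z ^ 2 + K1 * z ^ 3)) := by
    rw [← hprod]
    calc _ = (M.NvCount n w v * (y ^ w * ζ ^ v)) * (M.NcCount n v * z ^ v) := by ring
      _ ≤ _ := mul_le_mul n2 n1 (mul_nonneg (M.NcCount_nonneg _ _) (by positivity)) (by positivity)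
  have hB : M.NvCount n w v * M.NcCount n v * (y ^ w * b ^ v) * (1 - b) ^ (E - v) ≤
      Real.exp (E * ((K1 / c ^ 3 + K2 * c ^ 3 + 1) * β ^ 3)) := by
    refine (mul_le_mul hA n4 (pow_nonneg (by linarith) _) (by positivity)).trans ?_
    rw [← Real.exp_add, ← Real.exp_add]
    apply Real.exp_le_exp.2
    have e1 : M.Qpoly.eval y * ζ ^ 2 = b / 2 := by
      rw [hQ, hζ, mul_pow, hβ2, hcc]; field_simp
    have e2 : M.Cparam / 2 * z ^ 2 = b / 2 := by
      rw [hz, div_pow, hβ2, hcc]; field_simp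
    have e3 : z ^ 3 = β ^ 3 / c ^ 3 := by rw [hz, div_pow]
    have e4 : ζ ^ 3 = β ^ 3 * c ^ 3 := by rw [hζ, mul_pow]
    have e5 : (E : ℝ) * b = v := by rw [hb]; field_simp
    have e6 : b ^ 2 ≤ β ^ 3 := by
      rw [← hβ2, ← pow_mul]
      exact pow_le_pow_of_le_one hβ.le hb1 (by norm_num)
    have e7 : (E : ℝ) * b ^ 2 ≤ E * β ^ 3 := by gcongr
    rw [e1, e2, e3, e4]
    have e8 : (E : ℝ) * (b / 2 + K2 * (β ^ 3 * c ^ 3)) +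
      E * (b / 2 + K1 * (β ^ 3 / c ^ 3)) + (-v + E * b ^ 2) =
      (E * b - v) + E * ((K1 / c ^ 3 + K2 * c ^ 3) * β ^ 3) + E * b ^ 2 := by ring
    rw [e8, e5]
    linarith
  have hNN : 0 ≤ M.NvCount n w v * M.NcCount n v :=
    mul_nonneg (M.NvCount_nonneg _ _ _) (M.NcCount_nonneg _ _)
  calc M.NvCount n w v * M.NcCount n v / (E.choose v : ℝ)
      = M.NvCount n w v * M.NcCount n v * (1 / (E.choose v : ℝ)) := by ring
    _ ≤ M.NvCount n w v * M.NcCount n v * (9 * (E : ℝ) ^ 2 * (b ^ v * (1 - b) ^ (E - v))) := by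
        gcongr
    _ = 9 * (E : ℝ) ^ 2 * (1 / y) ^ w *
        (M.NvCount n w v * M.NcCount n v * (y ^ w * b ^ v) * (1 - b) ^ (E - v)) := by
        rw [one_div y, inv_pow]; field_simp
    _ ≤ _ := by gcongr

end DGLDPCss

end

section
namespace DGLDPCss
variable (M : DGLDPCss)

theorem NcCount_lower (hr : M.r = 2) {n J : ℕ} {s : ℝ} (hs : 0 ≤ s)
    (hc : ∀ t, (M.cExp n t : ℝ) = (M.En n : ℝ) * M.ρ t / (M.s t : ℝ))
    (hJ : ∀ t, s * (M.cExp n t : ℝ) ≤ (M.cExp n t : ℝ) - J) :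
    (s * M.En n * (M.Cparam / 2)) ^ J / (J.factorial : ℝ) ≤ M.NcCount n (2 * J) := by
  have h := prod_pow_cone (N := cone1) cone1_alg Finset.univ J (M.cExp n)
    (fun t => s * (M.cExp n t : ℝ)) (fun t => by positivity) hJ
    (fun t => C (M.phi t 2 : ℝ) * X ^ 2) M.Phipoly
    (fun t => by
      rw [mem_cone1]; intro i
      rw [coeff_C_mul, coeff_X_pow]; split_ifs <;> simp)
    (fun t => by
      rw [mem_cone1]; intro i
      have h2 : 2 ≤ M.s t := by have := M.h_hs t; have := M.h_hdim t; omega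
      rw [coeff_sub, coeff_add, coeff_C_mul, coeff_X_pow, coeff_one, Phipoly_coeff]
      by_cases h0 : i = 0
      · subst h0; simp [M.phi_zero]
      · by_cases hi : i = 2
        · subst hi; simp [h2]
        · simp [h0, hi]; split_ifs <;> positivity)
  have h3 := mem_cone1.1 h (2 * J)
  rw [coeff_sub, coeff_smul] at h3
  have h4 : ∑ t, (s * (M.cExp n t : ℝ)) • (C (M.phi t 2 : ℝ) * X ^ 2 : ℝ[X]) =
      C (s * M.En n * (M.Cparam / 2)) * X ^ 2 := by
    rw [M.Cparam_eq hr, mul_div_cancel_left₀ _ two_ne_zero, Finset.mul_sum, map_sum,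
      Finset.sum_mul]
    refine Finset.sum_congr rfl fun t _ => ?_
    rw [hc, smul_eq_C_mul, ← mul_assoc, ← C_mul]
    congr 2
    ring
  rw [h4, mul_pow, ← C_pow, ← pow_mul, coeff_C_mul, coeff_X_pow, if_pos rfl, mul_one,
    smul_eq_mul] at h3
  unfold NcCount
  rw [div_eq_inv_mul]
  linarith

theorem NvCount_lower {n J w : ℕ} {s : ℝ} (hs : 0 ≤ s)
    (hv : ∀ t, (M.vExp n t : ℝ) = (M.En n : ℝ) * M.lam t / (M.q t : ℝ))
    (hJ : ∀ t, s * (M.vExp n t : ℝ) ≤ (M.vExp n t : ℝ) - J) :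
    (s * M.En n) ^ J / (J.factorial : ℝ) * (M.Qpoly ^ J).coeff w ≤ M.NvCount n w (2 * J) := by
  set th : Fin M.nv → ℝ[X] := fun t =>
    ∑ i ∈ Finset.range (M.kdim t + 1), C (M.theta t i 2 : ℝ) * X ^ i with hth
  have hthc : ∀ t i, (th t).coeff i = if i ≤ M.kdim t then (M.theta t i 2 : ℝ) else 0 := by
    intro t i
    rw [hth]; simp only
    rw [finsetSum_coeff]
    simp [coeff_X_pow, Nat.lt_succ_iff]
  have hgc : ∀ t i j, ((C (X ^ 2 : ℝ[X]) * (th t).map C).coeff i).coeff j =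
      if j = 2 then (th t).coeff i else 0 := by
    intro t i j
    rw [coeff_C_mul, coeff_map, mul_comm, coeff_C_mul, coeff_X_pow]
    simp
  have h := prod_pow_cone (N := cone2) cone2_alg Finset.univ J (M.vExp n)
    (fun t => s * (M.vExp n t : ℝ)) (fun t => by positivity) hJ
    (fun t => C (X ^ 2) * (th t).map C) M.Thetapoly
    (fun t => by
      rw [mem_cone2]; intro i j
      rw [hgc, hthc]
      split_ifs <;> simp)
    (fun t => by
      rw [mem_cone2]; intro i j
      rw [coeff_sub, coeff_sub, coeff_add, coeff_add, hgc, hthc, Thetapoly_coeff, coeff_one]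
      by_cases hj : j = 2
      · subst hj
        have e1 : ((if i = 0 then (1 : ℝ[X]) else 0)).coeff 2 = 0 := by
          split_ifs <;> simp [coeff_one]
        rw [e1]
        by_cases hq : 2 ≤ M.q t
        · simp [hq]
        · have : M.theta t i 2 = 0 := by
            unfold theta
            rw [Set.ncard_eq_zero (Set.toFinite _), Set.eq_empty_iff_forall_notMem]
            rintro ⟨U, V⟩ ⟨_, hV, _⟩
            have := Finset.card_le_univ V
            simp only [Fintype.card_fin] at this
            simp only at hV
            omega
          simp [this]
      · by_cases h0 : i = 0
        · subst h0
          by_cases hj0 : j = 0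
          · subst hj0; simp [M.theta_zero]
          · simp [hj, hj0, coeff_one]; split_ifs <;> positivity
        · simp [hj, h0]; split_ifs <;> positivity)
  have h3 := mem_cone2.1 h w (2 * J)
  have h4 : ∑ t, (s * (M.vExp n t : ℝ)) • (C (X ^ 2) * (th t).map C : ℝ[X][X]) =
      C (X ^ 2) * (C (s * M.En n) * M.Qpoly).map C := by
    ext i j
    rw [finsetSum_coeff, finsetSum_coeff, coeff_C_mul, coeff_map, mul_comm (X ^ 2 : ℝ[X]),
      coeff_C_mul, coeff_C_mul, Qpoly_coeff, coeff_X_pow, Finset.mul_sum, Finset.sum_mul]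
    refine Finset.sum_congr rfl fun t _ => ?_
    rw [coeff_smul, coeff_smul, hgc, hthc, hv, smul_eq_mul]
    split_ifs <;> first | ring | simp
  rw [h4, mul_pow, ← C_pow, ← Polynomial.map_pow, mul_pow, ← pow_mul, coeff_sub, coeff_sub,
    coeff_smul, coeff_smul, coeff_C_mul, coeff_map, mul_comm (X ^ (2 * J) : ℝ[X]), coeff_C_mul,
    ← C_pow, coeff_C_mul, coeff_X_pow, if_pos rfl, mul_one, smul_eq_mul] at h3
  unfold NvCount
  rw [div_eq_inv_mul, mul_assoc]
  linarith

theorem ENss_ge_term (n w v : ℕ) (hv : v ≤ M.En n) :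
    M.NvCount n w v * M.NcCount n v / ((M.En n).choose v : ℝ) ≤ M.ENss n w := by
  unfold ENss
  exact Finset.single_le_sum
    (f := fun v => M.NvCount n w v * M.NcCount n v / ((M.En n).choose v : ℝ))
    (fun i _ => div_nonneg (mul_nonneg (M.NvCount_nonneg _ _ _) (M.NcCount_nonneg _ _))
      (by positivity)) (by simp; omega)

theorem ENss_lower (hr : M.r = 2) {n J w : ℕ} {s : ℝ} (hs : 0 ≤ s) (hE : 0 < M.En n)
    (hc : ∀ t, (M.cExp n t : ℝ) = (M.En n : ℝ) * M.ρ t / (M.s t : ℝ))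
    (hv : ∀ t, (M.vExp n t : ℝ) = (M.En n : ℝ) * M.lam t / (M.q t : ℝ))
    (hJc : ∀ t, s * (M.cExp n t : ℝ) ≤ (M.cExp n t : ℝ) - J)
    (hJv : ∀ t, s * (M.vExp n t : ℝ) ≤ (M.vExp n t : ℝ) - J) (hJE : 2 * J ≤ M.En n) :
    s ^ (2 * J) * ((2 * M.Cparam) ^ J * (M.Qpoly ^ J).coeff w) / (2 * J + 1) ≤ M.ENss n w := by
  refine le_trans ?_ (M.ENss_ge_term n w (2 * J) hJE)
  have h1 := M.NcCount_lower hr hs hc hJc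
  have h2 := M.NvCount_lower (w := w) hs hv hJv
  have hQ : 0 ≤ (M.Qpoly ^ J).coeff w := pow_mem M.Qpoly_mem J w
  have hC := (M.Cparam_pos hr).le
  have hE' : (0 : ℝ) < M.En n := by exact_mod_cast hE
  have hch : (0 : ℝ) < (M.En n).choose (2 * J) := by exact_mod_cast Nat.choose_pos hJE
  have h3 : ((M.En n).choose (2 * J) : ℝ) ≤ (M.En n : ℝ) ^ (2 * J) / ((2 * J).factorial : ℝ) :=
    Nat.choose_le_pow_div _ _
  have h4 : (4 : ℝ) ^ J ≤ (2 * J + 1) * ((2 * J).factorial / (J.factorial * J.factorial)) := by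
    have := Nat.four_pow_le_two_mul_add_one_mul_central_binom J
    rw [Nat.choose_eq_factorial_div_factorial (by omega)] at this
    have e : 2 * J - J = J := by omega
    rw [e] at this
    have h5 : ((J.factorial * J.factorial) ∣ (2 * J).factorial) := by
      have := Nat.factorial_mul_factorial_dvd_factorial_add J J
      rwa [two_mul]
    have h6 : ((4 ^ J : ℕ) : ℝ) ≤ (((2 * J + 1) * ((2 * J).factorial / (J.factorial * J.factorial)) : ℕ) : ℝ) := by
      exact_mod_cast this
    rw [Nat.cast_mul, Nat.cast_div h5 (by positivity)] at h6
    push_cast at h6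
    exact h6
  rw [le_div_iff₀ hch]
  have hmul := mul_le_mul h2 h1 (by positivity) (M.NvCount_nonneg _ _ _)
  refine le_trans ?_ hmul
  set q := (M.Qpoly ^ J).coeff w
  set E : ℝ := (M.En n : ℝ)
  have hA : 0 ≤ s ^ (2 * J) * ((2 * M.Cparam) ^ J * q) / (2 * J + 1) := by positivity
  refine (mul_le_mul_of_nonneg_left h3 hA).trans ?_
  have hf2 : (0 : ℝ) < ((2 * J).factorial : ℝ) := by positivity
  have hf : (0 : ℝ) < (J.factorial : ℝ) := by positivity
  have e1 : (s * E) ^ J / (J.factorial : ℝ) * q * ((s * E * (M.Cparam / 2)) ^ J / (J.factorial : ℝ))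
      = s ^ (2 * J) * (E ^ (2 * J)) * (M.Cparam / 2) ^ J * q / (J.factorial * J.factorial) := by
    rw [mul_pow, mul_pow, mul_pow, two_mul, pow_add, pow_add]
    field_simp
  have e2 : (2 * M.Cparam) ^ J = 4 ^ J * (M.Cparam / 2) ^ J := by rw [← mul_pow]; congr 1; ring
  rw [e1, e2]
  set c := (M.Cparam / 2) ^ J
  have hc0 : 0 ≤ c := by positivity
  have : s ^ (2 * J) * (4 ^ J * c * q) / (2 * J + 1) * (E ^ (2 * J) / ((2 * J).factorial : ℝ)) =
     (s ^ (2 * J) * c * q * E ^ (2 * J)) / ((2 * J).factorial * (2 * J + 1)) * 4 ^ J := by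
    field_simp
  rw [this]
  refine (mul_le_mul_of_nonneg_left h4 (by positivity)).trans (le_of_eq ?_)
  field_simp

/-- Lower bound along multiples of `i0`. -/
theorem ENss_lower' (hr : M.r = 2) (hp : M.p = 2) {y : ℝ} (hy : 0 < y)
    (hyC : M.Pfun y = 1 / M.Cparam) : ∃ i0 : ℕ, 1 ≤ i0 ∧ ∃ c : ℝ, 0 < c ∧ 
    ∀ n N : ℕ, ∀ s : ℝ, 0 ≤ s → s ≤ 1 → 0 < M.En n → 
    (∀ t, (M.cExp n t : ℝ) = (M.En n : ℝ) * M.ρ t / (M.s t : ℝ)) →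
    (∀ t, (M.vExp n t : ℝ) = (M.En n : ℝ) * M.lam t / (M.q t : ℝ)) →
    (∀ t, s * (M.cExp n t : ℝ) ≤ (M.cExp n t : ℝ) - (i0 * N : ℕ)) →
    (∀ t, s * (M.vExp n t : ℝ) ≤ (M.vExp n t : ℝ) - (i0 * N : ℕ)) → 2 * (i0 * N) ≤ M.En n → 
    (1 / y) ^ (i0 * N) * s ^ (2 * (i0 * N)) * 
      (c / ((N + 1 : ℝ) ^ i0 * (2 * (i0 * N : ℕ) + 1))) ≤ M.ENss n (i0 * N) := by
  obtain ⟨i0, hi0, hpos⟩ := M.Qpoly_pos hp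
  have hC := M.Cparam_pos hr
  set p : ℝ[X] := C (2 * M.Cparam) * M.Qpoly.comp (C y * X) with hpdef
  have hpc : ∀ J i, (p ^ J).coeff i = (2 * M.Cparam) ^ J * (M.Qpoly ^ J).coeff i * y ^ i := by
    intro J i
    rw [hpdef, mul_pow, ← C_pow, coeff_C_mul, ← Polynomial.pow_comp, comp_C_mul_X_coeff, mul_assoc]
  have hpc1 : ∀ i, p.coeff i = (2 * M.Cparam) * M.Qpoly.coeff i * y ^ i := by
    intro i; simpa using hpc 1 i
  have hQ : ∀ i, 0 ≤ M.Qpoly.coeff i := M.Qpoly_mem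
  obtain ⟨c, hc, hren⟩ := renewal (p := p) (fun i => by rw [hpc1]; have := hQ i; positivity)
    (by rw [hpc1, Qpoly_zero]; ring)
    (by
      rw [M.Pfun_eq hp] at hyC
      rw [hpdef, eval_mul, eval_C, eval_comp]
      simp only [eval_mul, eval_C, eval_X, mul_one]
      field_simp at hyC
      linarith)
    i0 (by rw [hpc1]; positivity)
  refine ⟨i0, hi0, c, hc, ?_⟩
  intro n N s hs hs1 hE hce hve hcJ hvJ h2
  obtain ⟨J, hJ, hge⟩ := hren N
  set w := i0 * N with hw
  have hJw : (J : ℝ) ≤ (w : ℕ) := by exact_mod_cast hJ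
  refine le_trans ?_ (M.ENss_lower (J := J) (w := w) hr hs hE hce hve
    (fun t => (hcJ t).trans (by linarith)) (fun t => (hvJ t).trans (by linarith)) (by omega))
  rw [hpc] at hge
  have h5 : c / (N + 1 : ℝ) ^ i0 * (1 / y) ^ w ≤ (2 * M.Cparam) ^ J * (M.Qpoly ^ J).coeff w := by
    rw [one_div, inv_pow, ← div_eq_mul_inv, div_le_iff₀ (by positivity)]
    exact hge
  have hs2 : s ^ (2 * w) ≤ s ^ (2 * J) := pow_le_pow_of_le_one hs hs1 (by omega)
  calc (1 / y) ^ w * s ^ (2 * w) * (c / ((N + 1 : ℝ) ^ i0 * (2 * (w : ℕ) + 1)))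
      = s ^ (2 * w) * (c / (N + 1 : ℝ) ^ i0 * (1 / y) ^ w) / (2 * (w : ℕ) + 1) := by
        field_simp
    _ ≤ s ^ (2 * J) * (c / (N + 1 : ℝ) ^ i0 * (1 / y) ^ w) / (2 * (w : ℕ) + 1) := by gcongr
    _ ≤ s ^ (2 * J) * ((2 * M.Cparam) ^ J * (M.Qpoly ^ J).coeff w) / (2 * (w : ℕ) + 1) := by gcongr
    _ ≤ s ^ (2 * J) * ((2 * M.Cparam) ^ J * (M.Qpoly ^ J).coeff w) / (2 * J + 1) := by
        have : 0 ≤ (M.Qpoly ^ J).coeff w := pow_mem M.Qpoly_mem J w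
        gcongr

end DGLDPCss

end

section
theorem log_lin_div (a b : ℝ) (ha : 0 < a) :
    Tendsto (fun n : ℕ => Real.log (a * n + b) / n) atTop (nhds 0) := by
  have h1 := Real.tendsto_pow_log_div_mul_add_atTop a⁻¹ (-b / a) 1 (by positivity)
  have h2 : Tendsto (fun n : ℕ => a * (n : ℝ) + b) atTop atTop :=
    tendsto_atTop_add_const_right _ _
      ((tendsto_natCast_atTop_atTop (R := ℝ)).const_mul_atTop ha)
  refine (h1.comp h2).congr fun n => ?_
  simp only [Function.comp, pow_one]
  congr 1
  field_simp
  ring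

theorem abstract_limit (A : Set ℕ) (hA : A.Nonempty) (hpos : ∀ n ∈ A, 0 < n)
    (f g : ℕ → ℝ) (B : ℝ) (hg : Tendsto (fun n => g n / n) atTop (nhds 0))
    (hB : ∀ n ∈ A, f n ≤ g n + n * B)
    (hsup : ∀ n1 ∈ A, ∀ m ∈ A, ∃ c : ℝ, ∀ k : ℕ, c + k * (f n1 - g n1) ≤ f (m + k * n1)) :
    ∃ G : ℝ, Tendsto (fun n => f n / n) (atTop ⊓ 𝓟 A) (nhds G) ∧ G ≤ B := by
  set S : Set ℝ := (fun n : ℕ => (f n - g n) / n) '' A with hS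
  have hSne : S.Nonempty := hA.image _
  have hSB : ∀ x ∈ S, x ≤ B := by
    rintro _ ⟨n, hn, rfl⟩
    have : (0 : ℝ) < n := by exact_mod_cast hpos n hn
    simp only
    rw [div_le_iff₀ this]
    linarith [hB n hn]
  have hbdd : BddAbove S := ⟨B, hSB⟩
  refine ⟨sSup S, ?_, csSup_le hSne hSB⟩
  rw [tendsto_order]
  have hev : ∀ P : ℕ → Prop, (∀ᶠ n : ℕ in atTop, n ∈ A → P n) → ∀ᶠ n in atTop ⊓ 𝓟 A, P n := by
    intro P h
    rwa [eventually_inf_principal]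
  constructor
  · intro a ha
    obtain ⟨_, ⟨n1, hn1, rfl⟩, hL⟩ := exists_lt_of_lt_csSup hSne ha
    simp only at hL
    set L := (f n1 - g n1) / n1 with hLd
    have hn1p : 0 < n1 := hpos n1 hn1
    have hn1' : (0 : ℝ) < n1 := by exact_mod_cast hn1p
    have hfl : f n1 - g n1 = n1 * L := by rw [hLd]; field_simp
    have hres : ∀ r : ℕ, ∃ K : ℝ, ∀ n ∈ A, n % n1 = r → n * L - K ≤ f n := by
      intro r
      by_cases hex : ∃ m, m ∈ A ∧ m % n1 = r
      · set m := Nat.find hex with hm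
        obtain ⟨hmA, hmr⟩ := Nat.find_spec hex
        obtain ⟨c, hc⟩ := hsup n1 hn1 m hmA
        refine ⟨m * L - c, fun n hn hnr => ?_⟩
        have hmn : m ≤ n := Nat.find_min' hex ⟨hn, hnr⟩
        have hdvd : n1 ∣ n - m := (Nat.modEq_iff_dvd' hmn).1 (hmr.trans hnr.symm)
        obtain ⟨k, hk⟩ := hdvd
        have hnk : n = m + k * n1 := by rw [mul_comm]; omega
        have := hc k
        rw [← hnk, hfl] at this
        have e : (n : ℝ) = m + k * n1 := by exact_mod_cast hnk
        rw [e] at *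
        linarith
      · refine ⟨0, fun n hn hnr => (hex ⟨n, hn, hnr⟩).elim⟩
    choose K hK using hres
    set KK := ∑ r ∈ Finset.range n1, |K r| with hKK
    have hall : ∀ n ∈ A, n * L - KK ≤ f n := by
      intro n hn
      refine le_trans ?_ (hK _ n hn rfl)
      have := Finset.single_le_sum (f := fun r => |K r|) (fun _ _ => abs_nonneg _)
        (Finset.mem_range.2 (Nat.mod_lt n hn1p))
      have h2 := le_abs_self (K (n % n1))
      linarith
    have hlim : Tendsto (fun n : ℕ => L - KK / n) atTop (nhds (L - 0)) :=
      tendsto_const_nhds.sub (tendsto_const_div_atTop_nhds_zero_nat KK)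
    rw [sub_zero] at hlim
    refine hev _ ?_
    filter_upwards [hlim.eventually_const_lt hL] with n hn hnA
    refine hn.trans_le ?_
    have : (0 : ℝ) < n := by exact_mod_cast hpos n hnA
    rw [le_div_iff₀ this, sub_mul, div_mul_cancel₀ _ this.ne']
    linarith [hall n hnA]
  · intro a ha
    refine hev _ ?_
    filter_upwards [hg.eventually_lt_const (sub_pos.2 ha)] with n hn hnA
    have h1 : (f n - g n) / n ≤ sSup S := le_csSup hbdd ⟨n, hnA, rfl⟩
    rw [sub_div] at h1
    linarith

namespace DGLDPCss
variable (M : DGLDPCss)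

theorem intlam_pos : 0 < M.intlam := by
  unfold intlam
  refine Finset.sum_pos (fun t _ => div_pos (M.hlampos t) (M.q_pos t)) ⟨⟨0, M.hnv⟩, Finset.mem_univ _⟩

/-- The integrality part of `Adm`. -/
def Ex (α : ℝ) (n : ℕ) : Prop :=
  ((M.En n : ℝ) = (n : ℝ) / M.intlam) ∧
  (∀ t, (M.cExp n t : ℝ) = (M.En n : ℝ) * M.ρ t / (M.s t : ℝ)) ∧
  (∀ t, (M.vExp n t : ℝ) = (M.En n : ℝ) * M.lam t / (M.q t : ℝ)) ∧
  ((⌊α * (n : ℝ)⌋₊ : ℝ) = α * (n : ℝ))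

variable {M}

theorem Adm.ex {α : ℝ} {n : ℕ} (h : M.Adm α n) : M.Ex α n :=
  ⟨h.2.1, h.2.2.1, h.2.2.2.1, h.2.2.2.2.1⟩

theorem Ex.add {α : ℝ} {n m : ℕ} (hn : M.Ex α n) (hm : M.Ex α m) :
    M.Ex α (n + m) ∧ M.En (n + m) = M.En n + M.En m ∧
    (∀ t, M.cExp (n + m) t = M.cExp n t + M.cExp m t) ∧
    (∀ t, M.vExp (n + m) t = M.vExp n t + M.vExp m t) ∧
    ⌊α * ((n + m : ℕ) : ℝ)⌋₊ = ⌊α * (n : ℝ)⌋₊ + ⌊α * (m : ℝ)⌋₊ := by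
  obtain ⟨a1, a2, a3, a4⟩ := hn
  obtain ⟨b1, b2, b3, b4⟩ := hm
  have e1 : M.En (n + m) = M.En n + M.En m := by
    have : ((n + m : ℕ) : ℝ) / M.intlam = ((M.En n + M.En m : ℕ) : ℝ) := by
      push_cast; rw [a1, b1, add_div]
    show ⌊((n + m : ℕ) : ℝ) / M.intlam⌋₊ = _
    rw [this, Nat.floor_natCast]
  have e2 : ∀ t, M.cExp (n + m) t = M.cExp n t + M.cExp m t := by
    intro t
    have : (M.En (n + m) : ℝ) * M.ρ t / (M.s t : ℝ) = ((M.cExp n t + M.cExp m t : ℕ) : ℝ) := by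
      push_cast; rw [a2, b2, e1]; push_cast; ring
    show ⌊(M.En (n + m) : ℝ) * M.ρ t / (M.s t : ℝ)⌋₊ = _
    rw [this, Nat.floor_natCast]
  have e3 : ∀ t, M.vExp (n + m) t = M.vExp n t + M.vExp m t := by
    intro t
    have : (M.En (n + m) : ℝ) * M.lam t / (M.q t : ℝ) = ((M.vExp n t + M.vExp m t : ℕ) : ℝ) := by
      push_cast; rw [a3, b3, e1]; push_cast; ring
    show ⌊(M.En (n + m) : ℝ) * M.lam t / (M.q t : ℝ)⌋₊ = _
    rw [this, Nat.floor_natCast]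
  have e4 : ⌊α * ((n + m : ℕ) : ℝ)⌋₊ = ⌊α * (n : ℝ)⌋₊ + ⌊α * (m : ℝ)⌋₊ := by
    have : α * ((n + m : ℕ) : ℝ) = ((⌊α * (n : ℝ)⌋₊ + ⌊α * (m : ℝ)⌋₊ : ℕ) : ℝ) := by
      push_cast; rw [a4, b4, mul_add]
    rw [this, Nat.floor_natCast]
  refine ⟨⟨?_, ?_, ?_, ?_⟩, e1, e2, e3, e4⟩
  · rw [e1]; push_cast; rw [a1, b1, add_div]
  · intro t; rw [e1, e2]; push_cast; rw [a2, b2]; ring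
  · intro t; rw [e1, e3]; push_cast; rw [a3, b3]; ring
  · rw [e4]; push_cast; rw [a4, b4, mul_add]

theorem term_super {α : ℝ} {m n : ℕ} (hm : M.Ex α m) (hn : M.Ex α n) (w0 v0 w1 v1 k : ℕ) :
    M.Ex α (m + k * n) ∧ M.En (m + k * n) = M.En m + k * M.En n ∧
    ⌊α * ((m + k * n : ℕ) : ℝ)⌋₊ = ⌊α * (m : ℝ)⌋₊ + k * ⌊α * (n : ℝ)⌋₊ ∧
    M.NvCount m w0 v0 * M.NcCount m v0 * (M.NvCount n w1 v1 * M.NcCount n v1) ^ k ≤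
      M.NvCount (m + k * n) (w0 + k * w1) (v0 + k * v1) * M.NcCount (m + k * n) (v0 + k * v1) := by
  induction k with
  | zero => simp [hm]
  | succ k ih =>
    obtain ⟨h1, h2, h3, h4⟩ := ih
    obtain ⟨g1, g2, g3, g4, g5⟩ := h1.add hn
    have en : m + (k + 1) * n = m + k * n + n := by ring
    have ew : w0 + (k + 1) * w1 = w0 + k * w1 + w1 := by ring
    have ev : v0 + (k + 1) * v1 = v0 + k * v1 + v1 := by ring
    rw [en, ew, ev]
    refine ⟨g1, by rw [g2, h2]; ring, by rw [g5, h3]; ring, ?_⟩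
    have p1 := M.NcCount_super g3 (v0 + k * v1) v1
    have p2 := M.NvCount_super g4 (w0 + k * w1) w1 (v0 + k * v1) v1
    have q1 := M.NcCount_nonneg n v1
    have q2 := M.NvCount_nonneg n w1 v1
    have q3 := M.NcCount_nonneg (m + k * n) (v0 + k * v1)
    have q4 := M.NvCount_nonneg (m + k * n) (w0 + k * w1) (v0 + k * v1)
    rw [pow_succ, ← mul_assoc]
    refine (mul_le_mul_of_nonneg_right h4 (mul_nonneg q2 q1)).trans ?_
    refine le_trans (le_of_eq ?_) (mul_le_mul p2 p1 (mul_nonneg q3 q1) (M.NvCount_nonneg _ _ _))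
    ring

theorem exists_v {α : ℝ} (hα : 0 < α) (hsmall : M.Qm * α * M.intlam < 1) {n : ℕ}
    (h : M.Adm α n) : ∃ v, 0 < v ∧ v < M.En n ∧
      M.ENss n ⌊α * (n : ℝ)⌋₊ / (M.En n + 1) ≤
        M.NvCount n ⌊α * (n : ℝ)⌋₊ v * M.NcCount n v / ((M.En n).choose v : ℝ) := by
  obtain ⟨hn, hE, hc, hv, hw, hpos⟩ := h
  set w := ⌊α * (n : ℝ)⌋₊ with hwd
  have hL := M.intlam_pos
  have hn' : (0 : ℝ) < n := by exact_mod_cast hn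
  obtain ⟨v, hvr, hle⟩ := Finset.exists_le_of_sum_le (s := Finset.range (M.En n + 1))
    (f := fun _ => M.ENss n w / (M.En n + 1))
    (g := fun v => M.NvCount n w v * M.NcCount n v / ((M.En n).choose v : ℝ)) (by simp)
    (by
      rw [Finset.sum_const, Finset.card_range, nsmul_eq_mul]
      push_cast
      rw [mul_div_cancel₀ _ (by positivity)]
      exact le_of_eq rfl)
  have hne : M.NvCount n w v ≠ 0 := by
    intro h0
    rw [h0] at hle
    have : 0 < M.ENss n w / (M.En n + 1) := by positivity
    simp at hle
    linarith
  obtain ⟨s1, s2⟩ := M.NvCount_supp hne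
  have hwpos : 0 < w := by
    have : (0 : ℝ) < w := by rw [hw]; positivity
    exact_mod_cast this
  refine ⟨v, ?_, ?_, hle⟩
  · rcases Nat.eq_zero_or_pos v with h0 | h0
    · subst h0; omega
    · exact h0
  · have h1 : (v : ℝ) ≤ M.Qm * w := by exact_mod_cast s1
    have h2 : (n : ℝ) = M.intlam * M.En n := by rw [hE]; field_simp
    have hE0 : (0 : ℝ) < M.En n := by rw [hE]; positivity
    have h3 : (v : ℝ) < M.En n := by
      calc (v : ℝ) ≤ M.Qm * w := h1
        _ = (M.Qm * α * M.intlam) * M.En n := by rw [hw, h2]; ring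
        _ < 1 * M.En n := by gcongr
        _ = _ := one_mul _
    exact_mod_cast h3

theorem super_lower {α : ℝ} (hα : 0 < α) (hsmall : M.Qm * α * M.intlam < 1) {n m : ℕ}
    (hn : M.Adm α n) (hm : M.Adm α m) : ∃ c : ℝ, 0 < c ∧ ∀ k : ℕ,
      c * (M.ENss n ⌊α * (n : ℝ)⌋₊ / (9 * (M.En n : ℝ) ^ 2 * (M.En n + 1))) ^ k ≤
        M.ENss (m + k * n) ⌊α * ((m + k * n : ℕ) : ℝ)⌋₊ := by
  obtain ⟨v1, hv1, hv1E, hle1⟩ := exists_v hα hsmall hn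
  obtain ⟨v0, hv0, hv0E, hle0⟩ := exists_v hα hsmall hm
  have hEN1 := hn.2.2.2.2.2
  have hEN0 := hm.2.2.2.2.2
  set w1 := ⌊α * (n : ℝ)⌋₊ with hw1
  set w0 := ⌊α * (m : ℝ)⌋₊ with hw0
  set E1 := M.En n
  set E0 := M.En m
  set T1 := M.NvCount n w1 v1 * M.NcCount n v1 with hT1
  set T0 := M.NvCount m w0 v0 * M.NcCount m v0 with hT0
  have hE1 : (0 : ℝ) < E1 := by exact_mod_cast (by omega : 0 < E1)
  have hv1' : (0 : ℝ) < v1 := by exact_mod_cast hv1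
  have hT0n : 0 ≤ T0 := mul_nonneg (M.NvCount_nonneg _ _ _) (M.NcCount_nonneg _ _)
  have hT1n : 0 ≤ T1 := mul_nonneg (M.NvCount_nonneg _ _ _) (M.NcCount_nonneg _ _)
  have hT0p : 0 < T0 := by
    rcases hT0n.eq_or_lt with h | h
    · rw [← h, zero_div] at hle0
      have : 0 < M.ENss m w0 / (E0 + 1) := by positivity
      linarith
    · exact h
  set b : ℝ := (v1 : ℝ) / E1 with hb
  have hb0 : 0 < b := by positivity
  have hb1 : b < 1 := by
    rw [hb, div_lt_one hE1]; exact_mod_cast hv1E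
  have hb1' : 0 < 1 - b := by linarith
  have hlow := choose_lower E1 v1 hv1 hv1E
  rw [← hb] at hlow
  have hch1 : (0 : ℝ) < E1.choose v1 := by exact_mod_cast Nat.choose_pos hv1E.le
  set γ := b ^ v1 * (1 - b) ^ (E1 - v1) with hγ
  have hγ0 : 0 < γ := by positivity
  have hTγ : M.ENss n w1 / (9 * (E1 : ℝ) ^ 2 * (E1 + 1)) ≤ T1 * γ := by
    have h1 : M.ENss n w1 / (E1 + 1) * E1.choose v1 ≤ T1 := by
      rwa [le_div_iff₀ hch1] at hle1
    calc M.ENss n w1 / (9 * (E1 : ℝ) ^ 2 * (E1 + 1))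
        = M.ENss n w1 / (E1 + 1) * (1 / (9 * (E1 : ℝ) ^ 2)) := by field_simp
      _ ≤ M.ENss n w1 / (E1 + 1) * (E1.choose v1 * γ) := by gcongr
      _ = M.ENss n w1 / (E1 + 1) * E1.choose v1 * γ := by ring
      _ ≤ T1 * γ := by gcongr
  refine ⟨T0 * (b ^ v0 * (1 - b) ^ (E0 - v0)), by positivity, fun k => ?_⟩
  obtain ⟨h1, h2, h3, h4⟩ := term_super hm.ex hn.ex w0 v0 w1 v1 k
  rw [h3]
  have hvE : v0 + k * v1 ≤ M.En (m + k * n) := by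
    rw [h2]
    exact Nat.add_le_add hv0E.le (Nat.mul_le_mul_left _ hv1E.le)
  refine le_trans ?_ (M.ENss_ge_term (m + k * n) (w0 + k * w1) (v0 + k * v1) hvE)
  have hchp : (0 : ℝ) < (M.En (m + k * n)).choose (v0 + k * v1) := by
    exact_mod_cast Nat.choose_pos hvE
  have hup := choose_upper (M.En (m + k * n)) (v0 + k * v1) hb0.le hb1.le
  have hsub : M.En (m + k * n) - (v0 + k * v1) = (E0 - v0) + k * (E1 - v1) := by
    have h5 : k * v1 ≤ k * E1 := Nat.mul_le_mul_left _ hv1E.le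
    have h6 : v0 < E0 := hv0E
    have h7 : M.En (m + k * n) = E0 + k * E1 := h2
    rw [h7, Nat.mul_sub]
    generalize k * E1 = a at *
    generalize k * v1 = a' at *
    clear_value E0
    omega
  rw [hsub] at hup
  rw [le_div_iff₀ hchp]
  refine le_trans ?_ h4
  have hR : (M.ENss n w1 / (9 * (E1 : ℝ) ^ 2 * (E1 + 1))) ^ k ≤ (T1 * γ) ^ k :=
    pow_le_pow_left₀ (by positivity) hTγ k
  calc T0 * (b ^ v0 * (1 - b) ^ (E0 - v0)) * (M.ENss n w1 / (9 * (E1 : ℝ) ^ 2 * (E1 + 1))) ^ k *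
        ((M.En (m + k * n)).choose (v0 + k * v1) : ℝ)
      ≤ T0 * (b ^ v0 * (1 - b) ^ (E0 - v0)) * (T1 * γ) ^ k *
        ((M.En (m + k * n)).choose (v0 + k * v1) : ℝ) := by gcongr
    _ = T0 * T1 ^ k * (((M.En (m + k * n)).choose (v0 + k * v1) : ℝ) *
        (b ^ (v0 + k * v1) * (1 - b) ^ (E0 - v0 + k * (E1 - v1)))) := by
        rw [mul_pow, hγ, mul_pow, pow_add, pow_add, mul_comm k v1, mul_comm k (E1 - v1), pow_mul,
          pow_mul]
        ring
    _ ≤ T0 * T1 ^ k * 1 := by gcongr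
    _ = _ := mul_one _

end DGLDPCss

end

section
theorem log_tail (x : ℝ) (hx : 0 ≤ x) (hx2 : x ≤ 1 / 2) : -(2 * x) ≤ Real.log (1 - x) := by
  have hs0 : 0 < 1 - x := by linarith
  refine le_trans ?_ (Real.one_sub_inv_le_log_of_pos hs0)
  have : (1 - x)⁻¹ ≤ 1 + 2 * x := by
    rw [← one_div, div_le_iff₀ hs0]
    nlinarith
  linarith

namespace DGLDPCss
variable (M : DGLDPCss)

theorem log_upper (hr : M.r = 2) (hp : M.p = 2) {y : ℝ} (hy : 0 < y)
    (hyC : M.Pfun y = 1 / M.Cparam) : ∃ K : ℝ, 0 ≤ K ∧ ∃ ε : ℝ, 0 < ε ∧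
    ∀ α : ℝ, 0 < α → α ≤ ε → ∀ n, M.Adm α n →
      Real.log (M.ENss n ⌊α * (n : ℝ)⌋₊) ≤ Real.log (9 * (M.En n : ℝ) ^ 2 * (M.En n + 1)) +
        n * (α * Real.log (1 / y) + K * α ^ ((3 : ℝ) / 2)) := by
  obtain ⟨K, hK, β0, hβ0, H⟩ := M.term_upper hr hp hy hyC
  have hL := M.intlam_pos
  have hQ : (0 : ℝ) < M.Qm := by exact_mod_cast M.Qm_pos
  set d := √(M.Qm * M.intlam) with hd
  have hd0 : 0 < d := Real.sqrt_pos.2 (by positivity)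
  have hdd : d ^ 2 = M.Qm * M.intlam := Real.sq_sqrt (by positivity)
  refine ⟨K * d ^ 3 / M.intlam, by positivity, min ((β0 / d) ^ 2) (1 / (2 * (M.Qm * M.intlam))),
    by positivity, ?_⟩
  intro α hα hαε n hAdm
  have hα1 : α ≤ (β0 / d) ^ 2 := hαε.trans (min_le_left _ _)
  have hα2 : α ≤ 1 / (2 * (M.Qm * M.intlam)) := hαε.trans (min_le_right _ _)
  obtain ⟨hn, hE, hc, hv, hw, hpos⟩ := hAdm
  have hn' : (0 : ℝ) < n := by exact_mod_cast hn
  set w := ⌊α * (n : ℝ)⌋₊ with hwd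
  have hE0 : (0 : ℝ) < M.En n := by rw [hE]; positivity
  have hnE : (n : ℝ) = M.intlam * M.En n := by rw [hE]; field_simp
  set a := √α with ha
  have ha0 : 0 < a := Real.sqrt_pos.2 hα
  have haa : a ^ 2 = α := Real.sq_sqrt hα.le
  have ha3 : a ^ 3 = α ^ ((3 : ℝ) / 2) := by
    rw [ha, Real.sqrt_eq_rpow, ← Real.rpow_natCast, ← Real.rpow_mul hα.le]
    norm_num
  have hda : d * a ≤ β0 := by
    have h1 : a ≤ β0 / d := by
      rw [ha]; exact Real.sqrt_le_iff.2 ⟨by positivity, hα1⟩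
    rw [le_div_iff₀ hd0] at h1
    linarith
  have hwpos : 0 < w := by
    have : (0 : ℝ) < w := by rw [hw]; positivity
    exact_mod_cast this
  set U := 9 * (M.En n : ℝ) ^ 2 * (1 / y) ^ w * Real.exp (M.En n * (K * (d * a) ^ 3)) with hU
  have hU0 : 0 < U := by positivity
  have hterm : ∀ v ∈ Finset.range (M.En n + 1),
      M.NvCount n w v * M.NcCount n v / ((M.En n).choose v : ℝ) ≤ U := by
    intro v _
    by_cases hne : M.NvCount n w v = 0
    · rw [hne, zero_mul, zero_div]; exact hU0.le
    obtain ⟨s1, s2⟩ := M.NvCount_supp hne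
    have hv0 : 0 < v := by
      rcases Nat.eq_zero_or_pos v with h0 | h0
      · subst h0; omega
      · exact h0
    have hv0' : (0 : ℝ) < v := by exact_mod_cast hv0
    have h1 : (v : ℝ) ≤ M.Qm * w := by exact_mod_cast s1
    have h2 : (v : ℝ) / M.En n ≤ M.Qm * M.intlam * α := by
      rw [div_le_iff₀ hE0]
      rw [hw, hnE] at h1
      linarith
    have h3 : M.Qm * M.intlam * α ≤ 1 / 2 := by
      rw [le_div_iff₀ (by positivity)] at hα2
      linarith
    have hvE : v < M.En n := by
      have : (v : ℝ) < M.En n := by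
        have : (v : ℝ) / M.En n < 1 := by linarith
        rwa [div_lt_one hE0] at this
      exact_mod_cast this
    have hβle : √((v : ℝ) / M.En n) ≤ d * a := by
      refine Real.sqrt_le_iff.2 ⟨by positivity, ?_⟩
      rw [mul_pow, hdd, haa]; exact h2
    refine (H n hc hv w v hv0 hvE (√((v : ℝ) / M.En n)) (Real.sqrt_pos.2 (by positivity))
      (hβle.trans hda) (Real.sq_sqrt (by positivity))).trans ?_
    rw [hU]
    gcongr
  have hsum : M.ENss n w ≤ (M.En n + 1) * U := by
    unfold ENss
    refine (Finset.sum_le_card_nsmul _ _ _ hterm).trans (le_of_eq ?_)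
    rw [Finset.card_range, nsmul_eq_mul]; push_cast; ring
  refine (Real.log_le_log hpos hsum).trans (le_of_eq ?_)
  have e : (M.En n + 1) * U = (9 * (M.En n : ℝ) ^ 2 * (M.En n + 1)) *
      ((1 / y) ^ w * Real.exp (M.En n * (K * (d * a) ^ 3))) := by rw [hU]; ring
  have hy1 : (1 / y) ^ w ≠ 0 := by positivity
  rw [e, Real.log_mul (by positivity) (by positivity), Real.log_mul hy1 (Real.exp_pos _).ne',
    Real.log_exp, Real.log_pow, hw, ← ha3, hE]
  field_simp

theorem Adm_add {α : ℝ} (hα : 0 < α) (hsmall : M.Qm * α * M.intlam < 1) {n m : ℕ}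
    (hn : M.Adm α n) (hm : M.Adm α m) (k : ℕ) : M.Adm α (m + k * n) := by
  obtain ⟨c, hc, H⟩ := super_lower hα hsmall hn hm
  obtain ⟨h1, h2, h3, h4⟩ := (term_super hm.ex hn.ex 0 0 0 0 k).1
  refine ⟨by have := hm.1; omega, h1, h2, h3, h4, lt_of_lt_of_le ?_ (H k)⟩
  have := hn.2.2.2.2.2
  obtain ⟨v, hv, hvE, -⟩ := exists_v hα hsmall hn
  have : (0 : ℝ) < M.En n := by exact_mod_cast (by omega : 0 < M.En n)
  positivity

set_option maxHeartbeats 1000000 in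
theorem lower_G (hr : M.r = 2) (hp : M.p = 2) {y : ℝ} (hy : 0 < y)
    (hyC : M.Pfun y = 1 / M.Cparam) : ∃ κ : ℝ, 0 ≤ κ ∧ ∃ ε : ℝ, 0 < ε ∧
    ∀ α : ℝ, 0 < α → α ≤ ε → M.Qm * α * M.intlam < 1 → ∀ n1, M.Adm α n1 → ∀ G : ℝ,
      Tendsto (M.grSeq α) (atTop ⊓ 𝓟 {n : ℕ | M.Adm α n}) (nhds G) →
      α * Real.log (1 / y) - κ * α ^ ((3 : ℝ) / 2) ≤ G := by
  obtain ⟨i0, hi0, c, hc, H⟩ := M.ENss_lower' hr hp hy hyC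
  have hL := M.intlam_pos
  set κ : ℝ := ∑ t, (M.s t : ℝ) * M.intlam / M.ρ t + ∑ t, (M.q t : ℝ) * M.intlam / M.lam t with hκ
  have hA : ∀ t, 0 ≤ (M.s t : ℝ) * M.intlam / M.ρ t := fun t => by
    have := M.hρpos t; positivity
  have hB : ∀ t, 0 ≤ (M.q t : ℝ) * M.intlam / M.lam t := fun t => by
    have := M.hlampos t; positivity
  have hκ1 : ∀ t, (M.s t : ℝ) * M.intlam / M.ρ t ≤ κ := fun t => by
    have h1 := Finset.single_le_sum (fun t _ => hA t) (Finset.mem_univ t)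
    have h2 := Finset.sum_nonneg (s := Finset.univ) (fun t _ => hB t)
    linarith
  have hκ2 : ∀ t, (M.q t : ℝ) * M.intlam / M.lam t ≤ κ := fun t => by
    have h1 := Finset.single_le_sum (fun t _ => hB t) (Finset.mem_univ t)
    have h2 := Finset.sum_nonneg (s := Finset.univ) (fun t _ => hA t)
    linarith
  have hκ0 : 0 ≤ κ := add_nonneg (Finset.sum_nonneg fun t _ => hA t)
    (Finset.sum_nonneg fun t _ => hB t)
  refine ⟨4 * κ, by positivity, min 1 (min (1 / (2 * κ + 1)) (1 / (2 * M.intlam))),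
    by positivity, ?_⟩
  intro α hα hαε hsmall n1 hn1 G hG
  have hα1 : α ≤ 1 := hαε.trans (min_le_left _ _)
  have hα2 : α ≤ 1 / (2 * κ + 1) := hαε.trans ((min_le_right _ _).trans (min_le_left _ _))
  have hα3 : α ≤ 1 / (2 * M.intlam) := hαε.trans ((min_le_right _ _).trans (min_le_right _ _))
  rw [le_div_iff₀ (by positivity)] at hα2 hα3
  set s : ℝ := 1 - κ * α with hs
  have hs2 : 1 / 2 ≤ s := by rw [hs]; nlinarith
  have hs0 : 0 < s := by linarith
  have hs1 : s ≤ 1 := by rw [hs]; nlinarith [mul_nonneg hκ0 hα.le]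
  -- the subsequence
  set nk : ℕ → ℕ := fun k => n1 + (i0 * (k + 1) - 1) * n1 with hnk
  have hnk' : ∀ k, nk k = i0 * ((k + 1) * n1) := by
    intro k
    have : 1 ≤ i0 * (k + 1) := Nat.mul_pos hi0 (by omega)
    obtain ⟨j, hj⟩ := Nat.exists_eq_add_of_le this
    simp only [hnk]
    rw [← mul_assoc, hj, Nat.add_sub_cancel_left]; ring
  have hnkA : ∀ k, M.Adm α (nk k) := fun k => M.Adm_add hα hsmall hn1 hn1 _
  have hn1pos : 0 < n1 := hn1.1
  have hnkk : ∀ k, k ≤ nk k := by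
    intro k
    rw [hnk']
    calc k ≤ (k + 1) * n1 := by nlinarith
      _ ≤ i0 * ((k + 1) * n1) := Nat.le_mul_of_pos_left _ hi0
  have htop : Tendsto nk atTop atTop := tendsto_atTop_mono hnkk tendsto_id
  have htend : Tendsto nk atTop (atTop ⊓ 𝓟 {n : ℕ | M.Adm α n}) :=
    tendsto_inf.2 ⟨htop, tendsto_principal.2 (Eventually.of_forall hnkA)⟩
  have hG' := hG.comp htend
  set h : ℕ → ℝ := fun n => Real.log c / n - (i0 + 1) * (Real.log (4 * i0 * n + 0) / n) with hh
  have hi0' : (0 : ℝ) < i0 := by exact_mod_cast hi0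
  have hi1' : (1 : ℝ) ≤ i0 := by exact_mod_cast hi0
  have hh0 : Tendsto h atTop (nhds 0) := by
    have h1 := tendsto_const_div_atTop_nhds_zero_nat (Real.log c)
    have h2 := (log_lin_div (4 * i0) 0 (by positivity)).const_mul ((i0 : ℝ) + 1)
    have h3 := h1.sub h2
    rw [mul_zero, sub_zero] at h3
    exact h3
  have hlim : Tendsto (fun k => α * Real.log (1 / y) + 2 * α * Real.log s + h (nk k)) atTop
      (nhds (α * Real.log (1 / y) + 2 * α * Real.log s + 0)) :=
    tendsto_const_nhds.add (hh0.comp htop)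
  have hmain : α * Real.log (1 / y) + 2 * α * Real.log s + 0 ≤ G := by
    refine le_of_tendsto_of_tendsto' hlim hG' fun k => ?_
    obtain ⟨g0, g1, g2, g3, g4, g5⟩ := hnkA k
    have hn' : (0 : ℝ) < nk k := by exact_mod_cast g0
    have hE0 : (0 : ℝ) < M.En (nk k) := by rw [g1]; positivity
    have hw1 := hn1.2.2.2.2.1
    set N := (k + 1) * ⌊α * (n1 : ℝ)⌋₊ with hN
    have hwN : ⌊α * (nk k : ℝ)⌋₊ = i0 * N := by
      have : α * (nk k : ℝ) = ((i0 * N : ℕ) : ℝ) := by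
        rw [hnk', hN]; push_cast; rw [hw1]; ring
      rw [this, Nat.floor_natCast]
    simp only [Function.comp, grSeq]
    rw [hwN] at g4 g5 ⊢
    have hwle : ((i0 * N : ℕ) : ℝ) ≤ nk k := by rw [g4]; nlinarith
    have hNle : (N : ℝ) ≤ nk k := by
      refine le_trans ?_ hwle
      exact_mod_cast Nat.le_mul_of_pos_left N hi0
    have hn1le : (1 : ℝ) ≤ nk k := by exact_mod_cast g0
    have key := H (nk k) N s hs0.le hs1 (by exact_mod_cast hE0) g2 g3
      (fun t => by
        have hp1 := M.hρpos t
        have hp2 := M.s_pos t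
        have h1 := hκ1 t
        rw [div_le_iff₀ hp1] at h1
        rw [g4, hs]
        have : α * (nk k : ℝ) ≤ κ * α * (M.cExp (nk k) t : ℝ) := by
          rw [g2, g1, div_mul_eq_mul_div, div_div, ← mul_div_assoc, le_div_iff₀ (by positivity)]
          have := mul_le_mul_of_nonneg_left h1 (mul_nonneg hα.le hn'.le)
          linarith
        linarith)
      (fun t => by
        have hp1 := M.hlampos t
        have hp2 := M.q_pos t
        have h1 := hκ2 t
        rw [div_le_iff₀ hp1] at h1
        rw [g4, hs]
        have : α * (nk k : ℝ) ≤ κ * α * (M.vExp (nk k) t : ℝ) := by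
          rw [g3, g1, div_mul_eq_mul_div, div_div, ← mul_div_assoc, le_div_iff₀ (by positivity)]
          have := mul_le_mul_of_nonneg_left h1 (mul_nonneg hα.le hn'.le)
          linarith
        linarith)
      (by
        have : (2 * (i0 * N : ℕ) : ℝ) ≤ M.En (nk k) := by
          rw [g4, g1, le_div_iff₀ hL]
          nlinarith
        exact_mod_cast this)
    have hD : ((N : ℝ) + 1) ^ i0 * (2 * (i0 * N : ℕ) + 1) ≤ (4 * i0 * (nk k : ℝ)) ^ (i0 + 1) := by
      rw [pow_succ]
      have : 2 * ((i0 * N : ℕ) : ℝ) + 1 ≤ 4 * i0 * (nk k : ℝ) := by nlinarith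
      have : (N : ℝ) + 1 ≤ 4 * i0 * (nk k : ℝ) := by nlinarith
      gcongr
    have key2 : (1 / y) ^ (i0 * N) * s ^ (2 * (i0 * N)) * (c / (4 * i0 * (nk k : ℝ)) ^ (i0 + 1)) ≤
        M.ENss (nk k) (i0 * N) := by
      refine le_trans ?_ key
      gcongr
    have key3 := Real.log_le_log (by positivity) key2
    rw [Real.log_mul (by positivity) (by positivity), Real.log_mul (by positivity) (by positivity),
      Real.log_div (by positivity) (by positivity), Real.log_pow, Real.log_pow, Real.log_pow] at key3
    rw [one_div_mul_eq_div, le_div_iff₀ hn']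
    refine le_trans (le_of_eq ?_) key3
    simp only [hh]
    rw [Nat.cast_mul 2 (i0 * N), g4]
    push_cast
    rw [add_zero]
    field_simp
  have hlogs : -(2 * κ * α) ≤ Real.log s := by
    have := log_tail (κ * α) (by positivity) (by linarith)
    rw [hs]; linarith
  have hpow : α ^ 2 ≤ α ^ ((3 : ℝ) / 2) := by
    rw [← Real.rpow_natCast]
    exact Real.rpow_le_rpow_of_exponent_ge hα hα1 (by norm_num)
  have := mul_le_mul_of_nonneg_left hlogs (by positivity : 0 ≤ 2 * α)
  have := mul_le_mul_of_nonneg_left hpow (by positivity : 0 ≤ 4 * κ)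
  linarith

end DGLDPCss

end

/-- **Theorem 2** (growth rate of the stopping set size distribution).  For a D-GLDPC
ensemble with `r = p = 2`, under MAP erasure decoding at VNs and CNs over the BEC,
the growth rate of the stopping set size distribution satisfies
`G_{ss}(α) = α log(1/P⁻¹(1/C)) + O(α^{3/2})`.  Here `y = P⁻¹(1/C)` is encoded as the
unique nonnegative solution of `P(y) = 1/C`. -/
theorem growth_rate_stopping_sets (M : DGLDPCss) (hr : M.r = 2) (hp : M.p = 2) :
    ∃ y : ℝ, (0 ≤ y ∧ M.Pfun y = 1 / M.Cparam ∧
        ∀ y' : ℝ, 0 ≤ y' → M.Pfun y' = 1 / M.Cparam → y' = y) ∧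
      ∃ k : ℝ, 0 < k ∧ ∃ ε : ℝ, 0 < ε ∧
        ∀ α : ℝ, 0 < α → α ≤ ε → {n : ℕ | M.Adm α n}.Infinite →
          ∃ G : ℝ,
            Filter.Tendsto (M.grSeq α)
              (Filter.atTop ⊓ Filter.principal {n : ℕ | M.Adm α n}) (nhds G) ∧
            |G - α * Real.log (1 / y)| ≤ k * α ^ ((3 : ℝ) / 2) := by
  obtain ⟨y, hy, hyC, huniq⟩ := M.exists_y hr hp
  refine ⟨y, ⟨hy.le, hyC, huniq⟩, ?_⟩
  obtain ⟨K, hK, ε1, hε1, hup⟩ := M.log_upper hr hp hy hyC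
  obtain ⟨κ, hκ, ε2, hε2, hlow⟩ := M.lower_G hr hp hy hyC
  have hL := M.intlam_pos
  have hQ : (0 : ℝ) < M.Qm := by exact_mod_cast M.Qm_pos
  refine ⟨K + κ + 1, by positivity, min (min ε1 ε2) (1 / (2 * (M.Qm * M.intlam))),
    by positivity, ?_⟩
  intro α hα hαε hinf
  have hα1 : α ≤ ε1 := hαε.trans ((min_le_left _ _).trans (min_le_left _ _))
  have hα2 : α ≤ ε2 := hαε.trans ((min_le_left _ _).trans (min_le_right _ _))
  have hα3 : α ≤ 1 / (2 * (M.Qm * M.intlam)) := hαε.trans (min_le_right _ _)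
  have hsmall : M.Qm * α * M.intlam < 1 := by
    rw [le_div_iff₀ (by positivity)] at hα3
    linarith
  obtain ⟨n1, hn1⟩ := hinf.nonempty
  set g : ℕ → ℝ := fun n => Real.log 9 + 2 * Real.log ((1 / M.intlam) * n + 0) +
    Real.log ((1 / M.intlam) * n + 1) with hg
  have hgE : ∀ n, M.Adm α n → 0 < M.En n ∧
      Real.log (9 * (M.En n : ℝ) ^ 2 * (M.En n + 1)) = g n := by
    intro n hn
    have hn' : (0 : ℝ) < n := by exact_mod_cast hn.1
    have e := hn.2.1
    have hE0 : (0 : ℝ) < M.En n := by rw [e]; positivity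
    refine ⟨by exact_mod_cast hE0, ?_⟩
    rw [Real.log_mul (by positivity) (by positivity), Real.log_mul (by positivity) (by positivity),
      Real.log_pow, e]
    simp only [hg]
    rw [one_div_mul_eq_div, add_zero]
    push_cast
    rfl
  have hglim : Tendsto (fun n : ℕ => g n / n) atTop (nhds 0) := by
    have h1 := tendsto_const_div_atTop_nhds_zero_nat (Real.log 9)
    have h2 := (log_lin_div (1 / M.intlam) 0 (by positivity)).const_mul 2
    have h3 := log_lin_div (1 / M.intlam) 1 (by positivity)
    have h4 := (h1.add h2).add h3
    rw [mul_zero, add_zero, add_zero] at h4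
    refine h4.congr fun n => ?_
    simp only [hg]
    ring
  obtain ⟨G, hG, hGB⟩ := abstract_limit {n : ℕ | M.Adm α n} ⟨n1, hn1⟩ (fun n hn => hn.1)
    (fun n => Real.log (M.ENss n ⌊α * (n : ℝ)⌋₊)) g
    (α * Real.log (1 / y) + K * α ^ ((3 : ℝ) / 2)) hglim
    (fun n hn => by
      rw [← (hgE n hn).2]
      exact hup α hα hα1 n hn)
    (fun n hn m hm => by
      obtain ⟨c, hc, H⟩ := DGLDPCss.super_lower hα hsmall hn hm
      refine ⟨Real.log c, fun k => ?_⟩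
      have hE0 : (0 : ℝ) < M.En n := by exact_mod_cast (hgE n hn).1
      have hpos : 0 < M.ENss n ⌊α * (n : ℝ)⌋₊ := hn.2.2.2.2.2
      have h1 := Real.log_le_log (by positivity) (H k)
      rw [Real.log_mul (by positivity) (by positivity), Real.log_pow,
        Real.log_div (by positivity) (by positivity), (hgE n hn).2] at h1
      exact h1)
  have hG' : Tendsto (M.grSeq α) (atTop ⊓ 𝓟 {n : ℕ | M.Adm α n}) (nhds G) := by
    refine hG.congr fun n => ?_
    unfold DGLDPCss.grSeq
    rw [one_div_mul_eq_div]
  refine ⟨G, hG', ?_⟩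
  have hlo := hlow α hα hα2 hsmall n1 hn1 G hG'
  have hpw : 0 < α ^ ((3 : ℝ) / 2) := by positivity
  rw [abs_le]
  constructor <;> nlinarith
end

section
/- Lemma (exponential growth rate of coefficients of polynomial powers, univariate). Let A(x) = 1 + sum_{u=c}^{d} A_u x^u, where 1 <= c <= d, be a real polynomial with A_c > 0 and A_u >= 0 for all c < u <= d; set A_0 = 1 and U = { i in N : A_i > 0 } (so 0 in U). Let xi be a fixed positive rational number, and suppose the set L of positive integers l such that xi*l is an integer and the coefficient of x^{xi*l} in (A(x))^l is positive is nonempty (hence infinite). Then the limit, over l in L as l -> infinity, of (1/l) log Coeff[(A(x))^l, x^{xi*l}] exists and equals the maximum of sum_{i in U} beta_i log(A_i / beta_i) over all vectors beta = (beta_i)_{i in U} satisfying beta_i >= 0 for all i in U, sum_{i in U} beta_i = 1, and sum_{i in U} i beta_i = xi (terms with beta_i = 0 are interpreted as 0; logarithms are natural). -/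
open Polynomial Filter Finset
open scoped Classical

namespace GR

noncomputable def F (U : Finset ℕ) (a β : ℕ → ℝ) : ℝ := ∑ i ∈ U, β i * Real.log (a i / β i)

lemma F_eq {U : Finset ℕ} {a : ℕ → ℝ} (ha : ∀ i ∈ U, 0 < a i) (β : ℕ → ℝ) :
    F U a β = ∑ i ∈ U, (β i * Real.log (a i) + Real.negMulLog (β i)) := by
  unfold F
  refine Finset.sum_congr rfl fun i hi => ?_
  by_cases h : β i = 0
  · simp [h]
  · rw [Real.log_div (ha i hi).ne' h, Real.negMulLog]; ring

lemma F_cont {U : Finset ℕ} {a : ℕ → ℝ} (ha : ∀ i ∈ U, 0 < a i) : Continuous (F U a) := by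
  have : F U a = fun β => ∑ i ∈ U, (β i * Real.log (a i) + Real.negMulLog (β i)) := by
    funext β; exact F_eq ha β
  rw [this]
  refine continuous_finsetSum _ fun i _ => ?_
  have := Real.continuous_negMulLog.comp (continuous_apply (A := fun _ : ℕ => ℝ) i)
  exact ((continuous_apply i).mul continuous_const).add this

lemma fact_lower (n : ℕ) : n * Real.log n - n ≤ Real.log (n.factorial) := by
  rcases Nat.eq_zero_or_pos n with rfl | h
  · simp
  have h1 := Stirling.le_log_factorial_stirling h.ne'
  have h2 : 0 ≤ Real.log n := Real.log_natCast_nonneg n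
  have h3 : 0 ≤ Real.log (2 * Real.pi) := Real.log_nonneg (by nlinarith [Real.pi_gt_three])
  linarith

lemma fact_upper' (n : ℕ) (hn : 1 ≤ n) :
    Real.log (n.factorial) ≤ n * Real.log n - n + 1 + Real.log n := by
  induction n, hn using Nat.le_induction with
  | base => simp
  | succ n hn ih =>
    have hn' : (0 : ℝ) < n := by exact_mod_cast hn
    rw [Nat.factorial_succ]
    push_cast
    rw [Real.log_mul (by positivity) (by positivity)]
    have h := Real.one_sub_inv_le_log_of_pos (x := ((n : ℝ) + 1) / n) (by positivity)
    rw [Real.log_div (by positivity) (by positivity)] at h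
    have e : 1 - (((n : ℝ) + 1) / n)⁻¹ = 1 / (n + 1) := by field_simp; ring
    rw [e, div_le_iff₀ (by positivity)] at h
    nlinarith

lemma fact_upper (n : ℕ) :
    Real.log (n.factorial) ≤ n * Real.log n - n + (1 + Real.log (n + 1)) := by
  rcases Nat.eq_zero_or_pos n with rfl | h
  · simp
  have h1 := fact_upper' n h
  have : Real.log n ≤ Real.log (n + 1) := Real.log_le_log (by exact_mod_cast h) (by linarith)
  linarith

noncomputable def T (U : Finset ℕ) (a : ℕ → ℝ) (k : ℕ → ℕ) : ℝ :=
  (Nat.multinomial U k : ℝ) * ∏ i ∈ U, a i ^ k i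

lemma T_pos {U : Finset ℕ} {a : ℕ → ℝ} (ha : ∀ i ∈ U, 0 < a i) (k : ℕ → ℕ) : 0 < T U a k := by
  unfold T
  have := Nat.multinomial_pos U k
  have h2 : 0 < ∏ i ∈ U, a i ^ k i := Finset.prod_pos fun i hi => pow_pos (ha i hi) _
  positivity

lemma log_T {U : Finset ℕ} {a : ℕ → ℝ} (ha : ∀ i ∈ U, 0 < a i) (k : ℕ → ℕ) :
    Real.log (T U a k) = Real.log ((∑ i ∈ U, k i).factorial) - ∑ i ∈ U, Real.log ((k i).factorial)
      + ∑ i ∈ U, k i * Real.log (a i) := by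
  have h2 : 0 < ∏ i ∈ U, a i ^ k i := Finset.prod_pos fun i hi => pow_pos (ha i hi) _
  have hm : (0 : ℝ) < Nat.multinomial U k := by exact_mod_cast Nat.multinomial_pos U k
  unfold T
  rw [Real.log_mul hm.ne' h2.ne', Real.log_prod (fun i hi => (pow_pos (ha i hi) _).ne'),
    ← Nat.multinomial_spec]
  push_cast
  rw [Real.log_mul (Finset.prod_ne_zero_iff.2 fun i _ => by positivity) hm.ne',
    Real.log_prod (fun i hi => by positivity)]
  simp only [Real.log_pow]
  ring

lemma F_int {U : Finset ℕ} {a : ℕ → ℝ} (ha : ∀ i ∈ U, 0 < a i) (k : ℕ → ℕ) (l : ℕ) (hl : 0 < l)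
    (hk : ∑ i ∈ U, k i = l) :
    l * F U a (fun i => (k i : ℝ) / l) =
      ∑ i ∈ U, k i * Real.log (a i) - ∑ i ∈ U, k i * Real.log (k i) + l * Real.log l := by
  have hl' : (l : ℝ) ≠ 0 := by positivity
  have hk' : ∑ i ∈ U, (k i : ℝ) = l := by exact_mod_cast hk
  rw [F_eq ha, Finset.mul_sum]
  conv_rhs => rw [← hk']
  rw [Finset.sum_mul, ← Finset.sum_sub_distrib, ← Finset.sum_add_distrib, hk']
  refine Finset.sum_congr rfl fun i hi => ?_
  by_cases h : k i = 0
  · simp [h]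
  · rw [Real.negMulLog, Real.log_div (by exact_mod_cast h) hl']
    field_simp; ring

noncomputable def K (U : Finset ℕ) (l : ℕ) : ℝ := (U.card + 1) * (1 + Real.log (l + 1))

lemma log_T_le {U : Finset ℕ} {a : ℕ → ℝ} (ha : ∀ i ∈ U, 0 < a i) (k : ℕ → ℕ) (l : ℕ) (hl : 0 < l)
    (hk : ∑ i ∈ U, k i = l) :
    Real.log (T U a k) ≤ l * F U a (fun i => (k i : ℝ) / l) + (1 + Real.log (l + 1)) := by
  rw [log_T ha, F_int ha k l hl hk, hk]
  have h1 := fact_upper l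
  have h2 : ∑ i ∈ U, ((k i : ℝ) * Real.log (k i) - k i) ≤ ∑ i ∈ U, Real.log ((k i).factorial) :=
    Finset.sum_le_sum fun i _ => fact_lower (k i)
  have hk' : ∑ i ∈ U, (k i : ℝ) = l := by exact_mod_cast hk
  rw [Finset.sum_sub_distrib, hk'] at h2
  linarith

lemma le_log_T {U : Finset ℕ} {a : ℕ → ℝ} (ha : ∀ i ∈ U, 0 < a i) (k : ℕ → ℕ) (l : ℕ) (hl : 0 < l)
    (hk : ∑ i ∈ U, k i = l) :
    l * F U a (fun i => (k i : ℝ) / l) - K U l ≤ Real.log (T U a k) := by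
  rw [log_T ha, F_int ha k l hl hk, hk]
  have h1 := fact_lower l
  have h2 : ∑ i ∈ U, Real.log ((k i).factorial) ≤
      ∑ i ∈ U, ((k i : ℝ) * Real.log (k i) - k i + (1 + Real.log (l + 1))) := by
    refine Finset.sum_le_sum fun i hi => (fact_upper (k i)).trans ?_
    have : k i ≤ l := hk ▸ Finset.single_le_sum (f := k) (fun _ _ => Nat.zero_le _) hi
    have : (k i : ℝ) ≤ l := by exact_mod_cast this
    have := Real.log_le_log (x := (k i : ℝ) + 1) (by positivity) (y := (l : ℝ) + 1) (by linarith)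
    linarith
  have hk' : ∑ i ∈ U, (k i : ℝ) = l := by exact_mod_cast hk
  rw [Finset.sum_add_distrib, Finset.sum_sub_distrib, hk', Finset.sum_const, nsmul_eq_mul] at h2
  have h4 : 0 ≤ Real.log ((l : ℝ) + 1) := Real.log_nonneg (by linarith [(Nat.cast_nonneg l : (0:ℝ) ≤ l)])
  unfold K
  linarith

lemma K_div (U : Finset ℕ) : Tendsto (fun l : ℕ => K U l / l) atTop (nhds 0) := by
  have h0 : Tendsto (fun l : ℕ => Real.log ((l : ℝ) + 1) / l) atTop (nhds 0) := by
    have h := (Real.isLittleO_log_id_atTop.tendsto_div_nhds_zero).comp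
      ((tendsto_atTop_add_const_right _ (1 : ℝ) tendsto_natCast_atTop_atTop) :
        Tendsto (fun l : ℕ => (l : ℝ) + 1) atTop atTop)
    have h2 : Tendsto (fun l : ℕ => 1 + 1 / (l : ℝ)) atTop (nhds (1 + 0)) :=
      tendsto_const_nhds.add tendsto_one_div_atTop_nhds_zero_nat
    have h3 := h.mul h2
    rw [zero_mul] at h3
    refine h3.congr' ?_
    filter_upwards [eventually_gt_atTop 0] with l hl
    have : (0 : ℝ) < l := by exact_mod_cast hl
    simp only [Function.comp, id]
    field_simp
  have h1 : Tendsto (fun l : ℕ => ((U.card : ℝ) + 1) * (1 / (l : ℝ) + Real.log ((l : ℝ) + 1) / l))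
      atTop (nhds ((U.card + 1) * (0 + 0))) :=
    (tendsto_one_div_atTop_nhds_zero_nat.add h0).const_mul _
  simp only [add_zero, mul_zero] at h1
  refine h1.congr fun l => ?_
  unfold K
  ring

/-- superadditive limit -/
lemma fekete (L : Set ℕ) (g : ℕ → ℝ) (hpos : ∀ l ∈ L, 0 < l)
    (hadd : ∀ l ∈ L, ∀ m ∈ L, l + m ∈ L ∧ g l + g m ≤ g (l + m))
    (p : ℕ) (hp : p ∈ L) (c : ℝ) (hc : c < g p / p) :
    ∀ᶠ l : ℕ in atTop, l ∈ L → c < g l / l := by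
  have hp0 : (0 : ℝ) < p := by exact_mod_cast hpos p hp
  have key : ∀ r ∈ L, ∀ q : ℕ, r + q * p ∈ L ∧ g r + q * g p ≤ g (r + q * p) := by
    intro r hr q
    induction q with
    | zero => simpa using hr
    | succ q ih =>
      have := hadd _ ih.1 _ hp
      have e : r + (q + 1) * p = r + q * p + p := by ring
      rw [e]
      refine ⟨this.1, ?_⟩
      push_cast
      linarith [this.2, ih.2]
  have main : ∀ j ∈ Finset.range p, ∀ᶠ l : ℕ in atTop, l % p = j → l ∈ L → c < g l / l := by
    intro j hj
    by_cases h : ∃ r ∈ L, r % p = j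
    · obtain ⟨r, hr, hrj⟩ := h
      have t : Tendsto (fun l : ℕ => g p / p + (g r - r * (g p / p)) * (1 / (l : ℝ))) atTop
          (nhds (g p / p + (g r - r * (g p / p)) * 0)) :=
        tendsto_const_nhds.add (tendsto_one_div_atTop_nhds_zero_nat.const_mul _)
      rw [mul_zero, add_zero] at t
      filter_upwards [t.eventually (lt_mem_nhds hc), eventually_ge_atTop r, eventually_gt_atTop 0]
        with l h1 h2 h3 h4 h5
      have hd : p ∣ l - r := (Nat.modEq_iff_dvd' h2).1 (by unfold Nat.ModEq; rw [hrj, h4])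
      obtain ⟨q, hq⟩ := hd
      have e : l = r + q * p := by rw [mul_comm]; omega
      have e2 : (l : ℝ) = r + q * p := by exact_mod_cast e
      have k := (key r hr q).2
      rw [← e] at k
      refine h1.trans_le ?_
      have hl : (0 : ℝ) < l := by exact_mod_cast h3
      rw [le_div_iff₀ hl]
      have : (g p / p + (g r - r * (g p / p)) * (1 / (l : ℝ))) * l = g r + q * g p := by
        have : (g p / p + (g r - r * (g p / p)) * (1 / (l : ℝ))) * l
          = g p / p * l + (g r - r * (g p / p)) := by field_simp
        rw [this, e2]; field_simp; ring
      linarith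
    · filter_upwards with l h1 h2
      exact absurd ⟨l, h2, h1⟩ h
  filter_upwards [(Filter.eventually_all_finset _).2 main] with l hl hL
  exact hl (l % p) (Finset.mem_range.2 (Nat.mod_lt _ (hpos p hp))) rfl hL

/-- simultaneous approximation -/
lemma approx (U : Finset ℕ) (β : ℕ → ℝ) (hβ : ∀ i, 0 ≤ β i) (h1 : ∑ i ∈ U, β i = 1) (ξ : ℚ)
    (h2 : ∑ i ∈ U, (i : ℝ) * β i = ξ) (δ : ℝ) (hδ : 0 < δ) :
    ∃ (k : ℕ → ℕ) (l : ℕ), 0 < l ∧ k ∈ U.piAntidiag l ∧ ((∑ i ∈ U, i * k i : ℕ) : ℚ) = ξ * l ∧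
      ∀ i ∈ U, |(k i : ℝ) / l - β i| < δ := by
  obtain ⟨N, hN⟩ := exists_nat_gt ((∑ i ∈ U, (i : ℝ)) + U.card + 1 / δ + 1)
  have hs0 : 0 ≤ ∑ i ∈ U, (i : ℝ) := Finset.sum_nonneg fun i _ => by positivity
  have hd0 : 0 < 1 / δ := by positivity
  have hc0 : (0 : ℝ) ≤ U.card := by positivity
  have hN0 : (0 : ℝ) < N := by linarith
  let x : ℕ → ℕ → ℝ := fun n i => n * ξ.den * β i
  let φ : ℕ → (U → Fin N) := fun n i => ⟨⌊N * Int.fract (x n i)⌋₊, by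
    rw [Nat.floor_lt (mul_nonneg hN0.le (Int.fract_nonneg _))]
    nlinarith [Int.fract_lt_one (x n i)]⟩
  have : ∃ n m, n < m ∧ φ n = φ m := by
    obtain ⟨n, m, hne, h⟩ := Finite.exists_ne_map_eq_of_infinite φ
    rcases lt_or_gt_of_ne hne with h' | h'
    · exact ⟨n, m, h', h⟩
    · exact ⟨m, n, h', h.symm⟩
  obtain ⟨n, m, hnm, hφ⟩ := this
  let l : ℕ := (m - n) * ξ.den
  have hl : 0 < l := Nat.mul_pos (by omega) ξ.den_pos
  have hl1 : (1 : ℝ) ≤ l := by exact_mod_cast hl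
  have hlc : (l : ℝ) = m * ξ.den - n * ξ.den := by
    simp only [l]; rw [Nat.cast_mul, Nat.cast_sub hnm.le]; ring
  let z : ℕ → ℤ := fun i => ⌊x m i⌋ - ⌊x n i⌋
  have hz : ∀ i ∈ U, |(z i : ℝ) - l * β i| < 1 / N := by
    intro i hi
    have e := congrArg Fin.val (congrFun hφ ⟨i, hi⟩)
    simp only [φ] at e
    have a1 := Nat.floor_le (mul_nonneg hN0.le (Int.fract_nonneg (x m i)))
    have a2 := Nat.lt_floor_add_one ((N : ℝ) * Int.fract (x m i))
    have b1 := Nat.floor_le (mul_nonneg hN0.le (Int.fract_nonneg (x n i)))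
    have b2 := Nat.lt_floor_add_one ((N : ℝ) * Int.fract (x n i))
    rw [e] at b1 b2
    have e3 : (z i : ℝ) - l * β i = Int.fract (x n i) - Int.fract (x m i) := by
      simp only [z, Int.fract, x]; rw [hlc]; push_cast; ring
    rw [e3, lt_div_iff₀ hN0, ← abs_of_pos hN0, ← abs_mul, abs_lt]
    constructor <;> linarith
  have hN1 : 1 / (N : ℝ) < 1 := by rw [div_lt_one hN0]; linarith
  have hz0 : ∀ i ∈ U, 0 ≤ z i := by
    intro i hi
    have := abs_lt.1 (hz i hi)
    have h3 : 0 ≤ (l : ℝ) * β i := mul_nonneg (by positivity) (hβ i)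
    have : (-1 : ℝ) < z i := by linarith
    have : (-1 : ℤ) < z i := by exact_mod_cast this
    omega
  have hsum : ∑ i ∈ U, z i = l := by
    rw [← sub_eq_zero, ← Int.abs_lt_one_iff]
    have : |∑ i ∈ U, (z i : ℝ) - l| < 1 := by
      have e : ∑ i ∈ U, (z i : ℝ) - l = ∑ i ∈ U, ((z i : ℝ) - l * β i) := by
        rw [Finset.sum_sub_distrib, ← Finset.mul_sum, h1, mul_one]
      rw [e]
      refine (Finset.abs_sum_le_sum_abs _ _).trans_lt ?_
      have := Finset.sum_le_sum fun i hi => (hz i hi).le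
      rw [Finset.sum_const, nsmul_eq_mul] at this
      refine this.trans_lt ?_
      rw [mul_one_div, div_lt_one hN0]; linarith
    exact_mod_cast this
  have hξl : (ξ : ℝ) * l = ((ξ.num * (m - n : ℕ) : ℤ) : ℝ) := by
    have : (ξ : ℚ) * l = ((ξ.num * (m - n : ℕ) : ℤ) : ℚ) := by
      simp only [l]; push_cast
      rw [mul_left_comm, Rat.mul_den_eq_num, mul_comm]
    exact_mod_cast this
  have hsum2 : ∑ i ∈ U, (i : ℤ) * z i = ξ.num * (m - n : ℕ) := by
    rw [← sub_eq_zero, ← Int.abs_lt_one_iff]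
    have : |∑ i ∈ U, (i : ℝ) * (z i : ℝ) - ((ξ.num * (m - n : ℕ) : ℤ) : ℝ)| < 1 := by
      rw [← hξl]
      have e : ∑ i ∈ U, (i : ℝ) * (z i : ℝ) - ξ * l = ∑ i ∈ U, (i : ℝ) * ((z i : ℝ) - l * β i) := by
        rw [← h2, Finset.sum_mul, ← Finset.sum_sub_distrib]
        exact Finset.sum_congr rfl fun i _ => by ring
      rw [e]
      refine (Finset.abs_sum_le_sum_abs _ _).trans_lt ?_
      have : ∑ i ∈ U, |(i : ℝ) * ((z i : ℝ) - l * β i)| ≤ ∑ i ∈ U, (i : ℝ) * (1 / N) := by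
        refine Finset.sum_le_sum fun i hi => ?_
        rw [abs_mul, abs_of_nonneg (Nat.cast_nonneg i)]
        exact mul_le_mul_of_nonneg_left (hz i hi).le (Nat.cast_nonneg i)
      rw [← Finset.sum_mul] at this
      refine this.trans_lt ?_
      rw [mul_one_div, div_lt_one hN0]; linarith
    exact_mod_cast this
  let k : ℕ → ℕ := fun i => if i ∈ U then (z i).toNat else 0
  have hk : ∀ i ∈ U, (k i : ℤ) = z i := by
    intro i hi
    simp only [k, if_pos hi]
    exact Int.toNat_of_nonneg (hz0 i hi)
  refine ⟨k, l, hl, ?_, ?_, ?_⟩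
  · rw [Finset.mem_piAntidiag]
    constructor
    · have : ∑ i ∈ U, (k i : ℤ) = l := by rw [Finset.sum_congr rfl hk, hsum]
      exact_mod_cast this
    · intro i hi
      by_contra h
      exact hi (by simp [k, h])
  · have h5 : ((∑ i ∈ U, i * k i : ℕ) : ℤ) = ξ.num * (m - n : ℕ) := by
      rw [← hsum2]; push_cast
      exact Finset.sum_congr rfl fun i hi => by rw [hk i hi]
    have h6 : (ξ : ℚ) * l = ((ξ.num * (m - n : ℕ) : ℤ) : ℚ) := by exact_mod_cast hξl
    rw [h6, ← h5]; norm_cast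
  · intro i hi
    have h7 : (k i : ℝ) = z i := by exact_mod_cast hk i hi
    have e : (k i : ℝ) / l - β i = ((z i : ℝ) - l * β i) / l := by rw [h7]; field_simp
    rw [e, abs_div, abs_of_pos (by linarith : (0 : ℝ) < l)]
    have h8 : 1 / (N : ℝ) < δ := by
      rw [div_lt_comm₀ hN0 hδ]; linarith
    exact (div_le_self (abs_nonneg _) hl1).trans_lt ((hz i hi).trans h8)

lemma coeff_eq (U : Finset ℕ) (a : ℕ → ℝ) (l n : ℕ) :
    ((∑ u ∈ U, C (a u) * X ^ u : ℝ[X]) ^ l).coeff n =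
      ∑ k ∈ U.piAntidiag l, if ∑ i ∈ U, i * k i = n then T U a k else 0 := by
  rw [Finset.sum_pow_eq_sum_piAntidiag, Polynomial.finsetSum_coeff]
  refine Finset.sum_congr rfl fun k _ => ?_
  have : ((Nat.multinomial U k : ℕ) : ℝ[X]) * ∏ i ∈ U, (C (a i) * X ^ i) ^ k i =
      C (T U a k) * X ^ (∑ i ∈ U, i * k i) := by
    simp only [mul_pow, Finset.prod_mul_distrib, T, ← pow_mul, Finset.prod_pow_eq_pow_sum]
    simp [mul_assoc]
  rw [this, Polynomial.coeff_C_mul_X_pow]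
  simp only [eq_comm]

lemma card_le (U : Finset ℕ) (l : ℕ) : (U.piAntidiag l).card ≤ (l + 1) ^ U.card := by
  have : (U.pi (fun _ => Finset.range (l + 1))).card = (l + 1) ^ U.card := by
    rw [Finset.card_pi]; simp
  rw [← this]
  refine Finset.card_le_card_of_injOn (fun k i _ => k i) ?_ ?_
  · intro k hk
    have hk := (Finset.mem_piAntidiag.1 hk).1
    rw [Finset.mem_coe, Finset.mem_pi]
    simp only [Finset.mem_range]
    intro i hi
    have : k i ≤ l := hk ▸ Finset.single_le_sum (f := k) (fun _ _ => Nat.zero_le _) hi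
    omega
  · intro k hk k' hk' h
    have hk := (Finset.mem_piAntidiag.1 hk).2
    have hk' := (Finset.mem_piAntidiag.1 hk').2
    funext i
    by_cases hi : i ∈ U
    · exact congrFun (congrFun h i) hi
    · rw [not_imp_comm.1 (hk i) hi, not_imp_comm.1 (hk' i) hi]

end GR

lemma GR.upper {U : Finset ℕ} {a : ℕ → ℝ} (ha : ∀ i ∈ U, 0 < a i) (M : ℝ) (l n : ℕ) (hl : 0 < l)
    (hM : ∀ k ∈ U.piAntidiag l, ∑ i ∈ U, i * k i = n → GR.F U a (fun i => (k i : ℝ) / l) ≤ M)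
    (hpos : 0 < ((∑ u ∈ U, C (a u) * X ^ u : ℝ[X]) ^ l).coeff n) :
    Real.log (((∑ u ∈ U, C (a u) * X ^ u : ℝ[X]) ^ l).coeff n) ≤ l * M + GR.K U l := by
  have h : ((∑ u ∈ U, C (a u) * X ^ u : ℝ[X]) ^ l).coeff n ≤
      ((l : ℝ) + 1) ^ U.card * Real.exp (l * M + (1 + Real.log (l + 1))) := by
    rw [GR.coeff_eq]
    refine (Finset.sum_le_card_nsmul _ _ (Real.exp (l * M + (1 + Real.log (l + 1)))) ?_).trans ?_
    · intro k hk
      split_ifs with h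
      · rw [← Real.log_le_iff_le_exp (GR.T_pos ha k)]
        have h1 := GR.log_T_le ha k l hl (Finset.mem_piAntidiag.1 hk).1
        have h2 := mul_le_mul_of_nonneg_left (hM k hk h) (Nat.cast_nonneg (α := ℝ) l)
        linarith
      · positivity
    · rw [nsmul_eq_mul]
      refine mul_le_mul_of_nonneg_right ?_ (Real.exp_pos _).le
      exact_mod_cast GR.card_le U l
  have h2 := Real.log_le_log hpos h
  rw [Real.log_mul (by positivity) (by positivity), Real.log_exp, Real.log_pow] at h2
  unfold GR.K
  have : (0 : ℝ) ≤ U.card := by positivity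
  linarith

lemma GR.lower {U : Finset ℕ} {a : ℕ → ℝ} (ha : ∀ i ∈ U, 0 < a i) (l n : ℕ) (k : ℕ → ℕ)
    (hk : k ∈ U.piAntidiag l) (hn : ∑ i ∈ U, i * k i = n) :
    GR.T U a k ≤ ((∑ u ∈ U, C (a u) * X ^ u : ℝ[X]) ^ l).coeff n := by
  rw [GR.coeff_eq]
  have := Finset.single_le_sum (s := U.piAntidiag l)
    (f := fun k => if ∑ i ∈ U, i * k i = n then GR.T U a k else 0)
    (fun k _ => by split_ifs <;> [exact (GR.T_pos ha k).le; exact le_rfl]) hk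
  simpa only [if_pos hn] using this

lemma GR.coeff_nonneg {U : Finset ℕ} {a : ℕ → ℝ} (ha : ∀ i ∈ U, 0 < a i) (l n : ℕ) :
    0 ≤ ((∑ u ∈ U, C (a u) * X ^ u : ℝ[X]) ^ l).coeff n := by
  rw [GR.coeff_eq]
  exact Finset.sum_nonneg fun k _ => by split_ifs <;> [exact (GR.T_pos ha k).le; exact le_rfl]

/-- **Lemma** (exponential growth rate of coefficients of polynomial powers, univariate).
Let `A(x) = 1 + ∑_{u=c}^d A_u x^u` with `1 ≤ c ≤ d`, `A_c > 0` and `A_u ≥ 0` for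
`c < u ≤ d`; set `A_0 = 1` and `U = { i : A_i > 0 }`.  If the set `L` of positive integers
`l` with `ξ l` an integer and `Coeff[A^l, x^{ξ l}] > 0` is nonempty, then
`lim_{l ∈ L, l → ∞} (1/l) log Coeff[A^l, x^{ξ l}]` exists and equals the maximum of
`∑_{i ∈ U} β_i log(A_i/β_i)` over `β ≥ 0` with `∑_{i ∈ U} β_i = 1` and `∑_{i ∈ U} i β_i = ξ`
(terms with `β_i = 0` vanish, since `0 · log(A_i/0) = 0` in Lean). -/
theorem growth_rate_coeff_pow_univariate (c d : ℕ) (hc : 1 ≤ c) (hcd : c ≤ d)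
    (a : ℕ → ℝ) (ha0 : a 0 = 1) (hac : 0 < a c)
    (hann : ∀ u, c < u → u ≤ d → 0 ≤ a u)
    (hsupp : ∀ u, u ≠ 0 → u < c ∨ d < u → a u = 0)
    (A : Polynomial ℝ)
    (hA : A = ∑ u ∈ Finset.range (d + 1), Polynomial.C (a u) * Polynomial.X ^ u)
    (ξ : ℚ) (hξ : 0 < ξ)
    (L : Set ℕ)
    (hL : L = {l : ℕ | 0 < l ∧ ((⌊ξ * (l : ℚ)⌋₊ : ℚ) = ξ * l) ∧
      0 < (A ^ l).coeff ⌊ξ * (l : ℚ)⌋₊})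
    (hLne : L.Nonempty) :
    ∃ Glim : ℝ,
      IsGreatest {x : ℝ | ∃ β : ℕ → ℝ, (∀ i, 0 ≤ β i) ∧
        (∑ i ∈ (Finset.range (d + 1)).filter (fun i => 0 < a i), β i = 1) ∧
        (∑ i ∈ (Finset.range (d + 1)).filter (fun i => 0 < a i), (i : ℝ) * β i = (ξ : ℝ)) ∧
        x = ∑ i ∈ (Finset.range (d + 1)).filter (fun i => 0 < a i),
          β i * Real.log (a i / β i)} Glim ∧
      Filter.Tendsto (fun l : ℕ => (1 / (l : ℝ)) * Real.log ((A ^ l).coeff ⌊ξ * (l : ℚ)⌋₊))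
        (Filter.atTop ⊓ Filter.principal L) (nhds Glim) := by
  have hnn : ∀ u ∈ Finset.range (d + 1), 0 ≤ a u := by
    intro u hu
    rw [Finset.mem_range] at hu
    rcases Nat.eq_zero_or_pos u with rfl | h0
    · rw [ha0]; exact zero_le_one
    rcases lt_trichotomy u c with h | h | h
    · rw [hsupp u h0.ne' (Or.inl h)]
    · rw [h]; exact hac.le
    · exact hann u h (by omega)
  set U := (Finset.range (d + 1)).filter (fun i => 0 < a i) with hU
  have ha : ∀ i ∈ U, 0 < a i := fun i hi => (Finset.mem_filter.1 hi).2
  have hA' : A = ∑ u ∈ U, C (a u) * X ^ u := by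
    rw [hA, hU, Finset.sum_filter_of_ne]
    intro u hu h
    refine lt_of_le_of_ne (hnn u hu) fun h0 => h ?_
    rw [← h0]; simp
  clear_value U
  clear hA
  subst hA'
  set A : ℝ[X] := ∑ u ∈ U, C (a u) * X ^ u with hA
  -- feasible set
  let S : Set (ℕ → ℝ) := {β | β ∈ Set.pi Set.univ (fun i => if i ∈ U then Set.Icc (0 : ℝ) 1 else {0}) ∧
    ∑ i ∈ U, β i = 1 ∧ ∑ i ∈ U, (i : ℝ) * β i = (ξ : ℝ)}
  have hScomp : IsCompact S := by
    have h1 : IsCompact (Set.pi Set.univ (fun i : ℕ => if i ∈ U then Set.Icc (0 : ℝ) 1 else {0})) := by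
      refine isCompact_univ_pi fun i => ?_
      split_ifs
      · exact isCompact_Icc
      · exact isCompact_singleton
    have h2 : IsClosed {β : ℕ → ℝ | ∑ i ∈ U, β i = 1 ∧ ∑ i ∈ U, (i : ℝ) * β i = (ξ : ℝ)} := by
      refine IsClosed.inter (isClosed_eq ?_ continuous_const) (isClosed_eq ?_ continuous_const)
      · fun_prop
      · fun_prop
    exact h1.inter_right h2
  have mkS : ∀ β : ℕ → ℝ, (∀ i, 0 ≤ β i) → ∑ i ∈ U, β i = 1 → ∑ i ∈ U, (i : ℝ) * β i = (ξ : ℝ) →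
      (∀ i, i ∉ U → β i = 0) → β ∈ S := by
    intro β h0 h1 h2 h3
    refine ⟨fun i _ => ?_, h1, h2⟩
    by_cases hi : i ∈ U
    · simp only [if_pos hi]
      exact ⟨h0 i, h1 ▸ Finset.single_le_sum (fun j _ => h0 j) hi⟩
    · simp only [if_neg hi]
      exact h3 i hi
  have S0 : ∀ β ∈ S, (∀ i, 0 ≤ β i) ∧ ∀ i, i ∉ U → β i = 0 := by
    intro β hβ
    have key : ∀ i, i ∉ U → β i = 0 := by
      intro i hi
      have := hβ.1 i trivial
      simpa only [if_neg hi, Set.mem_singleton_iff] using this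
    refine ⟨fun i => ?_, key⟩
    by_cases hi : i ∈ U
    · have := hβ.1 i trivial
      simp only [if_pos hi] at this
      exact this.1
    · exact (key i hi).ge
  have intS : ∀ (k : ℕ → ℕ) (l : ℕ), 0 < l → k ∈ U.piAntidiag l →
      ((∑ i ∈ U, i * k i : ℕ) : ℚ) = ξ * l → (fun i => (k i : ℝ) / l) ∈ S := by
    intro k l hl hk hn
    have hl' : (l : ℝ) ≠ 0 := by positivity
    obtain ⟨hk1, hk2⟩ := Finset.mem_piAntidiag.1 hk
    refine mkS _ (fun i => by positivity) ?_ ?_ ?_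
    · rw [← Finset.sum_div, div_eq_one_iff_eq hl']; exact_mod_cast hk1
    · have : ((∑ i ∈ U, i * k i : ℕ) : ℝ) = ξ * l := by exact_mod_cast hn
      simp only [← mul_div_assoc]
      rw [← Finset.sum_div, div_eq_iff hl', ← this]
      push_cast; rfl
    · intro i hi
      have : k i = 0 := not_imp_comm.1 (hk2 i) hi
      simp [this]
  have hSne : S.Nonempty := by
    obtain ⟨l, hl⟩ := hLne
    rw [hL] at hl
    obtain ⟨hl0, hl1, hl2⟩ := hl
    rw [hA, GR.coeff_eq] at hl2
    obtain ⟨k, hk, hkp⟩ := Finset.exists_lt_of_sum_lt (s := U.piAntidiag l) (f := fun _ => (0 : ℝ))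
      (g := fun k => if ∑ i ∈ U, i * k i = ⌊ξ * (l : ℚ)⌋₊ then GR.T U a k else 0)
      (by rw [Finset.sum_const_zero]; exact hl2)
    have hn : ∑ i ∈ U, i * k i = ⌊ξ * (l : ℚ)⌋₊ := by
      by_contra h
      simp only [if_neg h] at hkp
      exact lt_irrefl _ hkp
    exact ⟨_, intS k l hl0 hk (by rw [hn, hl1])⟩
  obtain ⟨β, hβS, hβmax⟩ := hScomp.exists_isMaxOn hSne (GR.F_cont ha).continuousOn
  have hmax : ∀ γ ∈ S, GR.F U a γ ≤ GR.F U a β := fun γ hγ => hβmax hγ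
  refine ⟨GR.F U a β, ⟨⟨β, (S0 β hβS).1, hβS.2.1, hβS.2.2, rfl⟩, ?_⟩, ?_⟩
  · rintro x ⟨γ, g0, g1, g2, rfl⟩
    let γ' : ℕ → ℝ := fun i => if i ∈ U then γ i else 0
    have e : ∀ i ∈ U, γ' i = γ i := fun i hi => if_pos hi
    have h : γ' ∈ S := by
      refine mkS γ' (fun i => ?_) ?_ ?_ (fun i hi => if_neg hi)
      · simp only [γ']; split_ifs <;> [exact g0 i; exact le_rfl]
      · rw [Finset.sum_congr rfl e, g1]
      · rw [← g2]; exact Finset.sum_congr rfl fun i hi => by rw [e i hi]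
    refine le_trans (le_of_eq ?_) (hmax γ' h)
    exact Finset.sum_congr rfl fun i hi => by rw [e i hi]
  -- the limit
  set M := GR.F U a β with hM
  let g : ℕ → ℝ := fun l => Real.log ((A ^ l).coeff ⌊ξ * (l : ℚ)⌋₊)
  have Lpos : ∀ l ∈ L, 0 < l := fun l hl => by rw [hL] at hl; exact hl.1
  have hadd : ∀ l ∈ L, ∀ m ∈ L, l + m ∈ L ∧ g l + g m ≤ g (l + m) := by
    intro l hl m hm
    rw [hL] at hl hm
    obtain ⟨l0, l1, l2⟩ := hl
    obtain ⟨m0, m1, m2⟩ := hm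
    have e : ξ * ((l + m : ℕ) : ℚ) = ((⌊ξ * (l : ℚ)⌋₊ + ⌊ξ * (m : ℚ)⌋₊ : ℕ) : ℚ) := by
      push_cast; rw [l1, m1]; ring
    have e2 : ⌊ξ * ((l + m : ℕ) : ℚ)⌋₊ = ⌊ξ * (l : ℚ)⌋₊ + ⌊ξ * (m : ℚ)⌋₊ := by
      rw [e, Nat.floor_natCast]
    have h : (A ^ l).coeff ⌊ξ * (l : ℚ)⌋₊ * (A ^ m).coeff ⌊ξ * (m : ℚ)⌋₊ ≤
        (A ^ (l + m)).coeff ⌊ξ * ((l + m : ℕ) : ℚ)⌋₊ := by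
      rw [e2, pow_add, Polynomial.coeff_mul]
      exact Finset.single_le_sum
        (f := fun x : ℕ × ℕ => (A ^ l).coeff x.1 * (A ^ m).coeff x.2)
        (a := (⌊ξ * (l : ℚ)⌋₊, ⌊ξ * (m : ℚ)⌋₊))
        (fun x _ => mul_nonneg (GR.coeff_nonneg ha _ _) (GR.coeff_nonneg ha _ _))
        (Finset.HasAntidiagonal.mem_antidiagonal.2 rfl)
    have hp := mul_pos l2 m2
    refine ⟨?_, ?_⟩
    · rw [hL]
      exact ⟨by omega, by rw [e2, ← e], hp.trans_le h⟩
    · simp only [g]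
      rw [← Real.log_mul l2.ne' m2.ne']
      exact Real.log_le_log hp h
  have hupper : ∀ l ∈ L, g l / l ≤ M + GR.K U l / l := by
    intro l hl
    rw [hL] at hl
    obtain ⟨l0, l1, l2⟩ := hl
    have hl' : (0 : ℝ) < l := by exact_mod_cast l0
    have := GR.upper ha M l _ l0 (fun k hk hn => hmax _ (intS k l l0 hk (by rw [hn, l1]))) l2
    rw [div_le_iff₀ hl', add_mul, div_mul_cancel₀ _ hl'.ne']
    linarith
  have hlower : ∀ c < M, ∀ᶠ l : ℕ in atTop, l ∈ L → c < g l / l := by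
    intro c hc
    have hex := fun n : ℕ => GR.approx U β (S0 β hβS).1 hβS.2.1 ξ hβS.2.2 (1 / ((n : ℝ) + 1))
      (by positivity)
    choose k l hl hk hn hlt using hex
    have t : Tendsto (fun n => (fun i => (k n i : ℝ) / l n : ℕ → ℝ)) atTop (nhds β) := by
      rw [tendsto_pi_nhds]
      intro i
      by_cases hi : i ∈ U
      · rw [tendsto_iff_dist_tendsto_zero]
        exact squeeze_zero (fun _ => dist_nonneg) (fun n => (hlt n i hi).le)
          tendsto_one_div_add_atTop_nhds_zero_nat
      · have : ∀ n, k n i = 0 := fun n => not_imp_comm.1 ((Finset.mem_piAntidiag.1 (hk n)).2 i) hi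
        simp [this, (S0 β hβS).2 i hi]
    have t2 := ((GR.F_cont ha).tendsto β).comp t
    obtain ⟨n, hnc⟩ := (t2.eventually (lt_mem_nhds hc)).exists
    simp only [Function.comp] at hnc
    have hkn := hk n
    have hnn' := hn n
    have hln := hl n
    have hl0 : (0 : ℝ) < l n := by exact_mod_cast hln
    obtain ⟨hk1, hk2⟩ := Finset.mem_piAntidiag.1 hkn
    have t3 : Tendsto (fun m : ℕ => GR.F U a (fun i => (k n i : ℝ) / l n)
        - GR.K U (m * l n) / ((m * l n : ℕ) : ℝ)) atTop
        (nhds (GR.F U a (fun i => (k n i : ℝ) / l n) - 0)) :=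
      tendsto_const_nhds.sub ((GR.K_div U).comp (tendsto_id.atTop_mul_const' hln))
    rw [sub_zero] at t3
    obtain ⟨m, hm, hm0⟩ := ((t3.eventually (lt_mem_nhds hnc)).and (eventually_gt_atTop 0)).exists
    have hp0 : 0 < m * l n := Nat.mul_pos hm0 hln
    have hp0' : (0 : ℝ) < ((m * l n : ℕ) : ℝ) := by exact_mod_cast hp0
    have hs1 : ∑ i ∈ U, m * k n i = m * l n := by rw [← Finset.mul_sum, hk1]
    have hmem : (fun i => m * k n i) ∈ U.piAntidiag (m * l n) := by
      rw [Finset.mem_piAntidiag]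
      exact ⟨hs1, fun i hi => hk2 i (right_ne_zero_of_mul hi)⟩
    have hs2 : ∑ i ∈ U, i * (m * k n i) = m * ∑ i ∈ U, i * k n i := by
      rw [Finset.mul_sum]; exact Finset.sum_congr rfl fun i _ => by ring
    have hx : ξ * ((m * l n : ℕ) : ℚ) = ((m * ∑ i ∈ U, i * k n i : ℕ) : ℚ) := by
      rw [Nat.cast_mul, Nat.cast_mul m, hnn']; ring
    have hfl : ⌊ξ * ((m * l n : ℕ) : ℚ)⌋₊ = m * ∑ i ∈ U, i * k n i := by
      rw [hx, Nat.floor_natCast]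
    have hlow := GR.lower ha (m * l n) _ _ hmem (hs2.trans hfl.symm)
    have hTpos := GR.T_pos ha (fun i => m * k n i)
    have hpL : m * l n ∈ L := by
      rw [hL]
      exact ⟨hp0, by rw [hfl, hx], hTpos.trans_le hlow⟩
    refine GR.fekete L g Lpos hadd (m * l n) hpL c (hm.trans_le ?_)
    have h1 := GR.le_log_T ha (fun i => m * k n i) (m * l n) hp0 hs1
    have h2 := Real.log_le_log hTpos hlow
    have e : (fun i => ((m * k n i : ℕ) : ℝ) / ((m * l n : ℕ) : ℝ)) =
        fun i => (k n i : ℝ) / l n := by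
      funext i
      push_cast
      rw [mul_div_mul_left]
      positivity
    rw [e] at h1
    rw [le_div_iff₀ hp0', sub_mul, div_mul_cancel₀ _ hp0'.ne']
    simp only [g]
    linarith
  rw [tendsto_order]
  constructor
  · intro c hc
    rw [eventually_inf_principal]
    filter_upwards [hlower c hc] with l h1 h2
    rw [one_div_mul_eq_div]
    exact h1 h2
  · intro c hc
    rw [eventually_inf_principal]
    have t : Tendsto (fun l : ℕ => M + GR.K U l / l) atTop (nhds (M + 0)) :=
      tendsto_const_nhds.add (GR.K_div U)
    rw [add_zero] at t
    filter_upwards [t.eventually (gt_mem_nhds hc)] with l h1 h2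
    rw [one_div_mul_eq_div]
    exact (hupper l h2).trans_lt h1
end

section
/- Lemma (exponential growth rate of coefficients of polynomial powers, bivariate). Let B(x,y) = 1 + sum_{u=1}^{k} sum_{v=c}^{d} B_{u,v} x^u y^v, where k >= 1 and 1 <= c <= d, be a real bivariate polynomial with B_{u,v} >= 0 for all 1 <= u <= k, c <= v <= d; set B_{0,0} = 1 and S = { (i,j) in N^2 : B_{i,j} > 0 } (so (0,0) in S). Let xi and theta be fixed positive rational numbers, and let L be the set of positive integers l such that xi*l and theta*l are integers and the coefficient of x^{xi*l} y^{theta*l} in (B(x,y))^l is positive. Then: (a) if t in L then j*t in L for every positive integer j, so L is either empty or infinite; and (b) if L is nonempty, the limit, over l in L as l -> infinity, of (1/l) log Coeff[(B(x,y))^l, x^{xi*l} y^{theta*l}] exists and equals the maximum of sum_{(i,j) in S} eta_{i,j} log(B_{i,j} / eta_{i,j}) over all vectors eta = (eta_{i,j})_{(i,j) in S} satisfying eta_{i,j} >= 0 for all (i,j) in S, sum_{(i,j) in S} eta_{i,j} = 1, sum_{(i,j) in S} i eta_{i,j} = xi, and sum_{(i,j) in S} j eta_{i,j} = theta (terms with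 eta_{i,j} = 0 are interpreted as 0; logarithms are natural). -/
open Polynomial Filter Finset
open scoped Classical

lemma aux_log_fact_lower (n : ℕ) :
    (n : ℝ) * Real.log n - n ≤ Real.log (n.factorial : ℝ) := by
  rcases Nat.eq_zero_or_pos n with rfl | hn
  · simp
  have hn' : (0 : ℝ) < n := by exact_mod_cast hn
  have h := Real.pow_div_factorial_le_exp (x := (n : ℝ)) hn'.le n
  have hf : (0 : ℝ) < (n.factorial : ℝ) := by exact_mod_cast n.factorial_pos
  have h2 := Real.log_le_log (by positivity) h
  rw [Real.log_exp, Real.log_div (by positivity) hf.ne', Real.log_pow] at h2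
  linarith

lemma aux_log_fact_upper (n : ℕ) :
    Real.log (n.factorial : ℝ) ≤ (n : ℝ) * Real.log n - n + (1 + Real.log (n + 1)) := by
  have key : ∀ m : ℕ, Real.log ((m + 1).factorial : ℝ) ≤
      ((m : ℝ) + 1) * Real.log (m + 1) - (m + 1) + (1 + Real.log (m + 1)) := by
    intro m
    induction m with
    | zero => simp
    | succ m ih =>
      rw [Nat.factorial_succ, Nat.cast_mul, Real.log_mul (by positivity) (by positivity)]
      have h := Real.one_sub_inv_le_log_of_pos (x := ((m : ℝ) + 2) / (m + 1)) (by positivity)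
      rw [Real.log_div (by positivity) (by positivity), inv_div] at h
      push_cast
      have e : ((m : ℝ) + 1 + 1) = m + 2 := by ring
      rw [e]
      have h3 : 1 ≤ ((m : ℝ) + 2) * (Real.log (m + 2) - Real.log (m + 1)) := by
        have : ((m : ℝ) + 2) * (1 - (m + 1) / (m + 2)) = 1 := by field_simp; ring
        calc (1 : ℝ) = ((m : ℝ) + 2) * (1 - (m + 1) / (m + 2)) := this.symm
          _ ≤ _ := by gcongr
      nlinarith
  rcases n with _ | m
  · simp
  · have h := key m
    have h2 : Real.log ((m : ℝ) + 1) ≤ Real.log ((m : ℝ) + 1 + 1) :=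
      Real.log_le_log (by positivity) (by linarith)
    push_cast at h ⊢
    linarith

noncomputable def auxF (S : Finset (ℕ × ℕ)) (w : ℕ × ℕ → ℝ) (x : ℕ × ℕ → ℝ) : ℝ :=
  ∑ s ∈ S, (x s * Real.log (w s) + Real.negMulLog (x s))

noncomputable def auxT (S : Finset (ℕ × ℕ)) (w : ℕ × ℕ → ℝ) (n : ℕ × ℕ → ℕ) : ℝ :=
  (Nat.multinomial S n : ℝ) * ∏ s ∈ S, w s ^ n s

lemma auxF_eq (S : Finset (ℕ × ℕ)) (w : ℕ × ℕ → ℝ) (hw : ∀ s ∈ S, 0 < w s) (x : ℕ × ℕ → ℝ) :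
    ∑ s ∈ S, x s * Real.log (w s / x s) = auxF S w x := by
  refine sum_congr rfl fun s hs => ?_
  by_cases h : x s = 0
  · simp [h]
  · rw [Real.log_div (hw s hs).ne' h, Real.negMulLog]; ring

lemma auxF_cont (S : Finset (ℕ × ℕ)) (w : ℕ × ℕ → ℝ) : Continuous (auxF S w) := by
  unfold auxF
  refine continuous_finsetSum _ fun s _ => ?_
  exact ((continuous_apply s).mul continuous_const).add
    (Real.continuous_negMulLog.comp (continuous_apply s))

lemma auxT_pos (S : Finset (ℕ × ℕ)) (w : ℕ × ℕ → ℝ) (hw : ∀ s ∈ S, 0 < w s) (n : ℕ × ℕ → ℕ) :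
    0 < auxT S w n := by
  unfold auxT
  have := Nat.multinomial_pos S n
  have h2 : 0 < ∏ s ∈ S, w s ^ n s := prod_pos fun s hs => pow_pos (hw s hs) _
  positivity

lemma auxT_log (S : Finset (ℕ × ℕ)) (w : ℕ × ℕ → ℝ) (hw : ∀ s ∈ S, 0 < w s) (n : ℕ × ℕ → ℕ)
    (l : ℕ) (hl : 0 < l) (hn : ∑ s ∈ S, n s = l) :
    |Real.log (auxT S w n) - l * auxF S w (fun s => (n s : ℝ) / l)|
      ≤ ((S.card : ℝ) + 1) * (1 + Real.log (l + 1)) := by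
  have hl' : (0 : ℝ) < l := by exact_mod_cast hl
  have hm : (0 : ℝ) < Nat.multinomial S n := by exact_mod_cast Nat.multinomial_pos S n
  have h2 : 0 < ∏ s ∈ S, w s ^ n s := prod_pos fun s hs => pow_pos (hw s hs) _
  have e1 : Real.log (Nat.multinomial S n : ℝ) =
      Real.log (l.factorial : ℝ) - ∑ s ∈ S, Real.log ((n s).factorial : ℝ) := by
    have h := Nat.multinomial_spec S n
    rw [hn] at h
    have h' : (∏ s ∈ S, ((n s).factorial : ℝ)) * (Nat.multinomial S n : ℝ) = l.factorial := by
      exact_mod_cast h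
    rw [← h', Real.log_mul (prod_ne_zero_iff.2 fun s _ => by positivity) hm.ne',
      Real.log_prod (fun s _ => by positivity)]
    ring
  have e2 : Real.log (∏ s ∈ S, w s ^ n s) = ∑ s ∈ S, (n s : ℝ) * Real.log (w s) := by
    rw [Real.log_prod (fun s hs => (pow_pos (hw s hs) _).ne')]
    simp
  have hn' : ∑ s ∈ S, (n s : ℝ) = l := by exact_mod_cast hn
  have e3 : l * auxF S w (fun s => (n s : ℝ) / l) =
      ∑ s ∈ S, (n s : ℝ) * Real.log (w s) + (l * Real.log l - ∑ s ∈ S, (n s : ℝ) * Real.log (n s)) := by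
    have : (l : ℝ) * Real.log l = ∑ s ∈ S, (n s : ℝ) * Real.log l := by rw [← sum_mul, hn']
    rw [this, ← sum_sub_distrib, ← sum_add_distrib, auxF, mul_sum]
    refine sum_congr rfl fun s _ => ?_
    rcases Nat.eq_zero_or_pos (n s) with h | h
    · simp [h]
    · have h' : (0 : ℝ) < n s := by exact_mod_cast h
      rw [Real.negMulLog, Real.log_div h'.ne' hl'.ne']
      field_simp
      ring
  have lo := sum_le_sum fun s (_ : s ∈ S) => aux_log_fact_lower (n s)
  have up : ∑ s ∈ S, Real.log ((n s).factorial : ℝ) ≤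
      ∑ s ∈ S, ((n s : ℝ) * Real.log (n s) - n s + (1 + Real.log (l + 1))) := by
    refine sum_le_sum fun s hs => (aux_log_fact_upper (n s)).trans ?_
    have : n s ≤ l := hn ▸ single_le_sum (f := n) (fun _ _ => Nat.zero_le _) hs
    have : (n s : ℝ) ≤ l := by exact_mod_cast this
    gcongr
  rw [sum_sub_distrib, hn'] at lo
  rw [sum_add_distrib, sum_sub_distrib, hn', sum_const, nsmul_eq_mul] at up
  have lo' := aux_log_fact_lower l
  have up' := aux_log_fact_upper l
  have hp : 0 ≤ 1 + Real.log ((l : ℝ) + 1) := by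
    have := Real.log_nonneg (x := (l : ℝ) + 1) (by linarith)
    linarith
  have hq : 0 ≤ (S.card : ℝ) * (1 + Real.log ((l : ℝ) + 1)) := by positivity
  rw [auxT, Real.log_mul hm.ne' h2.ne', e1, e2, e3, abs_le]
  constructor <;> linarith

lemma aux_card (S : Finset (ℕ × ℕ)) (l : ℕ) : (piAntidiag S l).card ≤ (l + 1) ^ S.card := by
  have : (S.pi fun _ => range (l + 1)).card = (l + 1) ^ S.card := by simp [card_pi]
  rw [← this]
  refine card_le_card_of_injOn (fun n s _ => n s) ?_ ?_
  · intro n hn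
    rw [mem_coe, mem_piAntidiag] at hn
    rw [mem_coe, Finset.mem_pi]
    intro s hs
    have : n s ≤ l := hn.1 ▸ single_le_sum (f := n) (fun _ _ => Nat.zero_le _) hs
    simp; omega
  · intro n hn m hm h
    rw [mem_coe, mem_piAntidiag] at hn hm
    funext s
    by_cases hs : s ∈ S
    · exact congrFun (congrFun h s) hs
    · rw [not_imp_comm.1 (hn.2 s) hs, not_imp_comm.1 (hm.2 s) hs]

/-- coefficient formula -/
lemma aux_coeff (S : Finset (ℕ × ℕ)) (w : ℕ × ℕ → ℝ) (l p q : ℕ) :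
    (((∑ s ∈ S, monomial s.1 (monomial s.2 (w s))) ^ l : ℝ[X][X]).coeff p).coeff q =
    ∑ n ∈ (piAntidiag S l).filter
      (fun n => ∑ s ∈ S, s.1 * n s = p ∧ ∑ s ∈ S, s.2 * n s = q), auxT S w n := by
  have hprod : ∀ (T : Finset (ℕ × ℕ)) (n : ℕ × ℕ → ℕ),
      ∏ s ∈ T, ((monomial s.1 (monomial s.2 (w s)) : ℝ[X][X]) ^ n s) =
      monomial (∑ s ∈ T, s.1 * n s) (monomial (∑ s ∈ T, s.2 * n s) (∏ s ∈ T, w s ^ n s)) := by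
    intro T n
    induction T using Finset.induction_on with
    | empty => simp
    | insert a T ha ih =>
      rw [prod_insert ha, ih, sum_insert ha, sum_insert ha, prod_insert ha]
      simp only [monomial_pow, monomial_mul_monomial]
  rw [sum_pow_eq_sum_piAntidiag, finsetSum_coeff, finsetSum_coeff, sum_filter]
  refine sum_congr rfl fun n _ => ?_
  rw [hprod, ← nsmul_eq_mul, coeff_smul, coeff_smul, coeff_monomial]
  by_cases h1 : ∑ s ∈ S, s.1 * n s = p
  · by_cases h2 : ∑ s ∈ S, s.2 * n s = q
    · simp [h1, h2, auxT]
    · simp [h1, h2, coeff_monomial]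
  · simp [h1]

lemma aux_super (P Q : ℝ[X][X]) (hP : ∀ p q, 0 ≤ (P.coeff p).coeff q)
    (hQ : ∀ p q, 0 ≤ (Q.coeff p).coeff q) (p q p' q' : ℕ) :
    (P.coeff p).coeff q * (Q.coeff p').coeff q' ≤ ((P * Q).coeff (p + p')).coeff (q + q') := by
  rw [coeff_mul, finsetSum_coeff]
  refine le_trans ?_ (single_le_sum (f := fun x : ℕ × ℕ => (P.coeff x.1 * Q.coeff x.2).coeff (q + q'))
    (fun x _ => ?_) (mem_antidiagonal.2 (rfl : (p, p').1 + (p, p').2 = p + p')))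
  · dsimp only
    rw [coeff_mul]
    exact single_le_sum (f := fun x : ℕ × ℕ => (P.coeff p).coeff x.1 * (Q.coeff p').coeff x.2)
      (fun x _ => mul_nonneg (hP _ _) (hQ _ _)) (mem_antidiagonal.2 (rfl : (q, q').1 + (q, q').2 = q + q'))
  · rw [coeff_mul]
    exact sum_nonneg fun y _ => mul_nonneg (hP _ _) (hQ _ _)

lemma aux_P (k d : ℕ) (b : ℕ → ℕ → ℝ) (hb : ∀ u v, 0 ≤ b u v) :
    ∑ u ∈ Finset.range (k + 1),
      Polynomial.C (∑ v ∈ Finset.range (d + 1),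
        Polynomial.C (b u v) * Polynomial.X ^ v) * Polynomial.X ^ u =
    ∑ s ∈ ((Finset.range (k + 1)) ×ˢ (Finset.range (d + 1))).filter
            (fun ij => 0 < b ij.1 ij.2), monomial s.1 (monomial s.2 (b s.1 s.2)) := by
  rw [sum_filter, sum_product]
  refine sum_congr rfl fun u _ => ?_
  rw [map_sum, sum_mul]
  refine sum_congr rfl fun v _ => ?_
  rw [C_mul_X_pow_eq_monomial, C_mul_X_pow_eq_monomial]
  split_ifs with h
  · rfl
  · have : b u v = 0 := le_antisymm (not_lt.1 h) (hb u v)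
    simp [this]

/-- simultaneous Dirichlet approximation -/
lemma aux_dirichlet (S : Finset (ℕ × ℕ)) (x : ℕ × ℕ → ℝ) (D : ℕ) (hD : 0 < D) (δ : ℝ) (hδ : 0 < δ)
    (M : ℕ) : ∃ r : ℕ, M ≤ r ∧ 0 < r ∧ ∃ z : ℕ × ℕ → ℤ,
      ∀ s ∈ S, |((r * D : ℕ) : ℝ) * x s - z s| < δ := by
  let f : ℕ → (S → ℝ) := fun j s => Int.fract ((j : ℝ) * D * x s)
  have hb : ∀ j, f j ∈ Set.univ.pi (fun _ : S => Set.Icc (0 : ℝ) 1) := fun j s _ =>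
    ⟨Int.fract_nonneg _, (Int.fract_lt_one _).le⟩
  obtain ⟨a, -, φ, hφ, ht⟩ := (isCompact_univ_pi (fun _ : S => isCompact_Icc (a := (0 : ℝ)) (b := 1))).tendsto_subseq hb
  obtain ⟨N, hN⟩ := Metric.cauchySeq_iff.1 ht.cauchySeq δ hδ
  have hlt : φ N + M + 1 ≤ φ (N + M + 1) := by
    have := hφ.add_le_nat (M + 1) N
    rw [show M + 1 + N = N + M + 1 by ring] at this
    omega
  refine ⟨φ (N + M + 1) - φ N, by omega, by omega,
    fun s => ⌊(φ (N + M + 1) : ℝ) * D * x s⌋ - ⌊(φ N : ℝ) * D * x s⌋, fun s hs => ?_⟩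
  have h := hN (N + M + 1) (by omega) N le_rfl
  have h2 := (dist_le_pi_dist _ _ (⟨s, hs⟩ : S)).trans_lt h
  rw [Real.dist_eq] at h2
  simp only [Function.comp, f, Int.fract] at h2
  rw [Nat.cast_mul, Nat.cast_sub (by omega)]
  push_cast
  refine lt_of_eq_of_lt ?_ h2
  congr 1
  ring

lemma aux_fekete (L : Set ℕ) (α : ℕ → ℝ) (hpos : ∀ l ∈ L, 0 < l)
    (hadd : ∀ l ∈ L, ∀ m ∈ L, l + m ∈ L ∧ α l + α m ≤ α (l + m)) (G : ℝ) (e : ℕ → ℝ)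
    (he : Tendsto (fun l : ℕ => e l / l) atTop (nhds 0)) (hup : ∀ l ∈ L, α l ≤ l * G + e l)
    (hlow : ∀ ε > 0, ∃ t ∈ L, G - ε ≤ α t / t) :
    Tendsto (fun l : ℕ => (1 / (l : ℝ)) * α l) (atTop ⊓ 𝓟 L) (nhds G) := by
  rw [tendsto_order]
  constructor
  · intro a ha
    obtain ⟨t, ht, hGt⟩ := hlow ((G - a) / 2) (by linarith)
    set β := α t / t with hβ
    have ht0 := hpos t ht
    have ht' : (0 : ℝ) < t := by exact_mod_cast ht0
    let R : ℕ → ℕ := fun r => if h : ∃ m, m ∈ L ∧ m % t = r then Nat.find h else 0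
    let C : ℝ := ∑ r ∈ range t, |α (R r) - β * R r|
    have hq : ∀ q : ℕ, ∀ m ∈ L, m + q * t ∈ L ∧ α m + q * α t ≤ α (m + q * t) := by
      intro q m hm
      induction q with
      | zero => simpa using hm
      | succ q ih =>
        have h := hadd _ ih.1 t ht
        rw [show m + (q + 1) * t = m + q * t + t by ring]
        refine ⟨h.1, ?_⟩
        push_cast
        linarith [h.2, ih.2]
    have hC : ∀ l ∈ L, β * l - C ≤ α l := by
      intro l hl
      have hex : ∃ m, m ∈ L ∧ m % t = l % t := ⟨l, hl, rfl⟩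
      have hR : R (l % t) = Nat.find hex := dif_pos hex
      obtain ⟨h1, h2⟩ := Nat.find_spec hex
      have h3 : Nat.find hex ≤ l := Nat.find_min' hex ⟨hl, rfl⟩
      rw [← hR] at h1 h2 h3
      have hC1 : |α (R (l % t)) - β * R (l % t)| ≤ C :=
        single_le_sum (f := fun r => |α (R r) - β * R r|) (fun _ _ => abs_nonneg _)
          (mem_range.2 (Nat.mod_lt _ ht0))
      obtain ⟨q, hq'⟩ := (Nat.modEq_iff_dvd' h3).1 h2
      have hl2 : l = R (l % t) + q * t := by rw [mul_comm]; omega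
      have h4 := (hq q _ h1).2
      rw [← hl2] at h4
      have h5 : (l : ℝ) = R (l % t) + q * t := by exact_mod_cast hl2
      have h6 : α t = β * t := by rw [hβ]; field_simp
      have h7 := neg_abs_le (α (R (l % t)) - β * R (l % t))
      rw [h6] at h4
      have h8 : β * l = β * R (l % t) + q * (β * t) := by rw [h5]; ring
      linarith
    have hlim : Tendsto (fun l : ℕ => β - C / l) atTop (nhds (β - 0)) :=
      tendsto_const_nhds.sub (tendsto_const_div_atTop_nhds_zero_nat C)
    have hev := (tendsto_order.1 hlim).1 a (by linarith)
    rw [eventually_inf_principal]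
    filter_upwards [hev] with l h1 hl
    have hl' : (0 : ℝ) < l := by exact_mod_cast hpos l hl
    refine h1.trans_le ?_
    have : β - C / l = 1 / (l : ℝ) * (β * l - C) := by field_simp
    rw [this]
    exact mul_le_mul_of_nonneg_left (hC l hl) (by positivity)
  · intro a ha
    have hlim : Tendsto (fun l : ℕ => G + e l / l) atTop (nhds (G + 0)) :=
      tendsto_const_nhds.add he
    have hev := (tendsto_order.1 hlim).2 a (by linarith)
    rw [eventually_inf_principal]
    filter_upwards [hev] with l h1 hl
    have hl' : (0 : ℝ) < l := by exact_mod_cast hpos l hl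
    refine lt_of_le_of_lt ?_ h1
    have : G + e l / l = 1 / (l : ℝ) * (l * G + e l) := by field_simp
    rw [this]
    exact mul_le_mul_of_nonneg_left (hup l hl) (by positivity)

lemma aux_err (c : ℝ) :
    Tendsto (fun l : ℕ => (c * (1 + Real.log ((l : ℝ) + 1))) / l) atTop (nhds 0) := by
  have h1 : Tendsto (fun x : ℝ => Real.log x / x) atTop (nhds 0) := by
    simpa using Real.isLittleO_log_id_atTop.tendsto_div_nhds_zero
  have h2 : Tendsto (fun l : ℕ => (l : ℝ) + 1) atTop atTop :=
    tendsto_atTop_add_const_right _ _ tendsto_natCast_atTop_atTop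
  have h3 := h1.comp h2
  have h4 : Tendsto (fun l : ℕ => 1 / (l : ℝ)) atTop (nhds 0) :=
    tendsto_const_div_atTop_nhds_zero_nat 1
  have h5 : Tendsto (fun l : ℕ => c * (1 / (l : ℝ) +
      (Real.log ((l : ℝ) + 1) / ((l : ℝ) + 1)) * (1 + 1 / (l : ℝ)))) atTop
      (nhds (c * (0 + 0 * (1 + 0)))) :=
    (h4.add (h3.mul (h4.const_add 1))).const_mul c
  rw [show c * (0 + 0 * (1 + 0)) = (0 : ℝ) by ring] at h5
  refine h5.congr' ?_
  filter_upwards [eventually_gt_atTop 0] with l hl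
  have hl' : (0 : ℝ) < l := by exact_mod_cast hl
  field_simp

lemma aux_approx (S : Finset (ℕ × ℕ)) (x : ℕ × ℕ → ℝ) (ξ θ : ℚ) (hξ : 0 < ξ) (hθ : 0 < θ)
    (hx0 : ∀ s, 0 ≤ x s) (hoff : ∀ s, s ∉ S → x s = 0) (h1 : ∑ s ∈ S, x s = 1)
    (h2 : ∑ s ∈ S, (s.1 : ℝ) * x s = ξ) (h3 : ∑ s ∈ S, (s.2 : ℝ) * x s = θ) (M : ℕ) :
    ∃ m : ℕ, M ≤ m ∧ 0 < m ∧ (⌊ξ * (m : ℚ)⌋₊ : ℚ) = ξ * m ∧ (⌊θ * (m : ℚ)⌋₊ : ℚ) = θ * m ∧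
      ∃ n ∈ piAntidiag S m, (∑ s ∈ S, s.1 * n s = ⌊ξ * (m : ℚ)⌋₊ ∧
        ∑ s ∈ S, s.2 * n s = ⌊θ * (m : ℚ)⌋₊) ∧ ∀ s, |(n s : ℝ) / m - x s| ≤ 1 / m := by
  set W : ℝ := ∑ s ∈ S, (1 + (s.1 : ℝ) + s.2) with hW
  have hW0 : 0 ≤ W := sum_nonneg fun s _ => by positivity
  obtain ⟨r, hMr, hr, z, hz⟩ := aux_dirichlet S x (ξ.den * θ.den)
    (Nat.mul_pos ξ.den_pos θ.den_pos) (1 / (1 + W)) (by positivity) M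
  set m := r * (ξ.den * θ.den) with hm
  have hm0 : 0 < m := Nat.mul_pos hr (Nat.mul_pos ξ.den_pos θ.den_pos)
  have hm' : (0 : ℝ) < m := by exact_mod_cast hm0
  have hint : ∀ ρ : ℚ, 0 < ρ → ρ.den ∣ m → (⌊ρ * (m : ℚ)⌋₊ : ℚ) = ρ * m := by
    intro ρ hρ ⟨a, ha⟩
    have : ρ * (m : ℚ) = ((ρ.num.toNat * a : ℕ) : ℚ) := by
      rw [ha]
      push_cast
      rw [← mul_assoc, Rat.mul_den_eq_num]
      congr 1
      have := Int.toNat_of_nonneg (Rat.num_pos.2 hρ).le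
      exact_mod_cast this.symm
    rw [this, Nat.floor_natCast]
  have hiξ := hint ξ hξ ⟨r * θ.den, by rw [hm]; ring⟩
  have hiθ := hint θ hθ ⟨r * ξ.den, by rw [hm]; ring⟩
  have hδ1 : 1 / (1 + W) ≤ 1 := by rw [div_le_one (by positivity)]; linarith
  have hz0 : ∀ s ∈ S, 0 ≤ z s := by
    intro s hs
    have := (abs_lt.1 ((hz s hs).trans_le hδ1)).2
    have h4 : 0 ≤ (m : ℝ) * x s := mul_nonneg hm'.le (hx0 s)
    have h5 : (-1 : ℝ) < z s := by linarith
    have h6 : (-1 : ℤ) < z s := by exact_mod_cast h5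
    omega
  let n : ℕ × ℕ → ℕ := fun s => if s ∈ S then (z s).toNat else 0
  have hn : ∀ s ∈ S, (n s : ℝ) = z s := by
    intro s hs
    have : n s = (z s).toNat := if_pos hs
    rw [this]
    exact_mod_cast Int.toNat_of_nonneg (hz0 s hs)
  have hsum : ∀ (c : ℕ × ℕ → ℕ) (p : ℕ) (ρ : ℝ), (∀ s ∈ S, (c s : ℝ) ≤ 1 + (s.1 : ℝ) + s.2) →
      ∑ s ∈ S, (c s : ℝ) * x s = ρ → (p : ℝ) = ρ * m → ∑ s ∈ S, c s * n s = p := by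
    intro c p ρ hc hρ hp
    have hlt : |(∑ s ∈ S, (c s : ℝ) * n s) - p| < 1 := by
      rw [hp, ← hρ, sum_mul, ← sum_sub_distrib]
      calc |∑ s ∈ S, ((c s : ℝ) * n s - c s * x s * m)|
          ≤ ∑ s ∈ S, |(c s : ℝ) * n s - c s * x s * m| := abs_sum_le_sum_abs _ _
        _ ≤ ∑ s ∈ S, (1 + (s.1 : ℝ) + s.2) * (1 / (1 + W)) := by
            refine sum_le_sum fun s hs => ?_
            have e : (c s : ℝ) * n s - c s * x s * m = c s * -(m * x s - z s) := by
              rw [hn s hs]; ring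
            rw [e, abs_mul, abs_neg, abs_of_nonneg (Nat.cast_nonneg _)]
            exact mul_le_mul (hc s hs) (hz s hs).le (abs_nonneg _) (by positivity)
        _ = W / (1 + W) := by rw [← sum_mul]; ring
        _ < 1 := by rw [div_lt_one (by positivity)]; linarith
    have hlt' : |((∑ s ∈ S, c s * n s : ℕ) : ℤ) - (p : ℤ)| < 1 := by
      have : ((|((∑ s ∈ S, c s * n s : ℕ) : ℤ) - (p : ℤ)| : ℤ) : ℝ) < 1 := by
        push_cast
        exact hlt
      exact_mod_cast this
    have := Int.abs_lt_one_iff.1 hlt'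
    omega
  have hcast : ∀ (ρ : ℚ) (p : ℕ), (p : ℚ) = ρ * m → (p : ℝ) = (ρ : ℝ) * m := by
    intro ρ p h
    exact_mod_cast congrArg (fun q : ℚ => (q : ℝ)) h
  refine ⟨m, ?_, hm0, hiξ, hiθ, n, ?_, ⟨?_, ?_⟩, ?_⟩
  · exact hMr.trans (Nat.le_mul_of_pos_right _ (Nat.mul_pos ξ.den_pos θ.den_pos))
  · rw [mem_piAntidiag]
    constructor
    · have := hsum (fun _ => 1) m 1 (fun s _ => by push_cast; linarith [Nat.cast_nonneg (α := ℝ) s.1, Nat.cast_nonneg (α := ℝ) s.2]) (by simpa using h1) (by simp)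
      simpa using this
    · intro s hs
      by_contra h
      exact hs (if_neg h)
  · exact hsum (fun s => s.1) _ ξ (fun s _ => by linarith [Nat.cast_nonneg (α := ℝ) s.1, Nat.cast_nonneg (α := ℝ) s.2]) h2 (hcast _ _ hiξ)
  · exact hsum (fun s => s.2) _ θ (fun s _ => by linarith [Nat.cast_nonneg (α := ℝ) s.1, Nat.cast_nonneg (α := ℝ) s.2]) h3 (hcast _ _ hiθ)
  · intro s
    by_cases hs : s ∈ S
    · have e : (n s : ℝ) / m - x s = -(m * x s - z s) / m := by
        rw [hn s hs]; field_simp; ring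
      rw [e, abs_div, abs_neg, abs_of_pos hm']
      gcongr
      exact ((hz s hs).trans_le hδ1).le
    · have : n s = 0 := if_neg hs
      rw [this, hoff s hs]
      simp

lemma aux_main (S : Finset (ℕ × ℕ)) (w : ℕ × ℕ → ℝ) (hw : ∀ s ∈ S, 0 < w s)
    (P : ℝ[X][X]) (hP : P = ∑ s ∈ S, monomial s.1 (monomial s.2 (w s)))
    (ξ θ : ℚ) (hξ : 0 < ξ) (hθ : 0 < θ) (L : Set ℕ)
    (hL : L = {l : ℕ | 0 < l ∧ ((⌊ξ * (l : ℚ)⌋₊ : ℚ) = ξ * l) ∧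
      ((⌊θ * (l : ℚ)⌋₊ : ℚ) = θ * l) ∧
      0 < ((P ^ l).coeff ⌊ξ * (l : ℚ)⌋₊).coeff ⌊θ * (l : ℚ)⌋₊}) :
    (∀ t ∈ L, ∀ j : ℕ, 0 < j → j * t ∈ L) ∧
    (L.Nonempty → ∃ x : ℕ × ℕ → ℝ, (∀ s, 0 ≤ x s) ∧ ∑ s ∈ S, x s = 1 ∧
      ∑ s ∈ S, (s.1 : ℝ) * x s = ξ ∧ ∑ s ∈ S, (s.2 : ℝ) * x s = θ ∧
      (∀ y : ℕ × ℕ → ℝ, (∀ s, 0 ≤ y s) → ∑ s ∈ S, y s = 1 →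
        ∑ s ∈ S, (s.1 : ℝ) * y s = ξ → ∑ s ∈ S, (s.2 : ℝ) * y s = θ →
        auxF S w y ≤ auxF S w x) ∧
      Tendsto (fun l : ℕ => (1 / (l : ℝ)) *
          Real.log (((P ^ l).coeff ⌊ξ * (l : ℚ)⌋₊).coeff ⌊θ * (l : ℚ)⌋₊))
        (atTop ⊓ 𝓟 L) (nhds (auxF S w x))) := by
  have hnn : ∀ l p q, 0 ≤ ((P ^ l).coeff p).coeff q := by
    intro l p q
    rw [hP, aux_coeff]
    exact sum_nonneg fun n _ => (auxT_pos S w hw n).le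
  set A : ℕ → ℝ := fun l => ((P ^ l).coeff ⌊ξ * (l : ℚ)⌋₊).coeff ⌊θ * (l : ℚ)⌋₊ with hA
  have hmem : ∀ l, l ∈ L ↔ 0 < l ∧ ((⌊ξ * (l : ℚ)⌋₊ : ℚ) = ξ * l) ∧
      ((⌊θ * (l : ℚ)⌋₊ : ℚ) = θ * l) ∧ 0 < A l := by
    intro l; rw [hL]; rfl
  have hAeq : ∀ l, A l = ∑ n ∈ (piAntidiag S l).filter
      (fun n => ∑ s ∈ S, s.1 * n s = ⌊ξ * (l : ℚ)⌋₊ ∧ ∑ s ∈ S, s.2 * n s = ⌊θ * (l : ℚ)⌋₊),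
      auxT S w n := by
    intro l
    simp only [hA]
    rw [hP, aux_coeff]
  have hfl : ∀ (ρ : ℚ) (l m : ℕ), (⌊ρ * (l : ℚ)⌋₊ : ℚ) = ρ * l → (⌊ρ * (m : ℚ)⌋₊ : ℚ) = ρ * m →
      ⌊ρ * ((l + m : ℕ) : ℚ)⌋₊ = ⌊ρ * (l : ℚ)⌋₊ + ⌊ρ * (m : ℚ)⌋₊ := by
    intro ρ l m h1 h2
    have : ρ * ((l + m : ℕ) : ℚ) = ((⌊ρ * (l : ℚ)⌋₊ + ⌊ρ * (m : ℚ)⌋₊ : ℕ) : ℚ) := by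
      push_cast
      rw [h1, h2]; ring
    rw [this, Nat.floor_natCast]
  have hadd : ∀ l ∈ L, ∀ m ∈ L, l + m ∈ L ∧ A l * A m ≤ A (l + m) := by
    intro l hl m hm
    rw [hmem] at hl hm
    obtain ⟨l0, l1, l2, l3⟩ := hl
    obtain ⟨m0, m1, m2, m3⟩ := hm
    have e1 := hfl ξ l m l1 m1
    have e2 := hfl θ l m l2 m2
    have hle : A l * A m ≤ A (l + m) := by
      simp only [hA]
      rw [e1, e2, pow_add]
      exact aux_super _ _ (hnn l) (hnn m) _ _ _ _
    refine ⟨(hmem _).2 ⟨by omega, ?_, ?_, (mul_pos l3 m3).trans_le hle⟩, hle⟩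
    · rw [e1]; push_cast; rw [l1, m1]; ring
    · rw [e2]; push_cast; rw [l2, m2]; ring
  refine ⟨?_, ?_⟩
  · intro t ht j hj
    induction j, hj using Nat.le_induction with
    | base => simpa using ht
    | succ j hj ih =>
      rw [Nat.succ_mul]
      exact (hadd _ ih t ht).1
  intro hne
  -- feasible points from indices
  let K : Set (ℕ × ℕ → ℝ) := (Set.univ.pi fun s => Set.Icc (0 : ℝ) (if s ∈ S then 1 else 0)) ∩
    {x | ∑ s ∈ S, x s = 1 ∧ ∑ s ∈ S, (s.1 : ℝ) * x s = ξ ∧ ∑ s ∈ S, (s.2 : ℝ) * x s = θ}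
  have hK : IsCompact K := by
    refine (isCompact_univ_pi fun s => isCompact_Icc).inter_right ?_
    refine IsClosed.inter ?_ (IsClosed.inter ?_ ?_)
    · exact isClosed_eq (continuous_finsetSum _ fun s _ => continuous_apply s) continuous_const
    · exact isClosed_eq (continuous_finsetSum _ fun s _ =>
        continuous_const.mul (continuous_apply s)) continuous_const
    · exact isClosed_eq (continuous_finsetSum _ fun s _ =>
        continuous_const.mul (continuous_apply s)) continuous_const
  have hKmk : ∀ y : ℕ × ℕ → ℝ, (∀ s, 0 ≤ y s) → ∑ s ∈ S, y s = 1 →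
        ∑ s ∈ S, (s.1 : ℝ) * y s = ξ → ∑ s ∈ S, (s.2 : ℝ) * y s = θ →
        ∃ x ∈ K, auxF S w x = auxF S w y := by
    intro y y0 y1 y2 y3
    have hc : ∀ s ∈ S, (if s ∈ S then y s else 0) = y s := fun s hs => if_pos hs
    refine ⟨fun s => if s ∈ S then y s else 0, ⟨?_, ?_, ?_, ?_⟩, ?_⟩
    · intro s _
      by_cases hs : s ∈ S
      · simp only [hs, if_true]
        exact ⟨y0 s, y1 ▸ single_le_sum (fun s _ => y0 s) hs⟩
      · simp [hs]
    · rw [← y1]; exact sum_congr rfl hc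
    · rw [← y2]; exact sum_congr rfl fun s hs => by simp only [hc s hs]
    · rw [← y3]; exact sum_congr rfl fun s hs => by simp only [hc s hs]
    · exact sum_congr rfl fun s hs => by simp only [hc s hs]
  have hcast : ∀ (ρ : ℚ) (l p : ℕ), (p : ℚ) = ρ * l → (p : ℝ) = (ρ : ℝ) * l := by
    intro ρ l p h
    exact_mod_cast congrArg (fun q : ℚ => (q : ℝ)) h
  have hfeas : ∀ l ∈ L, ∀ n ∈ (piAntidiag S l).filter
      (fun n => ∑ s ∈ S, s.1 * n s = ⌊ξ * (l : ℚ)⌋₊ ∧ ∑ s ∈ S, s.2 * n s = ⌊θ * (l : ℚ)⌋₊),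
      ∃ x ∈ K, auxF S w x = auxF S w (fun s => (n s : ℝ) / l) := by
    intro l hl n hn
    rw [hmem] at hl
    obtain ⟨l0, l1, l2, l3⟩ := hl
    rw [mem_filter, mem_piAntidiag] at hn
    obtain ⟨⟨n1, -⟩, n2, n3⟩ := hn
    have l0' : (0 : ℝ) < l := by exact_mod_cast l0
    apply hKmk
    · intro s; positivity
    · rw [← sum_div, div_eq_one_iff_eq l0'.ne']; exact_mod_cast n1
    · simp only [← mul_div_assoc]
      rw [← sum_div, div_eq_iff l0'.ne', ← hcast ξ l _ l1, ← n2]; push_cast; rfl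
    · simp only [← mul_div_assoc]
      rw [← sum_div, div_eq_iff l0'.ne', ← hcast θ l _ l2, ← n3]; push_cast; rfl
  have hKne : K.Nonempty := by
    obtain ⟨l, hl⟩ := hne
    have h3 := ((hmem l).1 hl).2.2.2
    rw [hAeq] at h3
    obtain ⟨n, hn, -⟩ := exists_ne_zero_of_sum_ne_zero h3.ne'
    obtain ⟨x, hx, -⟩ := hfeas l hl n hn
    exact ⟨x, hx⟩
  obtain ⟨x, hxK, hmax⟩ := hK.exists_isMaxOn hKne (auxF_cont S w).continuousOn
  have hmax' : ∀ y ∈ K, auxF S w y ≤ auxF S w x := fun y hy => hmax hy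
  have hx0 : ∀ s, 0 ≤ x s := fun s => (hxK.1 s trivial).1
  have hoff : ∀ s, s ∉ S → x s = 0 := fun s hs => by
    have := (hxK.1 s trivial).2
    rw [if_neg hs] at this
    exact le_antisymm this (hx0 s)
  obtain ⟨x1, x2, x3⟩ := hxK.2
  refine ⟨x, hx0, x1, x2, x3, ?_, ?_⟩
  · intro y y0 y1 y2 y3
    obtain ⟨z, hz, e⟩ := hKmk y y0 y1 y2 y3
    rw [← e]; exact hmax' z hz
  set G := auxF S w x with hG
  refine aux_fekete L (fun l => Real.log (A l)) (fun l hl => ((hmem l).1 hl).1) ?_ G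
    (fun l => (2 * (S.card : ℝ) + 1) * (1 + Real.log ((l : ℝ) + 1))) (aux_err _) ?_ ?_
  · intro l hl m hm
    have h := hadd l hl m hm
    have hA1 := ((hmem l).1 hl).2.2.2
    have hA2 := ((hmem m).1 hm).2.2.2
    refine ⟨h.1, ?_⟩
    rw [← Real.log_mul hA1.ne' hA2.ne']
    exact Real.log_le_log (mul_pos hA1 hA2) h.2
  · intro l hl
    have hA1 := ((hmem l).1 hl).2.2.2
    have l0 := ((hmem l).1 hl).1
    have l0' : (0 : ℝ) < l := by exact_mod_cast l0
    set E := ((S.card : ℝ) + 1) * (1 + Real.log ((l : ℝ) + 1)) with hE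
    have hle : A l ≤ ((l : ℝ) + 1) ^ S.card * Real.exp (l * G + E) := by
      rw [hAeq]
      refine (sum_le_card_nsmul _ _ (Real.exp (l * G + E)) ?_).trans ?_
      · intro n hn
        obtain ⟨y, hy, e⟩ := hfeas l hl n hn
        have h1 := auxT_log S w hw n l l0 (mem_piAntidiag.1 (mem_filter.1 hn).1).1
        have h2 := (abs_le.1 h1).2
        have h3 := hmax' y hy
        rw [e] at h3
        have h4 := mul_le_mul_of_nonneg_left h3 l0'.le
        rw [← Real.log_le_iff_le_exp (auxT_pos S w hw n)]
        linarith
      · rw [nsmul_eq_mul]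
        refine mul_le_mul_of_nonneg_right ?_ (Real.exp_pos _).le
        have := (card_filter_le (piAntidiag S l) (fun n => ∑ s ∈ S, s.1 * n s = ⌊ξ * (l : ℚ)⌋₊ ∧
          ∑ s ∈ S, s.2 * n s = ⌊θ * (l : ℚ)⌋₊)).trans (aux_card S l)
        exact_mod_cast this
    have h5 := Real.log_le_log hA1 hle
    rw [Real.log_mul (by positivity) (by positivity), Real.log_exp, Real.log_pow] at h5
    have h6 : (0 : ℝ) ≤ S.card := Nat.cast_nonneg _
    rw [hE] at h5
    nlinarith
  · intro ε hε
    choose m hm1 hm2 hm3 hm4 n hn1 hn2 hn3 using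
      aux_approx S x ξ θ hξ hθ hx0 hoff x1 x2 x3
    have hmt : Tendsto m atTop atTop := tendsto_atTop_mono hm1 tendsto_id
    have hconv : Tendsto (fun j => (fun s => (n j s : ℝ) / m j)) atTop (nhds x) := by
      rw [tendsto_pi_nhds]
      intro s
      rw [tendsto_iff_dist_tendsto_zero]
      refine squeeze_zero (fun _ => dist_nonneg) (fun j => ?_)
        ((tendsto_const_div_atTop_nhds_zero_nat (1 : ℝ)).comp hmt)
      rw [Real.dist_eq]
      exact hn3 j s
    have hF := ((auxF_cont S w).tendsto x).comp hconv
    have hE := (aux_err ((S.card : ℝ) + 1)).comp hmt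
    have hd := hF.sub hE
    rw [sub_zero] at hd
    obtain ⟨j, hj⟩ := ((tendsto_order.1 hd).1 (G - ε) (by rw [hG]; linarith)).exists
    have m0' : (0 : ℝ) < m j := by exact_mod_cast hm2 j
    have hle : auxT S w (n j) ≤ A (m j) := by
      rw [hAeq]
      exact single_le_sum (f := auxT S w) (fun k _ => (auxT_pos S w hw k).le)
        (mem_filter.2 ⟨hn1 j, hn2 j⟩)
    have hTp := auxT_pos S w hw (n j)
    refine ⟨m j, (hmem _).2 ⟨hm2 j, hm3 j, hm4 j, hTp.trans_le hle⟩, ?_⟩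
    have h1 := (abs_le.1 (auxT_log S w hw (n j) (m j) (hm2 j) (mem_piAntidiag.1 (hn1 j)).1)).1
    have h2 := Real.log_le_log hTp hle
    refine hj.le.trans ?_
    simp only [Function.comp]
    rw [le_div_iff₀ m0', sub_mul, div_mul_cancel₀ _ m0'.ne']
    linarith

/-- **Lemma** (exponential growth rate of coefficients of polynomial powers, bivariate).
Let `B(x,y) = 1 + ∑_{u=1}^k ∑_{v=c}^d B_{u,v} x^u y^v` with `k ≥ 1`, `1 ≤ c ≤ d`,
`B_{u,v} ≥ 0`; set `B_{0,0} = 1` and `S = {(i,j) : B_{i,j} > 0}`.  Let `L` be the set of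
positive integers `l` with `ξ l, θ l` integers and `Coeff[B^l, x^{ξ l} y^{θ l}] > 0`.
Then (a) `t ∈ L` implies `j t ∈ L` for all `j > 0`, so `L` is empty or infinite; and
(b) if `L ≠ ∅`, the limit over `l ∈ L` of `(1/l) log Coeff[B^l, x^{ξ l} y^{θ l}]` exists
and equals the maximum of `∑_{(i,j) ∈ S} η_{i,j} log(B_{i,j}/η_{i,j})` subject to
`η ≥ 0`, `∑ η_{i,j} = 1`, `∑ i η_{i,j} = ξ`, `∑ j η_{i,j} = θ`.
(The bivariate polynomial is represented as an element of `Polynomial (Polynomial ℝ)`,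
the outer variable being `x`.) -/
theorem growth_rate_coeff_pow_bivariate (k c d : ℕ) (hk : 1 ≤ k) (hc : 1 ≤ c) (hcd : c ≤ d)
    (b : ℕ → ℕ → ℝ) (hb00 : b 0 0 = 1)
    (hnn : ∀ u v, 1 ≤ u → u ≤ k → c ≤ v → v ≤ d → 0 ≤ b u v)
    (hsupp : ∀ u v, ¬(u = 0 ∧ v = 0) → ¬(1 ≤ u ∧ u ≤ k ∧ c ≤ v ∧ v ≤ d) → b u v = 0)
    (P : Polynomial (Polynomial ℝ))
    (hP : P = ∑ u ∈ Finset.range (k + 1),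
      Polynomial.C (∑ v ∈ Finset.range (d + 1),
        Polynomial.C (b u v) * Polynomial.X ^ v) * Polynomial.X ^ u)
    (ξ θ : ℚ) (hξ : 0 < ξ) (hθ : 0 < θ)
    (L : Set ℕ)
    (hL : L = {l : ℕ | 0 < l ∧ ((⌊ξ * (l : ℚ)⌋₊ : ℚ) = ξ * l) ∧
      ((⌊θ * (l : ℚ)⌋₊ : ℚ) = θ * l) ∧
      0 < ((P ^ l).coeff ⌊ξ * (l : ℚ)⌋₊).coeff ⌊θ * (l : ℚ)⌋₊}) :
    (∀ t ∈ L, ∀ j : ℕ, 0 < j → j * t ∈ L) ∧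
    (L = ∅ ∨ L.Infinite) ∧
    (L.Nonempty → ∃ Glim : ℝ,
      IsGreatest {x : ℝ | ∃ η : ℕ → ℕ → ℝ, (∀ i j, 0 ≤ η i j) ∧
        (∑ ij ∈ ((Finset.range (k + 1)) ×ˢ (Finset.range (d + 1))).filter
            (fun ij => 0 < b ij.1 ij.2), η ij.1 ij.2 = 1) ∧
        (∑ ij ∈ ((Finset.range (k + 1)) ×ˢ (Finset.range (d + 1))).filter
            (fun ij => 0 < b ij.1 ij.2), (ij.1 : ℝ) * η ij.1 ij.2 = (ξ : ℝ)) ∧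
        (∑ ij ∈ ((Finset.range (k + 1)) ×ˢ (Finset.range (d + 1))).filter
            (fun ij => 0 < b ij.1 ij.2), (ij.2 : ℝ) * η ij.1 ij.2 = (θ : ℝ)) ∧
        x = ∑ ij ∈ ((Finset.range (k + 1)) ×ˢ (Finset.range (d + 1))).filter
            (fun ij => 0 < b ij.1 ij.2),
          η ij.1 ij.2 * Real.log (b ij.1 ij.2 / η ij.1 ij.2)} Glim ∧
      Filter.Tendsto
        (fun l : ℕ => (1 / (l : ℝ)) *
          Real.log (((P ^ l).coeff ⌊ξ * (l : ℚ)⌋₊).coeff ⌊θ * (l : ℚ)⌋₊))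
        (Filter.atTop ⊓ Filter.principal L) (nhds Glim)) := by
  have hb : ∀ u v, 0 ≤ b u v := by
    intro u v
    by_cases h1 : u = 0 ∧ v = 0
    · rw [h1.1, h1.2, hb00]; exact zero_le_one
    · by_cases h2 : 1 ≤ u ∧ u ≤ k ∧ c ≤ v ∧ v ≤ d
      · exact hnn u v h2.1 h2.2.1 h2.2.2.1 h2.2.2.2
      · rw [hsupp u v h1 h2]
  rw [aux_P k d b hb] at hP
  set S := ((Finset.range (k + 1)) ×ˢ (Finset.range (d + 1))).filter
            (fun ij => 0 < b ij.1 ij.2) with hS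
  have hw : ∀ s ∈ S, 0 < (fun s : ℕ × ℕ => b s.1 s.2) s := fun s hs => (mem_filter.1 hs).2
  obtain ⟨hA, hB⟩ := aux_main S (fun s => b s.1 s.2) hw P hP ξ θ hξ hθ L hL
  refine ⟨hA, ?_, ?_⟩
  · rcases Set.eq_empty_or_nonempty L with h | ⟨t, ht⟩
    · exact Or.inl h
    · right
      have ht0 : 0 < t := by rw [hL] at ht; exact ht.1
      refine Set.infinite_of_not_bddAbove ?_
      rintro ⟨N, hN⟩
      have h1 := hN (hA t ht (N + 1) (Nat.succ_pos N))
      have h2 : N + 1 ≤ (N + 1) * t := Nat.le_mul_of_pos_right _ ht0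
      omega
  · intro hne
    obtain ⟨x, x0, x1, x2, x3, hmax, hlim⟩ := hB hne
    refine ⟨_, ⟨⟨fun i j => x (i, j), fun i j => x0 _, x1, x2, x3, ?_⟩, ?_⟩, hlim⟩
    · exact (auxF_eq S (fun s => b s.1 s.2) hw x).symm
    · rintro y ⟨η, h0, h1, h2, h3, rfl⟩
      refine le_of_eq_of_le (auxF_eq S (fun s => b s.1 s.2) hw (fun s => η s.1 s.2)) ?_
      exact hmax (fun s => η s.1 s.2) (fun s => h0 _ _) h1 h2 h3
end
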